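/- There exists a constant C > 0, depending only on T, α, β, K and δ, such that for every classical solution (v,u,θ,w,b) of the planar compressible MHD system on ℝ × [0,T] with (K,δ)-admissible initial data, one has sup_{0≤t≤T} ∫_ℝ u_x(x,t)² dx + ∫₀^T ∫_ℝ ( u_t² + u_xx² ) dx dt ≤ C. -/

import Mathlib

open MeasureTheory Set Filter

noncomputable section

/-- Viscosity function `μ(z) = 1 + α z^(−α)` (here `μ̃₁ = 1`, `μ̃₂ = α`). -/
def visc (α z : ℝ) : ℝ := 1 + α * z ^ (-α)

/-- Squared Euclidean norm on `ℝ × ℝ` (used for the transverse fields `w, b ∈ ℝ²`). -/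
def sq2 (p : ℝ × ℝ) : ℝ := p.1 ^ 2 + p.2 ^ 2

/-- Partial derivative with respect to the first (spatial) variable. -/
def pdx {E : Type*} [NormedAddCommGroup E] [NormedSpace ℝ E]
    (f : ℝ → ℝ → E) (x t : ℝ) : E := deriv (fun y => f y t) x

/-- Partial derivative with respect to the second (time) variable, taken within `[0, T]`
(so it is one-sided at the endpoints). -/
def pdt (T : ℝ) {E : Type*} [NormedAddCommGroup E] [NormedSpace ℝ E]
    (f : ℝ → ℝ → E) (x t : ℝ) : E := derivWithin (fun s => f x s) (Icc 0 T) t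

/-- A classical solution of the planar compressible MHD system (in Lagrangian coordinates,
with all physical constants normalized to `1` and `μ̃₂ = α`) on `ℝ × [0,T]`:
all the derivatives appearing in the equations exist and are continuous, `v, θ > 0`,
the five equations hold pointwise, the solution tends to `(1,0,1,0,0)` as `|x| → ∞`
uniformly in `t ∈ [0,T]`, and `v−1, u, θ−1, b, w` and their first spatial derivatives
are square-integrable in `x` for each `t ∈ [0,T]`. -/
structure IsClassicalSolution (α β T : ℝ) (v u θ : ℝ → ℝ → ℝ)
    (w b : ℝ → ℝ → ℝ × ℝ) : Prop where
  v_pos : ∀ x : ℝ, ∀ t ∈ Icc (0:ℝ) T, 0 < v x t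
  θ_pos : ∀ x : ℝ, ∀ t ∈ Icc (0:ℝ) T, 0 < θ x t
  diff_x : ∀ x : ℝ, ∀ t ∈ Icc (0:ℝ) T,
    DifferentiableAt ℝ (fun y => v y t) x ∧ DifferentiableAt ℝ (fun y => u y t) x ∧
    DifferentiableAt ℝ (fun y => θ y t) x ∧ DifferentiableAt ℝ (fun y => w y t) x ∧
    DifferentiableAt ℝ (fun y => b y t) x
  diff_xx : ∀ x : ℝ, ∀ t ∈ Icc (0:ℝ) T,
    DifferentiableAt ℝ (fun y => pdx u y t) x ∧ DifferentiableAt ℝ (fun y => pdx θ y t) x ∧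
    DifferentiableAt ℝ (fun y => pdx w y t) x ∧ DifferentiableAt ℝ (fun y => pdx b y t) x
  diff_t : ∀ x : ℝ, ∀ t ∈ Icc (0:ℝ) T,
    DifferentiableWithinAt ℝ (fun s => v x s) (Icc 0 T) t ∧
    DifferentiableWithinAt ℝ (fun s => u x s) (Icc 0 T) t ∧
    DifferentiableWithinAt ℝ (fun s => θ x s) (Icc 0 T) t ∧
    DifferentiableWithinAt ℝ (fun s => w x s) (Icc 0 T) t ∧
    DifferentiableWithinAt ℝ (fun s => b x s) (Icc 0 T) t
  cont : ContinuousOn (fun p : ℝ × ℝ =>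
      (v p.1 p.2, u p.1 p.2, θ p.1 p.2, w p.1 p.2, b p.1 p.2)) (univ ×ˢ Icc 0 T)
  cont_dx : ContinuousOn (fun p : ℝ × ℝ =>
      (pdx v p.1 p.2, pdx u p.1 p.2, pdx θ p.1 p.2, pdx w p.1 p.2, pdx b p.1 p.2))
      (univ ×ˢ Icc 0 T)
  cont_dxx : ContinuousOn (fun p : ℝ × ℝ =>
      (pdx (pdx u) p.1 p.2, pdx (pdx θ) p.1 p.2, pdx (pdx w) p.1 p.2, pdx (pdx b) p.1 p.2))
      (univ ×ˢ Icc 0 T)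
  cont_dt : ContinuousOn (fun p : ℝ × ℝ =>
      (pdt T v p.1 p.2, pdt T u p.1 p.2, pdt T θ p.1 p.2, pdt T w p.1 p.2, pdt T b p.1 p.2))
      (univ ×ˢ Icc 0 T)
  eq_mass : ∀ x : ℝ, ∀ t ∈ Icc (0:ℝ) T, pdt T v x t = pdx u x t
  eq_mom : ∀ x : ℝ, ∀ t ∈ Icc (0:ℝ) T,
    pdt T u x t + pdx (fun y s => θ y s / v y s + sq2 (b y s) / 2) x t
      = pdx (fun y s => visc α (v y s) * pdx u y s / v y s) x t
  eq_w : ∀ x : ℝ, ∀ t ∈ Icc (0:ℝ) T,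
    pdt T w x t - pdx b x t = pdx (fun y s => (v y s)⁻¹ • pdx w y s) x t
  eq_b : ∀ x : ℝ, ∀ t ∈ Icc (0:ℝ) T,
    pdt T (fun y s => v y s • b y s) x t - pdx w x t
      = pdx (fun y s => (v y s)⁻¹ • pdx b y s) x t
  eq_temp : ∀ x : ℝ, ∀ t ∈ Icc (0:ℝ) T,
    pdt T θ x t + θ x t / v x t * pdx u x t
      = pdx (fun y s => θ y s ^ β * pdx θ y s / v y s) x t
        + (visc α (v x t) * pdx u x t ^ 2 + sq2 (pdx w x t) + sq2 (pdx b x t)) / v x t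
  farfield : ∀ ε > (0:ℝ), ∃ M : ℝ, ∀ x : ℝ, ∀ t ∈ Icc (0:ℝ) T, M ≤ |x| →
    |v x t - 1| < ε ∧ |u x t| < ε ∧ |θ x t - 1| < ε ∧
    Real.sqrt (sq2 (b x t)) < ε ∧ Real.sqrt (sq2 (w x t)) < ε
  sq_int : ∀ t ∈ Icc (0:ℝ) T,
    Integrable (fun x => (v x t - 1) ^ 2) ∧ Integrable (fun x => (u x t) ^ 2) ∧
    Integrable (fun x => (θ x t - 1) ^ 2) ∧ Integrable (fun x => sq2 (b x t)) ∧
    Integrable (fun x => sq2 (w x t)) ∧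
    Integrable (fun x => (pdx v x t) ^ 2) ∧ Integrable (fun x => (pdx u x t) ^ 2) ∧
    Integrable (fun x => (pdx θ x t) ^ 2) ∧ Integrable (fun x => sq2 (pdx b x t)) ∧
    Integrable (fun x => sq2 (pdx w x t))

/-- The initial data of a solution are `(K, δ)`-admissible: the `H¹`-type norm of
`(v₀−1, u₀, θ₀−1, b₀, w₀)` is at most `K²` and `v₀ ≥ δ`, `θ₀ ≥ δ`. -/
def Admissible (K δ : ℝ) (v u θ : ℝ → ℝ → ℝ) (w b : ℝ → ℝ → ℝ × ℝ) : Prop :=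
  (∫ x : ℝ, ((v x 0 - 1) ^ 2 + (u x 0) ^ 2 + (θ x 0 - 1) ^ 2 + sq2 (b x 0) + sq2 (w x 0)
      + (pdx v x 0) ^ 2 + (pdx u x 0) ^ 2 + (pdx θ x 0) ^ 2
      + sq2 (pdx b x 0) + sq2 (pdx w x 0))) ≤ K ^ 2 ∧
  (∀ x : ℝ, δ ≤ v x 0) ∧ (∀ x : ℝ, δ ≤ θ x 0)

/-! ### One-variable calculus on intervals -/

theorem integral_le_of_cont {f g : ℝ → ℝ} {a b : ℝ} (hab : a ≤ b) (hf : Continuous f)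
    (hg : Continuous g) (h : ∀ x ∈ Icc a b, f x ≤ g x) :
    ∫ x in a..b, f x ≤ ∫ x in a..b, g x :=
  intervalIntegral.integral_mono_on hab (hf.intervalIntegrable _ _) (hg.intervalIntegrable _ _) h

theorem integral_nonneg_of_cont {f : ℝ → ℝ} {a b : ℝ} (hab : a ≤ b)
    (h : ∀ x ∈ Icc a b, 0 ≤ f x) : 0 ≤ ∫ x in a..b, f x :=
  intervalIntegral.integral_nonneg hab h

theorem integral_subinterval_le {f : ℝ → ℝ} {a b c d : ℝ} (hca : c ≤ a) (hab : a ≤ b)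
    (hbd : b ≤ d) (hf : Continuous f) (h : ∀ x ∈ Icc c d, 0 ≤ f x) :
    ∫ x in a..b, f x ≤ ∫ x in c..d, f x := by
  refine intervalIntegral.integral_mono_interval hca hab hbd ?_ (hf.intervalIntegrable _ _)
  filter_upwards [ae_restrict_mem measurableSet_Ioc] with x hx
  exact h x ⟨hx.1.le, hx.2⟩

theorem integral_add_cont {f g : ℝ → ℝ} (a b : ℝ) (hf : Continuous f) (hg : Continuous g) :
    ∫ x in a..b, (f x + g x) = (∫ x in a..b, f x) + ∫ x in a..b, g x :=
  intervalIntegral.integral_add (hf.intervalIntegrable _ _) (hg.intervalIntegrable _ _)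

theorem integral_sub_cont {f g : ℝ → ℝ} (a b : ℝ) (hf : Continuous f) (hg : Continuous g) :
    ∫ x in a..b, (f x - g x) = (∫ x in a..b, f x) - ∫ x in a..b, g x :=
  intervalIntegral.integral_sub (hf.intervalIntegrable _ _) (hg.intervalIntegrable _ _)

/-- Integral form of a pointwise bound by a linear combination of two functions. -/
theorem integral_le_lin2 {f g₁ g₂ : ℝ → ℝ} {a b : ℝ} (c₁ c₂ : ℝ) (hab : a ≤ b)
    (hf : Continuous f) (h₁ : Continuous g₁) (h₂ : Continuous g₂)
    (h : ∀ x ∈ Icc a b, f x ≤ c₁ * g₁ x + c₂ * g₂ x) :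
    ∫ x in a..b, f x ≤ c₁ * (∫ x in a..b, g₁ x) + c₂ * ∫ x in a..b, g₂ x := by
  refine (integral_le_of_cont hab hf (by fun_prop) h).trans (le_of_eq ?_)
  rw [integral_add_cont _ _ (by fun_prop) (by fun_prop), intervalIntegral.integral_const_mul,
    intervalIntegral.integral_const_mul]

theorem integral_le_lin3 {f g₁ g₂ g₃ : ℝ → ℝ} {a b : ℝ} (c₁ c₂ c₃ : ℝ) (hab : a ≤ b)
    (hf : Continuous f) (h₁ : Continuous g₁) (h₂ : Continuous g₂) (h₃ : Continuous g₃)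
    (h : ∀ x ∈ Icc a b, f x ≤ c₁ * g₁ x + c₂ * g₂ x + c₃ * g₃ x) :
    ∫ x in a..b, f x ≤ c₁ * (∫ x in a..b, g₁ x) + c₂ * (∫ x in a..b, g₂ x)
      + c₃ * ∫ x in a..b, g₃ x := by
  refine (integral_le_of_cont hab hf (by fun_prop) h).trans (le_of_eq ?_)
  rw [integral_add_cont _ _ (by fun_prop) (by fun_prop),
    integral_add_cont _ _ (by fun_prop) (by fun_prop), intervalIntegral.integral_const_mul,
    intervalIntegral.integral_const_mul, intervalIntegral.integral_const_mul]

theorem integral_le_lin4 {f g₁ g₂ g₃ g₄ : ℝ → ℝ} {a b : ℝ} (c₁ c₂ c₃ c₄ : ℝ) (hab : a ≤ b)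
    (hf : Continuous f) (h₁ : Continuous g₁) (h₂ : Continuous g₂) (h₃ : Continuous g₃)
    (h₄ : Continuous g₄)
    (h : ∀ x ∈ Icc a b, f x ≤ c₁ * g₁ x + c₂ * g₂ x + c₃ * g₃ x + c₄ * g₄ x) :
    ∫ x in a..b, f x ≤ c₁ * (∫ x in a..b, g₁ x) + c₂ * (∫ x in a..b, g₂ x)
      + c₃ * (∫ x in a..b, g₃ x) + c₄ * ∫ x in a..b, g₄ x := by
  refine (integral_le_of_cont hab hf (by fun_prop) h).trans (le_of_eq ?_)
  rw [integral_add_cont _ _ (by fun_prop) (by fun_prop),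
    integral_add_cont _ _ (by fun_prop) (by fun_prop),
    integral_add_cont _ _ (by fun_prop) (by fun_prop), intervalIntegral.integral_const_mul,
    intervalIntegral.integral_const_mul, intervalIntegral.integral_const_mul,
    intervalIntegral.integral_const_mul]

/-- Cauchy–Schwarz for continuous functions on an interval. -/
theorem sq_integral_mul_le {f g : ℝ → ℝ} {a b : ℝ} (hab : a ≤ b) (hf : Continuous f)
    (hg : Continuous g) :
    (∫ x in a..b, f x * g x) ^ 2 ≤ (∫ x in a..b, f x ^ 2) * ∫ x in a..b, g x ^ 2 := by
  have key : ∀ l : ℝ, 0 ≤ (∫ x in a..b, g x ^ 2) * (l * l) + (-2 * ∫ x in a..b, f x * g x) * l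
      + ∫ x in a..b, f x ^ 2 := by
    intro l
    have h0 : 0 ≤ ∫ x in a..b, (f x - l * g x) ^ 2 :=
      integral_nonneg_of_cont hab fun x _ => sq_nonneg _
    have h1 : ∫ x in a..b, (f x - l * g x) ^ 2
        ≤ (l * l) * (∫ x in a..b, g x ^ 2) + (-2 * l) * (∫ x in a..b, f x * g x)
          + 1 * ∫ x in a..b, f x ^ 2 :=
      integral_le_lin3 _ _ _ hab (by fun_prop) (by fun_prop) (by fun_prop) (by fun_prop)
        fun x _ => le_of_eq (by ring)
    nlinarith
  have := discrim_le_zero key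
  unfold discrim at this
  nlinarith

theorem integral_deriv_eq {f f' : ℝ → ℝ} (a b : ℝ) (hd : ∀ x, HasDerivAt f (f' x) x)
    (hf' : Continuous f') : ∫ x in a..b, f' x = f b - f a :=
  intervalIntegral.integral_eq_sub_of_hasDerivAt (fun x _ => hd x) (hf'.intervalIntegrable _ _)

/-- A `C¹` function on a unit interval is bounded by its mean and the integral of the absolute
value of its derivative. -/
theorem le_integral_unit {f f' : ℝ → ℝ} {a x : ℝ} (hx : x ∈ Icc a (a + 1))
    (hd : ∀ x, HasDerivAt f (f' x) x) (hf' : Continuous f') :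
    f x ≤ (∫ y in a..(a + 1), f y) + ∫ y in a..(a + 1), |f' y| := by
  have hf : Continuous f := continuous_iff_continuousAt.2 fun x => (hd x).continuousAt
  have key : ∀ y ∈ Icc a (a + 1), f x ≤ f y + ∫ y in a..(a + 1), |f' y| := by
    intro y hy
    have h1 : ∫ z in y..x, f' z = f x - f y := integral_deriv_eq _ _ hd hf'
    have h2 : |∫ z in y..x, f' z| ≤ ∫ z in a..(a + 1), |f' z| := by
      rcases le_total y x with h | h
      · exact (intervalIntegral.abs_integral_le_integral_abs h).trans
          (integral_subinterval_le hy.1 h hx.2 hf'.abs fun _ _ => abs_nonneg _)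
      · rw [intervalIntegral.integral_symm, abs_neg]
        exact (intervalIntegral.abs_integral_le_integral_abs h).trans
          (integral_subinterval_le hx.1 h hy.2 hf'.abs fun _ _ => abs_nonneg _)
    have := le_abs_self (∫ z in y..x, f' z)
    linarith
  have h3 := integral_le_of_cont (f := fun _ => f x)
    (g := fun y => f y + ∫ y in a..(a + 1), |f' y|) (by linarith : a ≤ a + 1) (by fun_prop)
    (by fun_prop) key
  rw [integral_add_cont _ _ (by fun_prop) (by fun_prop)] at h3
  simpa using h3

/-- Grönwall's inequality in integral form. -/
theorem gronwall_integral {y A : ℝ → ℝ} {T c : ℝ} (hy : Continuous y) (hA : Continuous A)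
    (hA0 : ∀ s ∈ Icc 0 T, 0 ≤ A s)
    (h : ∀ t ∈ Icc 0 T, y t ≤ c + ∫ s in (0:ℝ)..t, A s * y s) :
    ∀ t ∈ Icc 0 T, y t ≤ c * Real.exp (∫ s in (0:ℝ)..t, A s) := by
  intro t ht
  set G : ℝ → ℝ := fun t => c + ∫ s in (0:ℝ)..t, A s * y s with hG
  have hGd : ∀ t, HasDerivAt G (A t * y t) t := fun t =>
    ((hA.mul hy).integral_hasStrictDerivAt 0 t).hasDerivAt.const_add c
  have hAd : ∀ t, HasDerivAt (fun t => ∫ s in (0:ℝ)..t, A s) (A t) t := fun t =>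
    (hA.integral_hasStrictDerivAt 0 t).hasDerivAt
  set H : ℝ → ℝ := fun t => G t * Real.exp (-∫ s in (0:ℝ)..t, A s) with hH
  have hHd : ∀ t, HasDerivAt H (A t * y t * Real.exp (-∫ s in (0:ℝ)..t, A s)
      + G t * (Real.exp (-∫ s in (0:ℝ)..t, A s) * -A t)) t := fun t =>
    (hGd t).mul ((hAd t).neg.exp)
  have hanti : AntitoneOn H (Icc 0 T) := by
    refine antitoneOn_of_deriv_nonpos (convex_Icc 0 T)
      (fun t _ => (hHd t).continuousAt.continuousWithinAt)
      (fun t _ => (hHd t).differentiableAt.differentiableWithinAt) ?_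
    intro t ht
    rw [interior_Icc] at ht
    have ht' : t ∈ Icc 0 T := ⟨ht.1.le, ht.2.le⟩
    rw [(hHd t).deriv]
    have h1 := h t ht'
    have h2 := mul_le_mul_of_nonneg_left h1 (hA0 t ht')
    have h3 := Real.exp_pos (-∫ s in (0:ℝ)..t, A s)
    have h4 : A t * y t - A t * G t ≤ 0 := by simp only [hG]; linarith
    nlinarith
  have h5 := hanti ⟨le_rfl, ht.1.trans ht.2⟩ ht ht.1
  have h6 : H 0 = c := by simp [hH, hG]
  have h7 : G t ≤ c * Real.exp (∫ s in (0:ℝ)..t, A s) := by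
    have h8 : G t = H t * Real.exp (∫ s in (0:ℝ)..t, A s) := by
      simp only [hH]; rw [mul_assoc, ← Real.exp_add]; simp
    rw [h8, ← h6]
    exact mul_le_mul_of_nonneg_right h5 (Real.exp_pos _).le
  exact (h t ht).trans h7

/-- Grönwall's inequality with an extra dissipation term. -/
theorem gronwall_dissipation {y A d : ℝ → ℝ} {T c M : ℝ} (hy : Continuous y) (hA : Continuous A)
    (hA0 : ∀ s ∈ Icc 0 T, 0 ≤ A s)
    (hd0 : ∀ t ∈ Icc 0 T, 0 ≤ d t) (hc : 0 ≤ c)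
    (hM : ∫ s in (0:ℝ)..T, A s ≤ M)
    (h : ∀ t ∈ Icc 0 T, y t + d t ≤ c + ∫ s in (0:ℝ)..t, A s * y s) :
    ∀ t ∈ Icc 0 T, y t + d t ≤ c + M * (c * Real.exp M) := by
  have h1 : ∀ t ∈ Icc 0 T, y t ≤ c * Real.exp M := by
    intro t ht
    refine (gronwall_integral (c := c) hy hA hA0 (fun t ht => ?_) t ht).trans ?_
    · exact (by linarith [hd0 t ht] : y t ≤ y t + d t).trans (h t ht)
    · gcongr
      exact (integral_subinterval_le le_rfl ht.1 ht.2 hA hA0).trans hM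
  intro t ht
  refine (h t ht).trans ?_
  have h2 : ∫ s in (0:ℝ)..t, A s * y s ≤ ∫ s in (0:ℝ)..t, (c * Real.exp M) * A s := by
    refine integral_le_of_cont ht.1 (by fun_prop) (by fun_prop) fun s hs => ?_
    have hs' : s ∈ Icc 0 T := ⟨hs.1, hs.2.trans ht.2⟩
    rw [mul_comm]
    exact mul_le_mul_of_nonneg_right (h1 s hs') (hA0 s hs')
  rw [intervalIntegral.integral_const_mul] at h2
  have h3 : ∫ s in (0:ℝ)..t, A s ≤ M :=
    (integral_subinterval_le le_rfl ht.1 ht.2 hA hA0).trans hM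
  have h4 : 0 ≤ c * Real.exp M := by positivity
  nlinarith

/-! ### Space-time integrals -/

theorem continuous_slice_integral {f : ℝ → ℝ → ℝ} (hf : Continuous fun p : ℝ × ℝ => f p.1 p.2)
    (a b : ℝ) : Continuous fun t => ∫ x in a..b, f x t := by
  refine intervalIntegral.continuous_parametric_intervalIntegral_of_continuous' ?_ a b
  change Continuous fun p : ℝ × ℝ => f p.2 p.1
  fun_prop

theorem integral_swap_cont {f : ℝ → ℝ → ℝ} (hf : Continuous fun p : ℝ × ℝ => f p.1 p.2)
    (a b c d : ℝ) :
    ∫ x in a..b, ∫ t in c..d, f x t = ∫ t in c..d, ∫ x in a..b, f x t := by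
  refine MeasureTheory.intervalIntegral_intervalIntegral_swap ?_
  refine IntegrableOn.mono_set (t := uIcc a b ×ˢ uIcc c d) ?_
    (prod_mono uIoc_subset_uIcc uIoc_subset_uIcc)
  exact ContinuousOn.integrableOn_compact (isCompact_uIcc.prod isCompact_uIcc)
    (show Continuous (Function.uncurry f) from hf).continuousOn

theorem integral_time_deriv {f ft : ℝ → ℝ} {T : ℝ} (hf : Continuous f) (hft : Continuous ft)
    (hd : ∀ t ∈ Ioo 0 T, HasDerivAt f (ft t) t) {s t : ℝ} (hs : 0 ≤ s) (hst : s ≤ t) (ht : t ≤ T) :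
    ∫ r in s..t, ft r = f t - f s :=
  intervalIntegral.integral_eq_sub_of_hasDerivAt_of_le hst hf.continuousOn
    (fun r hr => hd r ⟨hs.trans_lt hr.1, hr.2.trans_le ht⟩) (hft.intervalIntegrable _ _)

/-- Evolution of the weighted space integral of a function. -/
theorem weighted_evolution {F Ft : ℝ → ℝ → ℝ} {φ : ℝ → ℝ} {T : ℝ} (hφ : Continuous φ)
    (hF : Continuous fun p : ℝ × ℝ => F p.1 p.2) (hFt : Continuous fun p : ℝ × ℝ => Ft p.1 p.2)
    (hd : ∀ x, ∀ t ∈ Ioo 0 T, HasDerivAt (fun s => F x s) (Ft x t) t) (a b : ℝ) {t : ℝ}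
    (ht : t ∈ Icc 0 T) :
    ∫ x in a..b, φ x * F x t
      = (∫ x in a..b, φ x * F x 0) + ∫ s in (0:ℝ)..t, ∫ x in a..b, φ x * Ft x s := by
  rw [← integral_swap_cont (f := fun x s => φ x * Ft x s) (by fun_prop),
    ← integral_add_cont _ _ (by fun_prop)
      (continuous_slice_integral (f := fun s x => φ x * Ft x s) (by fun_prop) _ _)]
  refine intervalIntegral.integral_congr fun x _ => ?_
  rw [intervalIntegral.integral_const_mul, integral_time_deriv (by fun_prop) (by fun_prop)
    (hd x) le_rfl ht.1 ht.2]
  ring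

/-! ### The cutoff -/

/-- The cutoff profile `1 - (x/L)²` on `[-L, L]`. -/
def cut (L x : ℝ) : ℝ := 1 - (x / L) ^ 2

@[fun_prop] theorem continuous_cut (L : ℝ) : Continuous (cut L) := by
  unfold cut; fun_prop

theorem cut_nonneg {L x : ℝ} (hL : 1 ≤ L) (hx : x ∈ Icc (-L) L) : 0 ≤ cut L x := by
  have hL0 : 0 < L := by linarith
  have : |x / L| ≤ 1 := by
    rw [abs_div, abs_of_pos hL0, div_le_one hL0]; exact abs_le.2 hx
  have := (sq_le_one_iff_abs_le_one _).2 this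
  unfold cut; linarith

theorem cut_le_one (L x : ℝ) : cut L x ≤ 1 := by
  unfold cut; nlinarith [sq_nonneg (x / L)]

theorem cut_left {L : ℝ} (hL : 1 ≤ L) : cut L (-L) = 0 := by
  unfold cut; field_simp; simp

theorem cut_right {L : ℝ} (hL : 1 ≤ L) : cut L L = 0 := by
  unfold cut; field_simp; simp

theorem half_le_cut_sq {L R x : ℝ} (hR : 0 < R) (hL : 2 * R ≤ L) (hx : x ∈ Icc (-R) R) :
    1 / 2 ≤ cut L x ^ 2 := by
  have hL0 : 0 < L := by linarith
  have h1 : |x / L| ≤ 1 / 2 := by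
    rw [abs_div, abs_of_pos hL0, div_le_iff₀ hL0]; linarith [abs_le.2 hx]
  have h2 : (x / L) ^ 2 ≤ 1 / 4 := by
    have := sq_le_sq' (by linarith [abs_nonneg (x / L)]) h1
    rw [sq_abs] at this; linarith
  unfold cut; nlinarith

/-- The derivative of the cutoff. -/
def cutd (L x : ℝ) : ℝ := -(2 * x / L ^ 2)

@[fun_prop] theorem continuous_cutd (L : ℝ) : Continuous (cutd L) := by
  unfold cutd; fun_prop

theorem hasDerivAt_cut {L : ℝ} (x : ℝ) : HasDerivAt (cut L) (cutd L x) x := by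
  have h : HasDerivAt (fun x : ℝ => 1 - (x / L) ^ 2) _ x :=
    (((hasDerivAt_id x).div_const L).fun_pow 2).const_sub 1
  refine h.congr_deriv ?_
  simp only [cutd, id]
  ring

theorem abs_cutd_le {L x : ℝ} (hL : 1 ≤ L) (hx : x ∈ Icc (-L) L) : |cutd L x| ≤ 2 / L := by
  have hL0 : 0 < L := by linarith
  unfold cutd
  rw [abs_neg, abs_div, abs_of_pos (by positivity : 0 < L ^ 2), abs_mul, abs_two,
    div_le_div_iff₀ (by positivity) hL0]
  nlinarith [abs_le.2 hx]

theorem hasDerivAt_cut_sq {L : ℝ} (x : ℝ) :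
    HasDerivAt (fun x => cut L x ^ 2) (2 * cut L x * cutd L x) x := by
  simpa using (hasDerivAt_cut (L := L) x).fun_pow 2

/-- Integration by parts against the squared cutoff. -/
theorem cut_integral_by_parts {G G' : ℝ → ℝ} {L : ℝ} (hL : 1 ≤ L)
    (hd : ∀ x, HasDerivAt G (G' x) x) (hG' : Continuous G') :
    ∫ x in (-L)..L, cut L x ^ 2 * G' x = -∫ x in (-L)..L, 2 * cut L x * cutd L x * G x := by
  have := intervalIntegral.integral_mul_deriv_eq_deriv_mul (a := -L) (b := L)
    (u := fun x => cut L x ^ 2) (v := G) (u' := fun x => 2 * cut L x * cutd L x) (v' := G')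
    (fun x _ => hasDerivAt_cut_sq x) (fun x _ => hd x)
    ((by fun_prop : Continuous _).intervalIntegrable _ _) (hG'.intervalIntegrable _ _)
  rw [this, cut_left hL, cut_right hL]
  simp

/-- Weighted Sobolev inequality. -/
theorem cut_sobolev {f f' : ℝ → ℝ} {L l x : ℝ} (hL : 1 ≤ L) (hl : 0 < l)
    (hx : x ∈ Icc (-L) L) (hd : ∀ x, HasDerivAt f (f' x) x) (hf' : Continuous f') :
    cut L x ^ 2 * f x ^ 2 ≤ (1 + 1 / l) * (∫ y in (-L)..L, cut L y ^ 2 * f y ^ 2)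
      + l * (∫ y in (-L)..L, cut L y ^ 2 * f' y ^ 2)
      + 4 / L * ∫ y in (-L)..L, f y ^ 2 := by
  have hf : Continuous f := continuous_iff_continuousAt.2 fun x => (hd x).continuousAt
  set a := min x (L - 1) with ha
  have ha1 : -L ≤ a := le_min hx.1 (by linarith)
  have ha2 : a + 1 ≤ L := by linarith [min_le_right x (L - 1)]
  have hxa : x ∈ Icc a (a + 1) := by
    refine ⟨min_le_left _ _, ?_⟩
    rcases min_cases x (L - 1) with ⟨h, _⟩ | ⟨h, _⟩
    · rw [ha, h]; linarith
    · rw [ha, h]; linarith [hx.2]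
  have hLL : -L ≤ L := by linarith
  have h1 := le_integral_unit (f := fun y => cut L y ^ 2 * f y ^ 2)
    (f' := fun y => 2 * cut L y * cutd L y * f y ^ 2 + cut L y ^ 2 * (2 * f y * f' y)) hxa
    (fun y => by simpa using (hasDerivAt_cut_sq (L := L) y).fun_mul ((hd y).fun_pow 2)) (by fun_prop)
  have h2 : ∫ y in a..(a + 1), cut L y ^ 2 * f y ^ 2 ≤ ∫ y in (-L)..L, cut L y ^ 2 * f y ^ 2 :=
    integral_subinterval_le ha1 (by linarith) ha2 (by fun_prop) fun y _ => by positivity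
  have h3 := integral_subinterval_le
    (f := fun y => |2 * cut L y * cutd L y * f y ^ 2 + cut L y ^ 2 * (2 * f y * f' y)|)
    ha1 (by linarith) ha2 (by fun_prop) fun y _ => abs_nonneg _
  have h4 := integral_le_lin3
    (f := fun y => |2 * cut L y * cutd L y * f y ^ 2 + cut L y ^ 2 * (2 * f y * f' y)|)
    (g₁ := fun y => cut L y ^ 2 * f y ^ 2) (g₂ := fun y => cut L y ^ 2 * f' y ^ 2)
    (g₃ := fun y => f y ^ 2) (1 / l) l (4 / L) hLL (by fun_prop) (by fun_prop) (by fun_prop)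
    (by fun_prop) (fun y hy => by
      have c0 := cut_nonneg hL hy
      have c1 := cut_le_one L y
      have cd := abs_cutd_le hL hy
      refine (abs_add_le _ _).trans ?_
      have e1 : |2 * cut L y * cutd L y * f y ^ 2| ≤ 4 / L * f y ^ 2 := by
        rw [abs_mul, abs_of_nonneg (sq_nonneg (f y)), abs_mul, abs_mul, abs_two, abs_of_nonneg c0]
        refine mul_le_mul_of_nonneg_right ?_ (sq_nonneg _)
        have : 4 / L = 2 * (2 / L) := by ring
        rw [this, mul_assoc]
        have := mul_le_mul c1 cd (abs_nonneg _) zero_le_one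
        linarith
      have e2 : |cut L y ^ 2 * (2 * f y * f' y)|
          ≤ 1 / l * (cut L y ^ 2 * f y ^ 2) + l * (cut L y ^ 2 * f' y ^ 2) := by
        have e3 : 2 * f y * f' y ≤ 1 / l * f y ^ 2 + l * f' y ^ 2 := by
          have : 1 / l * f y ^ 2 + l * f' y ^ 2 - 2 * f y * f' y
              = 1 / l * (f y - l * f' y) ^ 2 := by field_simp; ring
          nlinarith [mul_nonneg (one_div_pos.2 hl).le (sq_nonneg (f y - l * f' y))]
        have e4 : -(2 * f y * f' y) ≤ 1 / l * f y ^ 2 + l * f' y ^ 2 := by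
          have : 1 / l * f y ^ 2 + l * f' y ^ 2 + 2 * f y * f' y
              = 1 / l * (f y + l * f' y) ^ 2 := by field_simp; ring
          nlinarith [mul_nonneg (one_div_pos.2 hl).le (sq_nonneg (f y + l * f' y))]
        rw [abs_mul, abs_of_nonneg (sq_nonneg (cut L y))]
        have := mul_le_mul_of_nonneg_left (abs_le'.2 ⟨e3, e4⟩) (sq_nonneg (cut L y))
        linarith
      linarith)
  linarith

/-! ### Averages of functions vanishing at infinity -/

/-- Neighbourhoods of spatial infinity, uniform in time. -/
def spaceInf : Filter (ℝ × ℝ) := comap Prod.fst (cocompact ℝ)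

theorem average_tendsto_zero {g : ℝ → ℝ → ℝ} (T : ℝ)
    (hg : Continuous fun p : ℝ × ℝ => g p.1 p.2)
    (hlim : Tendsto (fun p : ℝ × ℝ => g p.1 p.2) spaceInf (nhds 0)) :
    ∀ ε > 0, ∀ᶠ L in atTop, ∀ t ∈ Icc 0 T, ∫ x in (-L)..L, |g x t| ≤ ε * L := by
  intro ε hε
  have h1 : ∀ᶠ p : ℝ × ℝ in spaceInf, |g p.1 p.2| < ε / 4 := by
    have := (tendsto_order.1 hlim.abs).2 (ε / 4) (by simpa using by positivity)
    simpa using this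
  obtain ⟨s, hs, hsub⟩ := mem_comap.1 h1
  obtain ⟨K, hK, hKs⟩ := mem_cocompact.1 hs
  obtain ⟨M, hM⟩ := hK.isBounded.subset_closedBall 0
  have hfar : ∀ x t, max M 0 < |x| → |g x t| ≤ ε / 4 := by
    intro x t hx
    have : x ∈ s := hKs fun hxK => by
      have := hM hxK
      rw [mem_closedBall_zero_iff, Real.norm_eq_abs] at this
      exact absurd hx (not_lt.2 (this.trans (le_max_left _ _)))
    exact le_of_lt (hsub (a := (x, t)) this)
  set m := max M 0 + 1 with hm
  have hm0 : 0 < m := by positivity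
  obtain ⟨B, hB⟩ := (isCompact_Icc.prod isCompact_Icc : IsCompact (Icc (-m) m ×ˢ Icc 0 T)
    ).exists_bound_of_continuousOn hg.continuousOn
  filter_upwards [eventually_ge_atTop (max m (4 * m * |B| / ε))] with L hL t ht
  have hLm : m ≤ L := (le_max_left _ _).trans hL
  have hLB : 4 * m * |B| ≤ ε * L := by
    have := (le_max_right _ _).trans hL
    rw [div_le_iff₀ hε] at this; linarith
  have hc : Continuous fun x => |g x t| := by fun_prop
  rw [← intervalIntegral.integral_add_adjacent_intervals (b := -m) (hc.intervalIntegrable _ _)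
    (hc.intervalIntegrable _ _), ← intervalIntegral.integral_add_adjacent_intervals (b := m)
    (a := -m) (hc.intervalIntegrable _ _) (hc.intervalIntegrable _ _)]
  have i1 := integral_le_of_cont (f := fun x => |g x t|) (g := fun _ => ε / 4)
    (by linarith : -L ≤ -m) hc (by fun_prop) fun x hx => hfar x t (by
      rw [lt_abs]; right; linarith [hx.2])
  have i2 := integral_le_of_cont (f := fun x => |g x t|) (g := fun _ => |B|)
    (by linarith : -m ≤ m) hc (by fun_prop) fun x hx =>
      (hB (x, t) ⟨hx, ht⟩).trans (le_abs_self B)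
  have i3 := integral_le_of_cont (f := fun x => |g x t|) (g := fun _ => ε / 4)
    (by linarith : m ≤ L) hc (by fun_prop) fun x hx => hfar x t (by
      rw [lt_abs]; left; linarith [hx.1])
  simp only [intervalIntegral.integral_const, smul_eq_mul] at i1 i2 i3
  nlinarith

/-! ### The squared derivative of a function with one time derivative -/

/-- For `f` with continuous `f_t` and `f_xx`, the weighted integral of `f_x²` evolves
as if `f_xt` existed. -/
theorem cut_deriv_sq_evolution {f fx fxx ft : ℝ → ℝ → ℝ} {L T : ℝ} (hL : 1 ≤ L)
    (hf : Continuous fun p : ℝ × ℝ => f p.1 p.2)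
    (hfx : Continuous fun p : ℝ × ℝ => fx p.1 p.2)
    (hfxx : Continuous fun p : ℝ × ℝ => fxx p.1 p.2)
    (hft : Continuous fun p : ℝ × ℝ => ft p.1 p.2)
    (hdx : ∀ x t, HasDerivAt (fun y => f y t) (fx x t) x)
    (hdxx : ∀ x t, HasDerivAt (fun y => fx y t) (fxx x t) x)
    (hdt : ∀ x, ∀ t ∈ Ioo 0 T, HasDerivAt (fun s => f x s) (ft x t) t) {t : ℝ}
    (ht : t ∈ Icc 0 T) :
    ∫ x in (-L)..L, cut L x ^ 2 * fx x t ^ 2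
      = (∫ x in (-L)..L, cut L x ^ 2 * fx x 0 ^ 2)
        + ∫ s in (0:ℝ)..t, ∫ x in (-L)..L,
          -2 * (2 * cut L x * cutd L x * fx x s + cut L x ^ 2 * fxx x s) * ft x s := by
  set J : ℝ → ℝ := fun t => ∫ x in (-L)..L, cut L x ^ 2 * fx x t ^ 2 with hJ
  have hJc : Continuous J := continuous_slice_integral
    (f := fun x t => cut L x ^ 2 * fx x t ^ 2) (by fun_prop) _ _
  have hder : ∀ s ∈ Ioo 0 T, HasDerivAt J (∫ x in (-L)..L,
      -2 * (2 * cut L x * cutd L x * fx x s + cut L x ^ 2 * fxx x s) * ft x s) s := by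
    intro s hs
    set k : ℝ → ℝ → ℝ := fun x t => ∫ r in (0:ℝ)..1, ft x (s + r * (t - s)) with hk
    have hkc : Continuous fun p : ℝ × ℝ => k p.1 p.2 := by
      refine intervalIntegral.continuous_parametric_intervalIntegral_of_continuous'
        (f := fun (p : ℝ × ℝ) r => ft p.1 (s + r * (p.2 - s))) ?_ 0 1
      change Continuous fun q : (ℝ × ℝ) × ℝ => ft q.1.1 (s + q.2 * (q.1.2 - s))
      fun_prop
    have hkf : ∀ x, ∀ t ∈ Ioo 0 T, f x t - f x s = (t - s) * k x t := by
      intro x t ht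
      have h1 : (t - s) * k x t = ∫ r in s..t, ft x r := by
        have := intervalIntegral.mul_integral_comp_add_mul (a := 0) (b := 1)
          (f := fun r => ft x r) (t - s) s
        simp only [mul_zero, add_zero, mul_one, add_sub_cancel] at this
        rw [← this]
        simp only [hk, mul_comm]
      rw [h1]
      rcases le_total s t with h | h
      · exact (integral_time_deriv (by fun_prop) (by fun_prop) (hdt x) hs.1.le h ht.2.le).symm
      · rw [intervalIntegral.integral_symm,
          integral_time_deriv (by fun_prop) (by fun_prop) (hdt x) ht.1.le h hs.2.le]
        ring
    set N : ℝ → ℝ := fun t => ∫ x in (-L)..L,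
      -(2 * cut L x * cutd L x * (fx x t + fx x s) + cut L x ^ 2 * (fxx x t + fxx x s)) * k x t
      with hN
    have hNc : Continuous N := continuous_slice_integral
      (f := fun x t => -(2 * cut L x * cutd L x * (fx x t + fx x s)
        + cut L x ^ 2 * (fxx x t + fxx x s)) * k x t) (by fun_prop) _ _
    have hJN : ∀ t ∈ Ioo 0 T, J t - J s = (t - s) * N t := by
      intro t ht
      simp only [hJ, hN]
      rw [← integral_sub_cont _ _ (by fun_prop) (by fun_prop),
        ← intervalIntegral.integral_const_mul]
      have := intervalIntegral.integral_mul_deriv_eq_deriv_mul (a := -L) (b := L)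
        (u := fun x => cut L x ^ 2 * (fx x t + fx x s))
        (v := fun x => f x t - f x s)
        (u' := fun x => 2 * cut L x * cutd L x * (fx x t + fx x s)
          + cut L x ^ 2 * (fxx x t + fxx x s))
        (v' := fun x => fx x t - fx x s)
        (fun x _ => (hasDerivAt_cut_sq x).fun_mul ((hdxx x t).fun_add (hdxx x s)))
        (fun x _ => (hdx x t).fun_sub (hdx x s))
        ((by fun_prop : Continuous _).intervalIntegrable _ _)
        ((by fun_prop : Continuous _).intervalIntegrable _ _)
      simp only [cut_left hL, cut_right hL] at this
      calc ∫ x in (-L)..L, (cut L x ^ 2 * fx x t ^ 2 - cut L x ^ 2 * fx x s ^ 2)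
          = ∫ x in (-L)..L, cut L x ^ 2 * (fx x t + fx x s) * (fx x t - fx x s) :=
            intervalIntegral.integral_congr fun x _ => by ring
        _ = _ := by
            rw [this]
            simp only [ne_eq, OfNat.ofNat_ne_zero, not_false_eq_true, zero_pow, zero_mul,
              sub_zero, zero_sub]
            rw [← intervalIntegral.integral_neg]
            refine intervalIntegral.integral_congr fun x _ => ?_
            rw [hkf x t ht]; ring
    have hNs : N s = ∫ x in (-L)..L,
        -2 * (2 * cut L x * cutd L x * fx x s + cut L x ^ 2 * fxx x s) * ft x s := by
      refine intervalIntegral.integral_congr fun x _ => ?_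
      simp only [hk, sub_self, mul_zero, add_zero, intervalIntegral.integral_const, sub_zero,
        one_smul]
      ring
    rw [← hNs, hasDerivAt_iff_tendsto_slope]
    refine ((hNc.tendsto s).mono_left nhdsWithin_le_nhds).congr' ?_
    filter_upwards [self_mem_nhdsWithin,
      mem_nhdsWithin_of_mem_nhds (isOpen_Ioo.mem_nhds hs)] with t hts htT
    rw [slope_def_field, hJN t htT, mul_div_cancel_left₀]
    exact sub_ne_zero.2 hts
  have := integral_time_deriv (f := J) hJc (continuous_slice_integral (f := fun x s =>
    -2 * (2 * cut L x * cutd L x * fx x s + cut L x ^ 2 * fxx x s) * ft x s) (by fun_prop) _ _)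
    hder le_rfl ht.1 ht.2
  linarith

/-! ### Flows: classical solutions extended to all times -/

/-- The derivative of the viscosity function. -/
def dvisc (α z : ℝ) : ℝ := α * (-α * z ^ (-α - 1))

theorem hasDerivAt_visc (α : ℝ) {z : ℝ} (hz : 0 < z) : HasDerivAt (visc α) (dvisc α z) z :=
  ((Real.hasDerivAt_rpow_const (Or.inl hz.ne')).const_mul α).const_add 1

theorem one_le_visc {α z : ℝ} (hα : 0 ≤ α) (hz : 0 < z) : 1 ≤ visc α z := by
  have := mul_nonneg hα (Real.rpow_nonneg hz.le (-α))
  unfold visc; linarith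

/-- The data of a classical solution on `ℝ × [0, T]`, with all the derivatives involved extended
continuously to `ℝ × ℝ`; the transverse fields are indexed by their two components. -/
structure MHDFlow (α β T : ℝ) where
  v : ℝ → ℝ → ℝ
  vx : ℝ → ℝ → ℝ
  u : ℝ → ℝ → ℝ
  ux : ℝ → ℝ → ℝ
  uxx : ℝ → ℝ → ℝ
  ut : ℝ → ℝ → ℝ
  θ : ℝ → ℝ → ℝ
  θx : ℝ → ℝ → ℝ
  θxx : ℝ → ℝ → ℝ
  θt : ℝ → ℝ → ℝ
  w : Fin 2 → ℝ → ℝ → ℝ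
  wx : Fin 2 → ℝ → ℝ → ℝ
  wxx : Fin 2 → ℝ → ℝ → ℝ
  wt : Fin 2 → ℝ → ℝ → ℝ
  b : Fin 2 → ℝ → ℝ → ℝ
  bx : Fin 2 → ℝ → ℝ → ℝ
  bxx : Fin 2 → ℝ → ℝ → ℝ
  bt : Fin 2 → ℝ → ℝ → ℝ
  cont_v : Continuous fun p : ℝ × ℝ => v p.1 p.2
  cont_vx : Continuous fun p : ℝ × ℝ => vx p.1 p.2
  cont_u : Continuous fun p : ℝ × ℝ => u p.1 p.2
  cont_ux : Continuous fun p : ℝ × ℝ => ux p.1 p.2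
  cont_uxx : Continuous fun p : ℝ × ℝ => uxx p.1 p.2
  cont_ut : Continuous fun p : ℝ × ℝ => ut p.1 p.2
  cont_θ : Continuous fun p : ℝ × ℝ => θ p.1 p.2
  cont_θx : Continuous fun p : ℝ × ℝ => θx p.1 p.2
  cont_θxx : Continuous fun p : ℝ × ℝ => θxx p.1 p.2
  cont_θt : Continuous fun p : ℝ × ℝ => θt p.1 p.2
  cont_w : ∀ i, Continuous fun p : ℝ × ℝ => w i p.1 p.2
  cont_wx : ∀ i, Continuous fun p : ℝ × ℝ => wx i p.1 p.2
  cont_wxx : ∀ i, Continuous fun p : ℝ × ℝ => wxx i p.1 p.2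
  cont_wt : ∀ i, Continuous fun p : ℝ × ℝ => wt i p.1 p.2
  cont_b : ∀ i, Continuous fun p : ℝ × ℝ => b i p.1 p.2
  cont_bx : ∀ i, Continuous fun p : ℝ × ℝ => bx i p.1 p.2
  cont_bxx : ∀ i, Continuous fun p : ℝ × ℝ => bxx i p.1 p.2
  cont_bt : ∀ i, Continuous fun p : ℝ × ℝ => bt i p.1 p.2
  hasDeriv_v : ∀ x t, HasDerivAt (fun y => v y t) (vx x t) x
  hasDeriv_u : ∀ x t, HasDerivAt (fun y => u y t) (ux x t) x
  hasDeriv_ux : ∀ x t, HasDerivAt (fun y => ux y t) (uxx x t) x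
  hasDeriv_θ : ∀ x t, HasDerivAt (fun y => θ y t) (θx x t) x
  hasDeriv_θx : ∀ x t, HasDerivAt (fun y => θx y t) (θxx x t) x
  hasDeriv_w : ∀ i x t, HasDerivAt (fun y => w i y t) (wx i x t) x
  hasDeriv_wx : ∀ i x t, HasDerivAt (fun y => wx i y t) (wxx i x t) x
  hasDeriv_b : ∀ i x t, HasDerivAt (fun y => b i y t) (bx i x t) x
  hasDeriv_bx : ∀ i x t, HasDerivAt (fun y => bx i y t) (bxx i x t) x
  hasTDeriv_v : ∀ x, ∀ t ∈ Ioo 0 T, HasDerivAt (fun s => v x s) (ux x t) t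
  hasTDeriv_u : ∀ x, ∀ t ∈ Ioo 0 T, HasDerivAt (fun s => u x s) (ut x t) t
  hasTDeriv_θ : ∀ x, ∀ t ∈ Ioo 0 T, HasDerivAt (fun s => θ x s) (θt x t) t
  hasTDeriv_w : ∀ i x, ∀ t ∈ Ioo 0 T, HasDerivAt (fun s => w i x s) (wt i x t) t
  hasTDeriv_b : ∀ i x, ∀ t ∈ Ioo 0 T, HasDerivAt (fun s => b i x s) (bt i x t) t
  v_pos : ∀ x t, 0 < v x t
  θ_pos : ∀ x t, 0 < θ x t
  lim_v : Tendsto (fun p : ℝ × ℝ => v p.1 p.2) spaceInf (nhds 1)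
  lim_u : Tendsto (fun p : ℝ × ℝ => u p.1 p.2) spaceInf (nhds 0)
  lim_θ : Tendsto (fun p : ℝ × ℝ => θ p.1 p.2) spaceInf (nhds 1)
  lim_w : ∀ i, Tendsto (fun p : ℝ × ℝ => w i p.1 p.2) spaceInf (nhds 0)
  lim_b : ∀ i, Tendsto (fun p : ℝ × ℝ => b i p.1 p.2) spaceInf (nhds 0)
  eq_u : ∀ x t, ut x t = visc α (v x t) / v x t * uxx x t
    + (dvisc α (v x t) / v x t - visc α (v x t) / v x t ^ 2) * vx x t * ux x t
    - θx x t / v x t + θ x t * vx x t / v x t ^ 2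
    - (b 0 x t * bx 0 x t + b 1 x t * bx 1 x t)
  eq_w : ∀ i x t, wt i x t = bx i x t + wxx i x t / v x t - wx i x t * vx x t / v x t ^ 2
  eq_b : ∀ i x t, v x t * bt i x t + ux x t * b i x t
    = wx i x t + bxx i x t / v x t - bx i x t * vx x t / v x t ^ 2
  eq_θ : ∀ x t, θt x t = -(θ x t / v x t * ux x t)
    + (θ x t ^ β * θxx x t + β * θ x t ^ (β - 1) * θx x t ^ 2) / v x t
    - θ x t ^ β * θx x t * vx x t / v x t ^ 2
    + (visc α (v x t) * ux x t ^ 2 + (wx 0 x t ^ 2 + wx 1 x t ^ 2)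
      + (bx 0 x t ^ 2 + bx 1 x t ^ 2)) / v x t

namespace MHDFlow

variable {α β T : ℝ} (S : MHDFlow α β T)

section Continuity

variable {X : Type*} [TopologicalSpace X] {f g : X → ℝ}

@[fun_prop] theorem continuous_v (hf : Continuous f) (hg : Continuous g) :
    Continuous fun x => S.v (f x) (g x) := S.cont_v.comp (hf.prodMk hg)

@[fun_prop] theorem continuous_vx (hf : Continuous f) (hg : Continuous g) :
    Continuous fun x => S.vx (f x) (g x) := S.cont_vx.comp (hf.prodMk hg)

@[fun_prop] theorem continuous_u (hf : Continuous f) (hg : Continuous g) :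
    Continuous fun x => S.u (f x) (g x) := S.cont_u.comp (hf.prodMk hg)

@[fun_prop] theorem continuous_ux (hf : Continuous f) (hg : Continuous g) :
    Continuous fun x => S.ux (f x) (g x) := S.cont_ux.comp (hf.prodMk hg)

@[fun_prop] theorem continuous_uxx (hf : Continuous f) (hg : Continuous g) :
    Continuous fun x => S.uxx (f x) (g x) := S.cont_uxx.comp (hf.prodMk hg)

@[fun_prop] theorem continuous_ut (hf : Continuous f) (hg : Continuous g) :
    Continuous fun x => S.ut (f x) (g x) := S.cont_ut.comp (hf.prodMk hg)

@[fun_prop] theorem continuous_θ (hf : Continuous f) (hg : Continuous g) :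
    Continuous fun x => S.θ (f x) (g x) := S.cont_θ.comp (hf.prodMk hg)

@[fun_prop] theorem continuous_θx (hf : Continuous f) (hg : Continuous g) :
    Continuous fun x => S.θx (f x) (g x) := S.cont_θx.comp (hf.prodMk hg)

@[fun_prop] theorem continuous_θxx (hf : Continuous f) (hg : Continuous g) :
    Continuous fun x => S.θxx (f x) (g x) := S.cont_θxx.comp (hf.prodMk hg)

@[fun_prop] theorem continuous_θt (hf : Continuous f) (hg : Continuous g) :
    Continuous fun x => S.θt (f x) (g x) := S.cont_θt.comp (hf.prodMk hg)

@[fun_prop] theorem continuous_w (i : Fin 2) (hf : Continuous f) (hg : Continuous g) :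
    Continuous fun x => S.w i (f x) (g x) := (S.cont_w i).comp (hf.prodMk hg)

@[fun_prop] theorem continuous_wx (i : Fin 2) (hf : Continuous f) (hg : Continuous g) :
    Continuous fun x => S.wx i (f x) (g x) := (S.cont_wx i).comp (hf.prodMk hg)

@[fun_prop] theorem continuous_wxx (i : Fin 2) (hf : Continuous f) (hg : Continuous g) :
    Continuous fun x => S.wxx i (f x) (g x) := (S.cont_wxx i).comp (hf.prodMk hg)

@[fun_prop] theorem continuous_wt (i : Fin 2) (hf : Continuous f) (hg : Continuous g) :
    Continuous fun x => S.wt i (f x) (g x) := (S.cont_wt i).comp (hf.prodMk hg)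

@[fun_prop] theorem continuous_b (i : Fin 2) (hf : Continuous f) (hg : Continuous g) :
    Continuous fun x => S.b i (f x) (g x) := (S.cont_b i).comp (hf.prodMk hg)

@[fun_prop] theorem continuous_bx (i : Fin 2) (hf : Continuous f) (hg : Continuous g) :
    Continuous fun x => S.bx i (f x) (g x) := (S.cont_bx i).comp (hf.prodMk hg)

@[fun_prop] theorem continuous_bxx (i : Fin 2) (hf : Continuous f) (hg : Continuous g) :
    Continuous fun x => S.bxx i (f x) (g x) := (S.cont_bxx i).comp (hf.prodMk hg)

@[fun_prop] theorem continuous_bt (i : Fin 2) (hf : Continuous f) (hg : Continuous g) :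
    Continuous fun x => S.bt i (f x) (g x) := (S.cont_bt i).comp (hf.prodMk hg)

end Continuity

/-- The reciprocal of the specific volume. -/
def iv (x t : ℝ) : ℝ := (S.v x t)⁻¹

/-- The viscosity along the flow. -/
def mu (x t : ℝ) : ℝ := visc α (S.v x t)

/-- The derivative of the viscosity along the flow. -/
def dmu (x t : ℝ) : ℝ := dvisc α (S.v x t)

/-- A power of the temperature. -/
def θp (p x t : ℝ) : ℝ := S.θ x t ^ p

/-- The logarithm of the specific volume. -/
def lv (x t : ℝ) : ℝ := Real.log (S.v x t)

/-- The logarithm of the temperature. -/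
def lθ (x t : ℝ) : ℝ := Real.log (S.θ x t)

/-- The effective logarithm `log v - v ^ (-α)`, whose derivative in `v` is `μ(v) / v`. -/
def hv (x t : ℝ) : ℝ := Real.log (S.v x t) - S.v x t ^ (-α)

section Continuity

variable {X : Type*} [TopologicalSpace X] {f g : X → ℝ}

@[fun_prop] theorem continuous_iv (hf : Continuous f) (hg : Continuous g) :
    Continuous fun x => S.iv (f x) (g x) :=
  (S.continuous_v hf hg).inv₀ fun _ => (S.v_pos _ _).ne'

@[fun_prop] theorem continuous_mu (hf : Continuous f) (hg : Continuous g) :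
    Continuous fun x => S.mu (f x) (g x) :=
  (((S.continuous_v hf hg).rpow_const fun _ => Or.inl (S.v_pos _ _).ne').const_mul α).const_add 1

@[fun_prop] theorem continuous_dmu (hf : Continuous f) (hg : Continuous g) :
    Continuous fun x => S.dmu (f x) (g x) :=
  (((S.continuous_v hf hg).rpow_const fun _ => Or.inl (S.v_pos _ _).ne').const_mul (-α)).const_mul α

@[fun_prop] theorem continuous_θp (p : ℝ) (hf : Continuous f) (hg : Continuous g) :
    Continuous fun x => S.θp p (f x) (g x) :=
  (S.continuous_θ hf hg).rpow_const fun _ => Or.inl (S.θ_pos _ _).ne'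

@[fun_prop] theorem continuous_lv (hf : Continuous f) (hg : Continuous g) :
    Continuous fun x => S.lv (f x) (g x) :=
  (S.continuous_v hf hg).log fun _ => (S.v_pos _ _).ne'

@[fun_prop] theorem continuous_lθ (hf : Continuous f) (hg : Continuous g) :
    Continuous fun x => S.lθ (f x) (g x) :=
  (S.continuous_θ hf hg).log fun _ => (S.θ_pos _ _).ne'

@[fun_prop] theorem continuous_hv (hf : Continuous f) (hg : Continuous g) :
    Continuous fun x => S.hv (f x) (g x) :=
  ((S.continuous_v hf hg).log fun _ => (S.v_pos _ _).ne').sub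
    ((S.continuous_v hf hg).rpow_const fun _ => Or.inl (S.v_pos _ _).ne')

end Continuity

theorem iv_pos (x t : ℝ) : 0 < S.iv x t := inv_pos.2 (S.v_pos x t)

theorem v_mul_iv (x t : ℝ) : S.v x t * S.iv x t = 1 := mul_inv_cancel₀ (S.v_pos x t).ne'

theorem one_le_mu (hα : 0 ≤ α) (x t : ℝ) : 1 ≤ S.mu x t := one_le_visc hα (S.v_pos x t)

theorem θp_pos (p x t : ℝ) : 0 < S.θp p x t := Real.rpow_pos_of_pos (S.θ_pos x t) p

theorem θp_add (p q x t : ℝ) : S.θp (p + q) x t = S.θp p x t * S.θp q x t :=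
  Real.rpow_add (S.θ_pos x t) p q

theorem θp_one (x t : ℝ) : S.θp 1 x t = S.θ x t := Real.rpow_one _

theorem θp_zero (x t : ℝ) : S.θp 0 x t = 1 := Real.rpow_zero _

theorem lim_iv : Tendsto (fun p : ℝ × ℝ => S.iv p.1 p.2) spaceInf (nhds 1) := by
  simpa [iv] using S.lim_v.inv₀ one_ne_zero

theorem lim_mu : Tendsto (fun p : ℝ × ℝ => S.mu p.1 p.2) spaceInf (nhds (1 + α)) := by
  have : Tendsto (fun p : ℝ × ℝ => S.v p.1 p.2 ^ (-α)) spaceInf (nhds (1 ^ (-α))) :=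
    S.lim_v.rpow_const (Or.inl one_ne_zero)
  rw [Real.one_rpow] at this
  simpa [mu, visc] using (this.const_mul α).const_add 1

theorem lim_θp (q : ℝ) : Tendsto (fun p : ℝ × ℝ => S.θp q p.1 p.2) spaceInf (nhds 1) := by
  simpa [θp] using S.lim_θ.rpow_const (p := q) (Or.inl one_ne_zero)

theorem hasDeriv_iv (x t : ℝ) :
    HasDerivAt (fun y => S.iv y t) (-(S.vx x t * S.iv x t ^ 2)) x := by
  refine ((S.hasDeriv_v x t).fun_inv (S.v_pos x t).ne').congr_deriv ?_
  unfold iv; field_simp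

theorem hasDeriv_mu (x t : ℝ) :
    HasDerivAt (fun y => S.mu y t) (S.dmu x t * S.vx x t) x :=
  (hasDerivAt_visc α (S.v_pos x t)).comp x (S.hasDeriv_v x t)

theorem hasDeriv_θp (p x t : ℝ) :
    HasDerivAt (fun y => S.θp p y t) (p * S.θp (p - 1) x t * S.θx x t) x := by
  refine ((S.hasDeriv_θ x t).rpow_const (p := p) (Or.inl (S.θ_pos x t).ne')).congr_deriv ?_
  unfold θp; ring

theorem hasTDeriv_lv (x : ℝ) {t : ℝ} (ht : t ∈ Ioo 0 T) :
    HasDerivAt (fun s => S.lv x s) (S.ux x t * S.iv x t) t :=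
  (S.hasTDeriv_v x t ht).log (S.v_pos x t).ne'

theorem hasDerivAt_log_sub_rpow (α : ℝ) {z : ℝ} (hz : 0 < z) :
    HasDerivAt (fun z : ℝ => Real.log z - z ^ (-α)) (visc α z * z⁻¹) z := by
  refine ((Real.hasDerivAt_log hz.ne').sub
    (Real.hasDerivAt_rpow_const (p := -α) (Or.inl hz.ne'))).congr_deriv ?_
  rw [Real.rpow_sub_one hz.ne']
  unfold visc; field_simp; ring

theorem hasTDeriv_hv (x : ℝ) {t : ℝ} (ht : t ∈ Ioo 0 T) :
    HasDerivAt (fun s => S.hv x s) (S.mu x t * S.iv x t * S.ux x t) t :=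
  (hasDerivAt_log_sub_rpow α (S.v_pos x t)).comp t (S.hasTDeriv_v x t ht)

/-- The momentum equation in terms of the reciprocal volume. -/
theorem ut_eq (x t : ℝ) : S.ut x t = S.mu x t * S.iv x t * S.uxx x t
    + (S.dmu x t * S.iv x t - S.mu x t * S.iv x t ^ 2) * S.vx x t * S.ux x t
    - S.θx x t * S.iv x t + S.θ x t * S.vx x t * S.iv x t ^ 2
    - (S.b 0 x t * S.bx 0 x t + S.b 1 x t * S.bx 1 x t) := by
  rw [S.eq_u]; simp only [mu, iv, dmu, div_eq_mul_inv, inv_pow]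

theorem wt_eq (i : Fin 2) (x t : ℝ) : S.wt i x t = S.bx i x t + S.wxx i x t * S.iv x t
    - S.wx i x t * S.vx x t * S.iv x t ^ 2 := by
  rw [S.eq_w]; simp only [iv, div_eq_mul_inv, inv_pow]

theorem bt_eq (i : Fin 2) (x t : ℝ) : S.bt i x t = S.iv x t * (S.wx i x t - S.ux x t * S.b i x t
    + S.bxx i x t * S.iv x t - S.bx i x t * S.vx x t * S.iv x t ^ 2) := by
  have h := S.eq_b i x t
  simp only [div_eq_mul_inv, ← inv_pow] at h
  have h1 := S.v_mul_iv x t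
  unfold iv at *
  linear_combination (S.v x t)⁻¹ * h - S.bt i x t * h1

theorem θt_eq (x t : ℝ) : S.θt x t = -(S.θ x t * S.iv x t * S.ux x t)
    + (S.θp β x t * S.θxx x t + β * S.θp (β - 1) x t * S.θx x t ^ 2) * S.iv x t
    - S.θp β x t * S.θx x t * S.vx x t * S.iv x t ^ 2
    + (S.mu x t * S.ux x t ^ 2 + (S.wx 0 x t ^ 2 + S.wx 1 x t ^ 2)
      + (S.bx 0 x t ^ 2 + S.bx 1 x t ^ 2)) * S.iv x t := by
  rw [S.eq_θ]; simp only [mu, iv, θp, div_eq_mul_inv, inv_pow]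

/-- The space derivative of `v` is differentiable in time. -/
theorem hasTDeriv_vx (x : ℝ) {t : ℝ} (ht : t ∈ Ioo 0 T) :
    HasDerivAt (fun s => S.vx x s) (S.uxx x t) t := by
  have key : ∀ r ∈ Icc 0 T, S.vx x r = S.vx x 0 + ∫ s in (0:ℝ)..r, S.uxx x s := by
    intro r hr
    have h1 : ∀ y, S.v y r = S.v y 0 + ((∫ s in (0:ℝ)..r, S.ux 0 s)
        + ∫ z in (0:ℝ)..y, ∫ s in (0:ℝ)..r, S.uxx z s) := by
      intro y
      rw [integral_swap_cont (f := S.uxx) (by fun_prop),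
        ← integral_add_cont _ _ (by fun_prop)
          (continuous_slice_integral (f := S.uxx) (by fun_prop) _ _)]
      have h2 := integral_time_deriv (by fun_prop) (by fun_prop) (S.hasTDeriv_v y) le_rfl hr.1 hr.2
      rw [← sub_eq_iff_eq_add', ← h2]
      refine intervalIntegral.integral_congr fun s _ => ?_
      have h3 := integral_deriv_eq 0 y (fun z => S.hasDeriv_ux z s) (by fun_prop)
      rw [h3]; ring
    have h4 : HasDerivAt (fun y => S.v y 0 + ((∫ s in (0:ℝ)..r, S.ux 0 s)
        + ∫ z in (0:ℝ)..y, ∫ s in (0:ℝ)..r, S.uxx z s))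
        (S.vx x 0 + ∫ s in (0:ℝ)..r, S.uxx x s) x :=
      (S.hasDeriv_v x 0).add (((continuous_slice_integral (f := fun s z => S.uxx z s)
        (by fun_prop) _ _).integral_hasStrictDerivAt 0 x).hasDerivAt.const_add _)
    exact (S.hasDeriv_v x r).unique (h4.congr_of_eventuallyEq (Eventually.of_forall h1))
  have h5 : HasDerivAt (fun r => S.vx x 0 + ∫ s in (0:ℝ)..r, S.uxx x s) (S.uxx x t) t :=
    ((by fun_prop : Continuous fun s => S.uxx x s).integral_hasStrictDerivAt 0
      t).hasDerivAt.const_add _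
  refine h5.congr_of_eventuallyEq ?_
  filter_upwards [isOpen_Ioo.mem_nhds ht] with r hr
  exact key r ⟨hr.1.le, hr.2.le⟩

/-- The density of the initial norm. -/
def initDensity (x : ℝ) : ℝ :=
  (S.v x 0 - 1) ^ 2 + S.u x 0 ^ 2 + (S.θ x 0 - 1) ^ 2 + (S.b 0 x 0 ^ 2 + S.b 1 x 0 ^ 2)
    + (S.w 0 x 0 ^ 2 + S.w 1 x 0 ^ 2) + S.vx x 0 ^ 2 + S.ux x 0 ^ 2 + S.θx x 0 ^ 2
    + (S.bx 0 x 0 ^ 2 + S.bx 1 x 0 ^ 2) + (S.wx 0 x 0 ^ 2 + S.wx 1 x 0 ^ 2)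

/-- Admissible initial data. -/
structure Init (K δ : ℝ) : Prop where
  int_le : ∀ x y : ℝ, x ≤ y → ∫ z in x..y, S.initDensity z ≤ K ^ 2
  v_ge : ∀ x, δ ≤ S.v x 0
  θ_ge : ∀ x, δ ≤ S.θ x 0

@[fun_prop] theorem continuous_initDensity : Continuous S.initDensity := by
  unfold initDensity; fun_prop

end MHDFlow

/-! ### Weighted energy inequalities -/

namespace MHDFlow

variable {α β T : ℝ} (S : MHDFlow α β T)

/-- The energy density associated with a temperature potential `Ψ`. -/
def energy (Ψ : ℝ → ℝ) (x t : ℝ) : ℝ :=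
  1 / 2 * (S.u x t ^ 2 + (S.w 0 x t ^ 2 + S.w 1 x t ^ 2)
    + S.v x t * (S.b 0 x t ^ 2 + S.b 1 x t ^ 2)) + (S.v x t - 1 - S.lv x t) + Ψ (S.θ x t)

/-- The viscous, resistive and shear heating. -/
def heating (x t : ℝ) : ℝ :=
  S.mu x t * S.ux x t ^ 2 + (S.wx 0 x t ^ 2 + S.wx 1 x t ^ 2)
    + (S.bx 0 x t ^ 2 + S.bx 1 x t ^ 2)

/-- The dissipation density at temperature weight `ε`. -/
def dissipation (ε x t : ℝ) : ℝ :=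
  ε * S.θp (β - 1 - ε) x t * S.θx x t ^ 2 * S.iv x t + S.θp (-ε) x t * S.heating x t * S.iv x t

/-- The energy flux at temperature weight `ε`. -/
def energyFlux (ε x t : ℝ) : ℝ :=
  S.u x t * (S.mu x t * S.ux x t * S.iv x t)
    + S.u x t * (1 - S.θ x t * S.iv x t - 1 / 2 * (S.b 0 x t ^ 2 + S.b 1 x t ^ 2))
    + (1 - S.θp (-ε) x t) * (S.θp β x t * S.θx x t * S.iv x t)
    + (S.w 0 x t * S.b 0 x t + S.w 1 x t * S.b 1 x t)
    + (S.w 0 x t * (S.wx 0 x t * S.iv x t) + S.w 1 x t * (S.wx 1 x t * S.iv x t))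
    + (S.b 0 x t * (S.bx 0 x t * S.iv x t) + S.b 1 x t * (S.bx 1 x t * S.iv x t))

/-- The time derivative of the energy density. -/
def energyRate (ε x t : ℝ) : ℝ :=
  S.u x t * S.ut x t + (S.w 0 x t * S.wt 0 x t + S.w 1 x t * S.wt 1 x t)
    + 1 / 2 * S.ux x t * (S.b 0 x t ^ 2 + S.b 1 x t ^ 2)
    + S.v x t * (S.b 0 x t * S.bt 0 x t + S.b 1 x t * S.bt 1 x t)
    + (S.ux x t - S.ux x t * S.iv x t) + (1 - S.θp (-ε) x t) * S.θt x t

/-- The compression source at temperature weight `ε`. -/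
def compression (ε x t : ℝ) : ℝ := (S.θp (1 - ε) x t - 1) * S.iv x t * S.ux x t

@[fun_prop] theorem continuous_heating {X : Type*} [TopologicalSpace X] {f g : X → ℝ}
    (hf : Continuous f) (hg : Continuous g) :
    Continuous fun x => S.heating (f x) (g x) := by
  unfold heating; fun_prop

@[fun_prop] theorem continuous_dissipation (ε : ℝ) {X : Type*} [TopologicalSpace X] {f g : X → ℝ}
    (hf : Continuous f) (hg : Continuous g) :
    Continuous fun x => S.dissipation ε (f x) (g x) := by
  unfold dissipation; fun_prop

@[fun_prop] theorem continuous_energyFlux (ε : ℝ) {X : Type*} [TopologicalSpace X] {f g : X → ℝ}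
    (hf : Continuous f) (hg : Continuous g) :
    Continuous fun x => S.energyFlux ε (f x) (g x) := by
  unfold energyFlux; fun_prop

@[fun_prop] theorem continuous_energyRate (ε : ℝ) {X : Type*} [TopologicalSpace X] {f g : X → ℝ}
    (hf : Continuous f) (hg : Continuous g) :
    Continuous fun x => S.energyRate ε (f x) (g x) := by
  unfold energyRate; fun_prop

@[fun_prop] theorem continuous_compression (ε : ℝ) {X : Type*} [TopologicalSpace X] {f g : X → ℝ}
    (hf : Continuous f) (hg : Continuous g) :
    Continuous fun x => S.compression ε (f x) (g x) := by
  unfold compression; fun_prop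

theorem continuous_energy {ε : ℝ} {Ψ : ℝ → ℝ}
    (hΨ : ∀ z > 0, HasDerivAt Ψ (1 - z ^ (-ε)) z) {X : Type*} [TopologicalSpace X] {f g : X → ℝ}
    (hf : Continuous f) (hg : Continuous g) :
    Continuous fun x => S.energy Ψ (f x) (g x) := by
  have : Continuous fun x => Ψ (S.θ (f x) (g x)) := by
    refine continuous_iff_continuousAt.2 fun x => ?_
    exact ContinuousAt.comp (f := fun x => S.θ (f x) (g x)) (hΨ _ (S.θ_pos _ _)).continuousAt
      (S.continuous_θ hf hg).continuousAt
  unfold energy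
  refine Continuous.add ?_ this
  fun_prop

theorem hasTDeriv_energy {ε : ℝ} {Ψ : ℝ → ℝ}
    (hΨ : ∀ z > 0, HasDerivAt Ψ (1 - z ^ (-ε)) z) (x : ℝ) {t : ℝ} (ht : t ∈ Ioo 0 T) :
    HasDerivAt (fun s => S.energy Ψ x s) (S.energyRate ε x t) t := by
  have hv := S.hasTDeriv_v x t ht
  have hu := S.hasTDeriv_u x t ht
  have hθ := (hΨ _ (S.θ_pos x t)).comp t (S.hasTDeriv_θ x t ht)
  have hw := fun i => S.hasTDeriv_w i x t ht
  have hb := fun i => S.hasTDeriv_b i x t ht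
  have hl := S.hasTDeriv_lv x ht
  have h := (((((hu.fun_pow 2).fun_add (((hw 0).fun_pow 2).fun_add ((hw 1).fun_pow 2))).fun_add
    (hv.fun_mul (((hb 0).fun_pow 2).fun_add ((hb 1).fun_pow 2)))).const_mul (1 / 2)).fun_add
    ((hv.sub_const 1).fun_sub hl)).fun_add hθ
  refine h.congr_deriv ?_
  simp only [energyRate, θp]
  push_cast
  ring

theorem hasDeriv_energyFlux (ε x t : ℝ) :
    HasDerivAt (fun y => S.energyFlux ε y t)
      (S.energyRate ε x t + S.dissipation ε x t - S.compression ε x t) x := by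
  have hv := S.hasDeriv_v x t
  have hu := S.hasDeriv_u x t
  have hux := S.hasDeriv_ux x t
  have hθ := S.hasDeriv_θ x t
  have hθx := S.hasDeriv_θx x t
  have hw := fun i => S.hasDeriv_w i x t
  have hb := fun i => S.hasDeriv_b i x t
  have hwx := fun i => S.hasDeriv_wx i x t
  have hbx := fun i => S.hasDeriv_bx i x t
  have hi := S.hasDeriv_iv x t
  have hm := S.hasDeriv_mu x t
  have h1 := hu.fun_mul ((hm.fun_mul hux).fun_mul hi)
  have h2 := hu.fun_mul (((hθ.fun_mul hi).const_sub 1).fun_sub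
    ((((hb 0).fun_pow 2).fun_add ((hb 1).fun_pow 2)).const_mul (1 / 2)))
  have h3 := ((S.hasDeriv_θp (-ε) x t).const_sub 1).fun_mul
    (((S.hasDeriv_θp β x t).fun_mul hθx).fun_mul hi)
  have h4 := ((hw 0).fun_mul (hb 0)).fun_add ((hw 1).fun_mul (hb 1))
  have h5 := ((hw 0).fun_mul ((hwx 0).fun_mul hi)).fun_add ((hw 1).fun_mul ((hwx 1).fun_mul hi))
  have h6 := ((hb 0).fun_mul ((hbx 0).fun_mul hi)).fun_add ((hb 1).fun_mul ((hbx 1).fun_mul hi))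
  refine (((((h1.fun_add h2).fun_add h3).fun_add h4).fun_add h5).fun_add h6).congr_deriv ?_
  have e1 : S.θp (β - 1 - ε) x t = S.θp (-ε - 1) x t * S.θp β x t := by
    rw [← θp_add]; ring_nf
  have e2 : S.θp (1 - ε) x t = S.θ x t * S.θp (-ε) x t := by
    rw [← S.θp_one, ← θp_add]; ring_nf
  have e3 := S.v_mul_iv x t
  simp only [energyRate, dissipation, compression, heating, e1, e2, S.ut_eq, S.wt_eq, S.bt_eq,
    S.θt_eq]
  push_cast
  linear_combination (-(S.b 0 x t * (S.wx 0 x t - S.ux x t * S.b 0 x t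
    + S.bxx 0 x t * S.iv x t - S.bx 0 x t * S.vx x t * S.iv x t ^ 2)
    + S.b 1 x t * (S.wx 1 x t - S.ux x t * S.b 1 x t
    + S.bxx 1 x t * S.iv x t - S.bx 1 x t * S.vx x t * S.iv x t ^ 2))) * e3

/-- The part of the flux that must vanish at infinity for the cutoff error to be negligible. -/
def fluxTail (ε x t : ℝ) : ℝ :=
  8 * ((1 - S.θp (-ε) x t) ^ 2 * S.θp (β + 1 + ε) x t * S.iv x t / ε
    + S.θp ε x t * S.iv x t * (S.mu x t * S.u x t ^ 2 + (S.w 0 x t ^ 2 + S.w 1 x t ^ 2)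
      + (S.b 0 x t ^ 2 + S.b 1 x t ^ 2)))
  + 4 * (|S.u x t * (1 - S.θ x t * S.iv x t - 1 / 2 * (S.b 0 x t ^ 2 + S.b 1 x t ^ 2))|
    + |S.w 0 x t * S.b 0 x t + S.w 1 x t * S.b 1 x t|)

@[fun_prop] theorem continuous_fluxTail (ε : ℝ) {X : Type*} [TopologicalSpace X] {f g : X → ℝ}
    (hf : Continuous f) (hg : Continuous g) :
    Continuous fun x => S.fluxTail ε (f x) (g x) := by
  unfold fluxTail; fun_prop

theorem lim_fluxTail (ε : ℝ) :
    Tendsto (fun p : ℝ × ℝ => S.fluxTail ε p.1 p.2) spaceInf (nhds 0) := by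
  have hP := ((S.lim_θ.mul S.lim_iv).const_sub 1).sub
    ((((S.lim_b 0).pow 2).add ((S.lim_b 1).pow 2)).const_mul (1 / 2))
  have h := (((((((S.lim_θp (-ε)).const_sub 1).pow 2).mul (S.lim_θp (β + 1 + ε))).mul
    S.lim_iv).div_const ε).add (((S.lim_θp ε).mul S.lim_iv).mul
    (((S.lim_mu.mul (S.lim_u.pow 2)).add (((S.lim_w 0).pow 2).add ((S.lim_w 1).pow 2))).add
      (((S.lim_b 0).pow 2).add ((S.lim_b 1).pow 2))))).const_mul 8
  have h' := h.add (((S.lim_u.mul hP).abs.add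
    (((S.lim_w 0).mul (S.lim_b 0)).add ((S.lim_w 1).mul (S.lim_b 1))).abs).const_mul 4)
  simpa [fluxTail] using h'

theorem heating_nonneg (hα : 0 ≤ α) (x t : ℝ) : 0 ≤ S.heating x t := by
  have := zero_le_one.trans (S.one_le_mu hα x t)
  unfold heating; positivity

theorem dissipation_nonneg (hα : 0 ≤ α) {ε : ℝ} (hε : 0 ≤ ε) (x t : ℝ) :
    0 ≤ S.dissipation ε x t := by
  have h1 := S.heating_nonneg hα x t
  have h2 := S.iv_pos x t
  have h3 := S.θp_pos (-ε) x t
  have h4 := S.θp_pos (β - 1 - ε) x t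
  unfold dissipation; positivity

theorem abs_cut_mul_le {c d L Z A B : ℝ} (hL : 1 ≤ L) (hd : |d| ≤ 2 / L) (hA : 0 ≤ A)
    (hB : 0 ≤ B) (h : Z ^ 2 ≤ A * B) : |2 * c * d * Z| ≤ 1 / 2 * (c ^ 2 * A) + 8 * B / L := by
  have hL0 : 0 < L := by linarith
  have h1 : 8 * B / L ^ 2 ≤ 8 * B / L := by
    apply div_le_div_of_nonneg_left (by positivity) hL0; nlinarith
  refine le_trans ?_ (add_le_add_right h1 _)
  refine abs_le_of_sq_le_sq ?_ (by positivity)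
  have h2 : d ^ 2 ≤ 4 / L ^ 2 := by
    have := sq_le_sq' (by linarith [abs_nonneg d, show 0 ≤ 2 / L by positivity]) hd
    rw [sq_abs] at this
    exact this.trans (le_of_eq (by ring))
  have h3 : d ^ 2 * Z ^ 2 ≤ 4 / L ^ 2 * (A * B) :=
    mul_le_mul h2 h (sq_nonneg _) (by positivity)
  have h4 := mul_le_mul_of_nonneg_left h3 (by positivity : 0 ≤ 4 * c ^ 2)
  have h5 : 4 * c ^ 2 * (4 / L ^ 2 * (A * B)) = 4 * (1 / 2 * (c ^ 2 * A)) * (8 * B / L ^ 2) := by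
    ring
  nlinarith [sq_nonneg (1 / 2 * (c ^ 2 * A) - 8 * B / L ^ 2)]

theorem abs_cut_mul_le' {c d L Z : ℝ} (hd : |d| ≤ 2 / L) (hc0 : 0 ≤ c)
    (hc1 : c ≤ 1) : |2 * c * d * Z| ≤ 4 * |Z| / L := by
  rw [abs_mul, abs_mul, abs_mul, abs_two, abs_of_nonneg hc0]
  have h1 : c * |d| ≤ 1 * (2 / L) := mul_le_mul hc1 hd (abs_nonneg _) zero_le_one
  have := mul_le_mul_of_nonneg_right h1 (abs_nonneg Z)
  calc 2 * c * |d| * |Z| = 2 * (c * |d| * |Z|) := by ring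
    _ ≤ 2 * (1 * (2 / L) * |Z|) := by linarith
    _ = _ := by ring

theorem abs_cut_energyFlux_le (hα : 0 ≤ α) {ε : ℝ} (hε : 0 ≤ ε) {L x : ℝ} (hL : 1 ≤ L)
    (hx : x ∈ Icc (-L) L) (t : ℝ) :
    |2 * cut L x * cutd L x * S.energyFlux ε x t|
      ≤ 1 / 2 * (cut L x ^ 2 * S.dissipation ε x t) + S.fluxTail ε x t / L := by
  have c0 := cut_nonneg hL hx
  have c1 := cut_le_one L x
  have hd := abs_cutd_le hL hx
  have hi := S.iv_pos x t
  have hm := zero_lt_one.trans_le (S.one_le_mu hα x t)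
  have p1 := S.θp_pos (-ε) x t
  have p2 := S.θp_pos ε x t
  have p3 := S.θp_pos (β - 1 - ε) x t
  have p4 := S.θp_pos (β + 1 + ε) x t
  have e1 : S.θp (-ε) x t * S.θp ε x t = 1 := by rw [← θp_add, neg_add_cancel, θp_zero]
  have e2 : S.θp (β - 1 - ε) x t * S.θp (β + 1 + ε) x t = S.θp β x t ^ 2 := by
    rw [sq, ← θp_add, ← θp_add]; ring_nf
  have k1 := abs_cut_mul_le (c := cut L x) (Z := S.u x t * (S.mu x t * S.ux x t * S.iv x t))
    (A := S.θp (-ε) x t * (S.mu x t * S.ux x t ^ 2) * S.iv x t)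
    (B := S.θp ε x t * S.iv x t * (S.mu x t * S.u x t ^ 2)) hL hd (by positivity) (by positivity)
    (le_of_eq (by
      linear_combination (-(S.mu x t ^ 2 * S.ux x t ^ 2 * S.iv x t ^ 2 * S.u x t ^ 2)) * e1))
  have k2 := abs_cut_mul_le (c := cut L x)
    (Z := (1 - S.θp (-ε) x t) * (S.θp β x t * S.θx x t * S.iv x t))
    (A := ε * S.θp (β - 1 - ε) x t * S.θx x t ^ 2 * S.iv x t)
    (B := (1 - S.θp (-ε) x t) ^ 2 * S.θp (β + 1 + ε) x t * S.iv x t / ε) hL hd (by positivity)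
    (by positivity) (by
      rcases hε.eq_or_lt with h | h
      · rw [← h]; simp [θp_zero]
      · refine le_of_eq ?_
        have e3 : ε * ε⁻¹ = 1 := mul_inv_cancel₀ h.ne'
        rw [div_eq_mul_inv]
        linear_combination (-((1 - S.θp (-ε) x t) ^ 2 * S.θx x t ^ 2 * S.iv x t ^ 2)) * e2
          - (S.θp (β - 1 - ε) x t * S.θp (β + 1 + ε) x t * (1 - S.θp (-ε) x t) ^ 2
            * S.θx x t ^ 2 * S.iv x t ^ 2) * e3)
  have kw := fun i => abs_cut_mul_le (c := cut L x) (Z := S.w i x t * (S.wx i x t * S.iv x t))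
    (A := S.θp (-ε) x t * S.wx i x t ^ 2 * S.iv x t)
    (B := S.θp ε x t * S.iv x t * S.w i x t ^ 2) hL hd (by positivity) (by positivity)
    (le_of_eq (by
      linear_combination (-(S.wx i x t ^ 2 * S.iv x t ^ 2 * S.w i x t ^ 2)) * e1))
  have kb := fun i => abs_cut_mul_le (c := cut L x) (Z := S.b i x t * (S.bx i x t * S.iv x t))
    (A := S.θp (-ε) x t * S.bx i x t ^ 2 * S.iv x t)
    (B := S.θp ε x t * S.iv x t * S.b i x t ^ 2) hL hd (by positivity) (by positivity)
    (le_of_eq (by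
      linear_combination (-(S.bx i x t ^ 2 * S.iv x t ^ 2 * S.b i x t ^ 2)) * e1))
  have k3 := abs_cut_mul_le' (c := cut L x) (Z := S.u x t * (1 - S.θ x t * S.iv x t
    - 1 / 2 * (S.b 0 x t ^ 2 + S.b 1 x t ^ 2))) hd c0 c1
  have k4 := abs_cut_mul_le' (c := cut L x) (Z := S.w 0 x t * S.b 0 x t + S.w 1 x t * S.b 1 x t)
    hd c0 c1
  have kw0 := kw 0
  have kw1 := kw 1
  have kb0 := kb 0
  have kb1 := kb 1
  rw [abs_le] at *
  simp only [dissipation, heating, energyFlux, fluxTail]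
  constructor
  · have := add_le_add (add_le_add (add_le_add k1.1 k2.1) (add_le_add kw0.1 kw1.1))
      (add_le_add (add_le_add kb0.1 kb1.1) (add_le_add k3.1 k4.1))
    refine le_trans (le_of_eq ?_) (this.trans (le_of_eq ?_)) <;> ring
  · have := add_le_add (add_le_add (add_le_add k1.2 k2.2) (add_le_add kw0.2 kw1.2))
      (add_le_add (add_le_add kb0.2 kb1.2) (add_le_add k3.2 k4.2))
    refine le_trans (le_of_eq ?_) (this.trans (le_of_eq ?_)) <;> ring

theorem fluxTail_nonneg (hα : 0 ≤ α) {ε : ℝ} (hε : 0 ≤ ε) (x t : ℝ) : 0 ≤ S.fluxTail ε x t := by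
  have hi := S.iv_pos x t
  have hm := zero_lt_one.trans_le (S.one_le_mu hα x t)
  have p2 := S.θp_pos ε x t
  have p4 := S.θp_pos (β + 1 + ε) x t
  unfold fluxTail; positivity

/-- The energy inequality on large intervals, with the compression source on the right. -/
theorem energy_inequality (hα : 0 ≤ α) (hT : 0 < T) {ε : ℝ} (hε : 0 ≤ ε) {Ψ : ℝ → ℝ}
    (hΨ : ∀ z > 0, HasDerivAt Ψ (1 - z ^ (-ε)) z) :
    ∀ᶠ L in atTop, 1 ≤ L ∧ ∀ t ∈ Icc 0 T,
      (∫ x in (-L)..L, cut L x ^ 2 * S.energy Ψ x t)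
        + 1 / 2 * (∫ s in (0:ℝ)..t, ∫ x in (-L)..L, cut L x ^ 2 * S.dissipation ε x s)
      ≤ (∫ x in (-L)..L, cut L x ^ 2 * S.energy Ψ x 0) + 1
        + ∫ s in (0:ℝ)..t, ∫ x in (-L)..L, cut L x ^ 2 * S.compression ε x s := by
  filter_upwards [average_tendsto_zero T (S.continuous_fluxTail ε continuous_fst continuous_snd)
    (S.lim_fluxTail ε) (1 / T) (by positivity), eventually_ge_atTop 1] with L hav hL
  refine ⟨hL, fun t ht => ?_⟩
  have hL0 : 0 < L := by linarith
  rw [weighted_evolution (F := S.energy Ψ) (Ft := S.energyRate ε) (φ := fun x => cut L x ^ 2)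
    (by fun_prop) (S.continuous_energy hΨ continuous_fst continuous_snd) (by fun_prop)
    (fun x t ht => S.hasTDeriv_energy hΨ x ht) _ _ ht]
  have key : ∀ s ∈ Icc 0 t, ∫ x in (-L)..L, cut L x ^ 2 * S.energyRate ε x s
      ≤ -(1 / 2) * (∫ x in (-L)..L, cut L x ^ 2 * S.dissipation ε x s)
        + 1 * (∫ x in (-L)..L, cut L x ^ 2 * S.compression ε x s) + 1 * (1 / T) := by
    intro s hs
    have hs' : s ∈ Icc 0 T := ⟨hs.1, hs.2.trans ht.2⟩
    have h1 := cut_integral_by_parts hL (fun x => S.hasDeriv_energyFlux ε x s) (by fun_prop)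
    have h2 := integral_le_lin2 (f := fun x => -(2 * cut L x * cutd L x * S.energyFlux ε x s))
      (g₁ := fun x => cut L x ^ 2 * S.dissipation ε x s) (g₂ := fun x => |S.fluxTail ε x s|)
      (a := -L) (b := L) (1 / 2) (1 / L) (by linarith) (by fun_prop) (by fun_prop) (by fun_prop)
      (fun x hx => by
        have h3 := (neg_le_abs _).trans (S.abs_cut_energyFlux_le hα hε hL hx s)
        rw [abs_of_nonneg (S.fluxTail_nonneg hα hε x s)]
        refine h3.trans (le_of_eq ?_)
        ring)
    rw [intervalIntegral.integral_neg, ← h1] at h2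
    have h4 : 1 / L * ∫ x in (-L)..L, |S.fluxTail ε x s| ≤ 1 / T := by
      have := hav s hs'
      calc _ ≤ 1 / L * (1 / T * L) := by gcongr
        _ = _ := by field_simp
    have h5 : ∫ x in (-L)..L, cut L x ^ 2 * (S.energyRate ε x s + S.dissipation ε x s
        - S.compression ε x s) = (∫ x in (-L)..L, cut L x ^ 2 * S.energyRate ε x s)
        + (∫ x in (-L)..L, cut L x ^ 2 * S.dissipation ε x s)
        - ∫ x in (-L)..L, cut L x ^ 2 * S.compression ε x s := by
      rw [← integral_add_cont _ _ (by fun_prop) (by fun_prop),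
        ← integral_sub_cont _ _ (by fun_prop) (by fun_prop)]
      exact intervalIntegral.integral_congr fun x _ => by ring
    linarith
  have h6 := integral_le_lin3 (f := fun s => ∫ x in (-L)..L, cut L x ^ 2 * S.energyRate ε x s)
    (g₁ := fun s => ∫ x in (-L)..L, cut L x ^ 2 * S.dissipation ε x s)
    (g₂ := fun s => ∫ x in (-L)..L, cut L x ^ 2 * S.compression ε x s) (g₃ := fun _ => 1 / T)
    (-(1 / 2)) 1 1 ht.1
    (continuous_slice_integral (f := fun x s => cut L x ^ 2 * S.energyRate ε x s)
      (by fun_prop) _ _)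
    (continuous_slice_integral (f := fun x s => cut L x ^ 2 * S.dissipation ε x s)
      (by fun_prop) _ _)
    (continuous_slice_integral (f := fun x s => cut L x ^ 2 * S.compression ε x s)
      (by fun_prop) _ _) continuous_const key
  have h7 : ∫ s in (0:ℝ)..t, 1 / T ≤ 1 := by
    simp only [intervalIntegral.integral_const, smul_eq_mul, sub_zero]
    rw [mul_one_div, div_le_one hT]; exact ht.2
  linarith

end MHDFlow

/-! ### From cutoff bounds to bounds on intervals -/

theorem integral_le_of_cut {f : ℝ → ℝ} {C : ℝ} (hf : Continuous f) (h0 : ∀ x, 0 ≤ f x)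
    (h : ∀ᶠ L in atTop, ∫ x in (-L)..L, cut L x ^ 2 * f x ≤ C) {a b : ℝ} (hab : a ≤ b) :
    ∫ x in a..b, f x ≤ 2 * C := by
  set R := max |a| |b| + 1 with hR
  have hR0 : 0 < R := by positivity
  obtain ⟨L, hL, hLR⟩ := (h.and (eventually_ge_atTop (2 * R))).exists
  have ha : -R ≤ a := by linarith [neg_abs_le a, le_max_left |a| |b|]
  have hb : b ≤ R := by linarith [le_abs_self b, le_max_right |a| |b|]
  have h1 := integral_subinterval_le (f := fun x => 2 * (cut L x ^ 2 * f x)) ha hab hb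
    (by fun_prop) fun x _ => mul_nonneg zero_le_two (mul_nonneg (sq_nonneg _) (h0 x))
  have h2 := integral_subinterval_le (f := fun x => 2 * (cut L x ^ 2 * f x)) (c := -L) (d := L)
    (a := -R) (b := R) (by linarith) (by linarith) (by linarith)
    (by fun_prop) fun x _ => mul_nonneg zero_le_two (mul_nonneg (sq_nonneg _) (h0 x))
  have h3 := integral_le_of_cont (f := f) (g := fun x => 2 * (cut L x ^ 2 * f x)) hab hf
    (by fun_prop) fun x hx => by
      have := half_le_cut_sq hR0 hLR ⟨ha.trans hx.1, hx.2.trans hb⟩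
      nlinarith [h0 x]
  rw [intervalIntegral.integral_const_mul 2 (fun x => cut L x ^ 2 * f x) (a := -L)] at h2
  linarith

theorem integral2_le_of_cut {F : ℝ → ℝ → ℝ} {C t : ℝ} (ht : 0 ≤ t)
    (hF : Continuous fun p : ℝ × ℝ => F p.1 p.2) (h0 : ∀ x s, 0 ≤ F x s)
    (h : ∀ᶠ L in atTop, ∫ s in (0:ℝ)..t, ∫ x in (-L)..L, cut L x ^ 2 * F x s ≤ C) {a b : ℝ}
    (hab : a ≤ b) : ∫ s in (0:ℝ)..t, ∫ x in a..b, F x s ≤ 2 * C := by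
  rw [← integral_swap_cont hF]
  refine integral_le_of_cut
    (continuous_slice_integral (f := fun s x => F x s) (by fun_prop) _ _)
    (fun x => integral_nonneg_of_cont ht fun s _ => h0 x s) ?_ hab
  filter_upwards [h] with L hL
  refine le_trans (le_of_eq ?_) hL
  rw [← integral_swap_cont (f := fun x s => cut L x ^ 2 * F x s) (by fun_prop)]
  exact intervalIntegral.integral_congr fun x _ =>
    (intervalIntegral.integral_const_mul _ _).symm

theorem cut_sq_mul_le {L x z : ℝ} (hL : 1 ≤ L) (hx : x ∈ Icc (-L) L) (hz : 0 ≤ z) :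
    cut L x ^ 2 * z ≤ z := by
  have := cut_nonneg hL hx
  have := cut_le_one L x
  nlinarith [mul_nonneg (by nlinarith : 0 ≤ 1 - cut L x ^ 2) hz]

/-! ### The relative entropy function -/

/-- The function `z - 1 - log z`. -/
def ent (z : ℝ) : ℝ := z - 1 - Real.log z

theorem ent_nonneg {z : ℝ} (hz : 0 < z) : 0 ≤ ent z := by
  have := Real.log_le_sub_one_of_pos hz
  unfold ent; linarith

theorem ent_le {z : ℝ} (hz : 0 < z) : ent z ≤ (z - 1) ^ 2 / z := by
  have h := Real.one_sub_inv_le_log_of_pos hz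
  have : (z - 1) ^ 2 / z = z - 1 - (1 - z⁻¹) := by field_simp
  unfold ent; linarith

theorem le_ent {z : ℝ} (hz : 0 < z) : z ≤ 2 * ent z + 2 := by
  have h := Real.log_le_sub_one_of_pos (half_pos hz)
  rw [Real.log_div hz.ne' two_ne_zero] at h
  have := Real.log_two_lt_d9
  unfold ent; linarith

theorem hasDerivAt_ent {z : ℝ} (hz : 0 < z) : HasDerivAt ent (1 - z ^ (-(1:ℝ))) z := by
  rw [Real.rpow_neg_one]
  exact ((hasDerivAt_id z).sub_const 1).sub (Real.hasDerivAt_log hz.ne')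

namespace MHDFlow

variable {α β T : ℝ} {S : MHDFlow α β T}

theorem Init.integral_le {K δ : ℝ} (hI : S.Init K δ) {f : ℝ → ℝ} {c a b : ℝ} (hc : 0 ≤ c)
    (hab : a ≤ b) (hf : Continuous f) (h : ∀ x, f x ≤ c * S.initDensity x) :
    ∫ x in a..b, f x ≤ c * K ^ 2 := by
  refine (integral_le_of_cont hab hf (by fun_prop) fun x _ => h x).trans ?_
  rw [intervalIntegral.integral_const_mul]
  exact mul_le_mul_of_nonneg_left (hI.int_le a b hab) hc

theorem Init.v_le {K δ : ℝ} (hI : S.Init K δ) (x : ℝ) : S.v x 0 ≤ 2 + 2 * K ^ 2 := by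
  have h := le_integral_unit (f := fun y => (S.v y 0 - 1) ^ 2) (x := x) (a := x)
    ⟨le_rfl, by linarith⟩
    (fun y => ((S.hasDeriv_v y 0).sub_const 1).fun_pow 2) (by fun_prop)
  have h1 := hI.integral_le (f := fun y => (S.v y 0 - 1) ^ 2) (c := 1) (a := x) (b := x + 1)
    zero_le_one (by linarith) (by fun_prop) fun y => by
      unfold initDensity
      have : 0 ≤ S.u y 0 ^ 2 + (S.θ y 0 - 1) ^ 2 + (S.b 0 y 0 ^ 2 + S.b 1 y 0 ^ 2)
        + (S.w 0 y 0 ^ 2 + S.w 1 y 0 ^ 2) + S.vx y 0 ^ 2 + S.ux y 0 ^ 2 + S.θx y 0 ^ 2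
        + (S.bx 0 y 0 ^ 2 + S.bx 1 y 0 ^ 2) + (S.wx 0 y 0 ^ 2 + S.wx 1 y 0 ^ 2) := by positivity
      linarith
  have h2 := hI.integral_le (f := fun y => |((2:ℕ):ℝ) * (S.v y 0 - 1) ^ (2 - 1) * S.vx y 0|)
    (c := 1) (a := x) (b := x + 1)
    zero_le_one (by linarith) (by fun_prop) fun y => by
      unfold initDensity
      have : 0 ≤ S.u y 0 ^ 2 + (S.θ y 0 - 1) ^ 2 + (S.b 0 y 0 ^ 2 + S.b 1 y 0 ^ 2)
        + (S.w 0 y 0 ^ 2 + S.w 1 y 0 ^ 2) + S.ux y 0 ^ 2 + S.θx y 0 ^ 2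
        + (S.bx 0 y 0 ^ 2 + S.bx 1 y 0 ^ 2) + (S.wx 0 y 0 ^ 2 + S.wx 1 y 0 ^ 2) := by positivity
      have h3 : |((2:ℕ):ℝ) * (S.v y 0 - 1) ^ (2 - 1) * S.vx y 0|
          ≤ (S.v y 0 - 1) ^ 2 + S.vx y 0 ^ 2 := by
        rw [abs_le]
        norm_num
        constructor
        · nlinarith [sq_nonneg (S.v y 0 - 1 + S.vx y 0)]
        · nlinarith [sq_nonneg (S.v y 0 - 1 - S.vx y 0)]
      linarith
  nlinarith [sq_nonneg (S.v x 0 - 1 - 1 / 2)]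

theorem energy_nonneg {Ψ : ℝ → ℝ} (hΨ : ∀ z > 0, 0 ≤ Ψ z) (x t : ℝ) : 0 ≤ S.energy Ψ x t := by
  have h1 := S.v_pos x t
  have h2 := hΨ _ (S.θ_pos x t)
  have h3 := ent_nonneg h1
  unfold ent at h3
  unfold energy lv
  positivity

/-- The initial energy is controlled by the initial norm. -/
theorem Init.energy_le {K δ : ℝ} (hI : S.Init K δ) (hδ : 0 < δ) {Ψ : ℝ → ℝ}
    (hΨ : ∀ z > 0, Ψ z ≤ ent z) {a b : ℝ} (hab : a ≤ b)
    (hc : Continuous fun x => S.energy Ψ x 0) :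
    ∫ x in a..b, S.energy Ψ x 0 ≤ (2 + K ^ 2 + 1 / δ) * K ^ 2 := by
  refine hI.integral_le (by positivity) hab hc fun x => ?_
  have hv := S.v_pos x 0
  have hθ := S.θ_pos x 0
  have h1 := ent_le hv
  have h2 := (hΨ _ hθ).trans (ent_le hθ)
  have h3 : (S.v x 0 - 1) ^ 2 / S.v x 0 ≤ (S.v x 0 - 1) ^ 2 / δ :=
    div_le_div_of_nonneg_left (sq_nonneg _) hδ (hI.v_ge x)
  have h4 : (S.θ x 0 - 1) ^ 2 / S.θ x 0 ≤ (S.θ x 0 - 1) ^ 2 / δ :=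
    div_le_div_of_nonneg_left (sq_nonneg _) hδ (hI.θ_ge x)
  have h5 := mul_le_mul_of_nonneg_right (hI.v_le x)
    (by positivity : 0 ≤ S.b 0 x 0 ^ 2 + S.b 1 x 0 ^ 2)
  have hd : 0 < 1 / δ := by positivity
  have h6 : (S.v x 0 - 1) ^ 2 / δ + (S.θ x 0 - 1) ^ 2 / δ
    ≤ 1 / δ * S.initDensity x := by
    rw [← add_div, div_eq_inv_mul, ← one_div]
    refine mul_le_mul_of_nonneg_left ?_ hd.le
    unfold initDensity
    have : 0 ≤ S.u x 0 ^ 2 + (S.b 0 x 0 ^ 2 + S.b 1 x 0 ^ 2)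
      + (S.w 0 x 0 ^ 2 + S.w 1 x 0 ^ 2) + S.vx x 0 ^ 2 + S.ux x 0 ^ 2 + S.θx x 0 ^ 2
      + (S.bx 0 x 0 ^ 2 + S.bx 1 x 0 ^ 2) + (S.wx 0 x 0 ^ 2 + S.wx 1 x 0 ^ 2) := by positivity
    linarith
  have h7 : 1 / 2 * (S.u x 0 ^ 2 + (S.w 0 x 0 ^ 2 + S.w 1 x 0 ^ 2)
      + (2 + 2 * K ^ 2) * (S.b 0 x 0 ^ 2 + S.b 1 x 0 ^ 2)) ≤ (2 + K ^ 2) * S.initDensity x := by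
    unfold initDensity
    have : 0 ≤ S.vx x 0 ^ 2 + S.ux x 0 ^ 2 + S.θx x 0 ^ 2 + (S.v x 0 - 1) ^ 2 + (S.θ x 0 - 1) ^ 2
      + (S.bx 0 x 0 ^ 2 + S.bx 1 x 0 ^ 2) + (S.wx 0 x 0 ^ 2 + S.wx 1 x 0 ^ 2) := by positivity
    have e1 : 0 ≤ S.u x 0 ^ 2 + (S.w 0 x 0 ^ 2 + S.w 1 x 0 ^ 2) := by positivity
    have e2 : 0 ≤ S.b 0 x 0 ^ 2 + S.b 1 x 0 ^ 2 := by positivity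
    nlinarith [mul_nonneg (sq_nonneg K) e1, mul_nonneg (sq_nonneg K) e2,
      mul_nonneg (sq_nonneg K) this]
  unfold ent at h1
  unfold energy lv
  linarith

/-- The consequences of the entropy estimate. -/
structure EntropyBound (S : MHDFlow α β T) (C : ℝ) : Prop where
  energy_le : ∀ t ∈ Icc 0 T, ∀ a b, a ≤ b → ∫ x in a..b, S.energy ent x t ≤ C
  dissipation_le : ∀ t ∈ Icc 0 T, ∀ a b, a ≤ b →
    ∫ s in (0:ℝ)..t, ∫ x in a..b, S.dissipation 1 x s ≤ C

theorem exists_entropyBound (α β T K δ : ℝ) (hα : 0 ≤ α) (hT : 0 < T) (hδ : 0 < δ) :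
    ∃ C > 0, ∀ S : MHDFlow α β T, S.Init K δ → S.EntropyBound C := by
  set C₀ := (2 + K ^ 2 + 1 / δ) * K ^ 2 + 1 with hC₀
  have hC₀0 : 0 < C₀ := by positivity
  refine ⟨4 * C₀, by positivity, fun S hI => ?_⟩
  have hc : Continuous fun p : ℝ × ℝ => S.energy ent p.1 p.2 :=
    S.continuous_energy (fun z hz => hasDerivAt_ent hz) continuous_fst continuous_snd
  have hE0 : ∀ x t, 0 ≤ S.energy ent x t := energy_nonneg fun z hz => ent_nonneg hz
  have hD0 := S.dissipation_nonneg hα (zero_le_one (α := ℝ))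
  have key : ∀ᶠ L in atTop, 1 ≤ L ∧ ∀ t ∈ Icc 0 T,
      (∫ x in (-L)..L, cut L x ^ 2 * S.energy ent x t)
        + 1 / 2 * (∫ s in (0:ℝ)..t, ∫ x in (-L)..L, cut L x ^ 2 * S.dissipation 1 x s) ≤ C₀ := by
    filter_upwards [S.energy_inequality hα hT zero_le_one fun z hz => hasDerivAt_ent hz]
      with L ⟨hL, h⟩
    refine ⟨hL, fun t ht => (h t ht).trans ?_⟩
    have h1 : ∫ x in (-L)..L, cut L x ^ 2 * S.energy ent x 0 ≤ ∫ x in (-L)..L, S.energy ent x 0 :=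
      integral_le_of_cont (by linarith) (by fun_prop) (by fun_prop)
        fun x hx => cut_sq_mul_le hL hx (hE0 x 0)
    have h2 := h1.trans (hI.energy_le hδ (fun z _ => le_rfl) (by linarith) (by fun_prop))
    have h3 : ∀ x s, S.compression 1 x s = 0 := fun x s => by
      simp [compression, θp_zero]
    simp only [h3, mul_zero, intervalIntegral.integral_zero]
    linarith
  have hD1 : ∀ t ∈ Icc 0 T, ∀ L,  1 ≤ L →
      0 ≤ ∫ s in (0:ℝ)..t, ∫ x in (-L)..L, cut L x ^ 2 * S.dissipation 1 x s :=
    fun t ht L hL => integral_nonneg_of_cont ht.1 fun s _ =>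
      integral_nonneg_of_cont (by linarith) fun x _ => mul_nonneg (sq_nonneg _) (hD0 x s)
  have hE1 : ∀ t, ∀ L, 1 ≤ L → 0 ≤ ∫ x in (-L)..L, cut L x ^ 2 * S.energy ent x t :=
    fun t L hL => integral_nonneg_of_cont (by linarith) fun x _ =>
      mul_nonneg (sq_nonneg _) (hE0 x t)
  constructor
  · intro t ht a b hab
    refine (integral_le_of_cut (C := 2 * C₀) (by fun_prop) (fun x => hE0 x t) ?_ hab).trans
      (by linarith)
    filter_upwards [key] with L hL
    linarith [hL.2 t ht, hD1 t ht L hL.1]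
  · intro t ht a b hab
    refine (integral2_le_of_cut (C := 2 * C₀) ht.1 (by fun_prop) hD0 ?_ hab).trans
      (by linarith)
    filter_upwards [key] with L hL
    linarith [hL.2 t ht, hE1 t L hL.1]

end MHDFlow

/-! ### Bounds for the specific volume from the effective viscous flux -/

namespace MHDFlow

variable {α β T : ℝ} (S : MHDFlow α β T)

/-- The total pressure. -/
def press (x t : ℝ) : ℝ := S.θ x t * S.iv x t + 1 / 2 * (S.b 0 x t ^ 2 + S.b 1 x t ^ 2)

@[fun_prop] theorem continuous_press {X : Type*} [TopologicalSpace X] {f g : X → ℝ}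
    (hf : Continuous f) (hg : Continuous g) :
    Continuous fun x => S.press (f x) (g x) := by
  unfold press; fun_prop

theorem press_nonneg (x t : ℝ) : 0 ≤ S.press x t := by
  have := S.θ_pos x t
  have := S.iv_pos x t
  unfold press; positivity

theorem hasDeriv_stress (x t : ℝ) :
    HasDerivAt (fun y => S.mu y t * S.iv y t * S.ux y t - S.press y t) (S.ut x t) x := by
  have hi := S.hasDeriv_iv x t
  refine ((((S.hasDeriv_mu x t).fun_mul hi).fun_mul (S.hasDeriv_ux x t)).fun_sub
    (((S.hasDeriv_θ x t).fun_mul hi).fun_add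
      ((((S.hasDeriv_b 0 x t).fun_pow 2).fun_add ((S.hasDeriv_b 1 x t).fun_pow 2)).const_mul
        (1 / 2)))).congr_deriv ?_
  rw [S.ut_eq]; push_cast; ring

/-- The time integral of the total stress, expressed through the effective logarithm. -/
def stressPotential (x t : ℝ) : ℝ :=
  S.hv x t - S.hv x 0 - ∫ s in (0:ℝ)..t, S.press x s

theorem continuous_stressPotential (x : ℝ) : Continuous fun t => S.stressPotential x t := by
  have : Continuous fun t => ∫ s in (0:ℝ)..t, S.press x s :=
    intervalIntegral.continuous_primitive
      (fun a b => (by fun_prop : Continuous fun s => S.press x s).intervalIntegrable a b) 0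
  unfold stressPotential; fun_prop

theorem stressPotential_eq (x : ℝ) {t : ℝ} (ht : t ∈ Icc 0 T) :
    S.stressPotential x t
      = ∫ s in (0:ℝ)..t, (S.mu x s * S.iv x s * S.ux x s - S.press x s) := by
  rw [integral_sub_cont _ _ (by fun_prop) (by fun_prop),
    integral_time_deriv (f := fun s => S.hv x s) (by fun_prop) (by fun_prop)
      (fun t ht => S.hasTDeriv_hv x ht) le_rfl ht.1 ht.2]
  rfl

theorem stressPotential_sub (x y : ℝ) {t : ℝ} (ht : t ∈ Icc 0 T) :
    S.stressPotential y t - S.stressPotential x t = ∫ z in x..y, (S.u z t - S.u z 0) := by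
  rw [S.stressPotential_eq x ht, S.stressPotential_eq y ht,
    ← integral_sub_cont _ _ (by fun_prop) (by fun_prop)]
  have h1 : ∀ s, (S.mu y s * S.iv y s * S.ux y s - S.press y s)
      - (S.mu x s * S.iv x s * S.ux x s - S.press x s) = ∫ z in x..y, S.ut z s := fun s =>
    (integral_deriv_eq x y (fun z => S.hasDeriv_stress z s) (by fun_prop)).symm
  simp only [h1]
  rw [← integral_swap_cont (f := S.ut) (by fun_prop)]
  refine intervalIntegral.integral_congr fun z _ => ?_
  exact integral_time_deriv (f := fun s => S.u z s) (by fun_prop) (by fun_prop) (S.hasTDeriv_u z)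
    le_rfl ht.1 ht.2

theorem hv_le_log (x t : ℝ) : S.hv x t ≤ Real.log (S.v x t) := by
  have := Real.rpow_pos_of_pos (S.v_pos x t) (-α)
  unfold hv; linarith

theorem exp_hv_le (x t : ℝ) : Real.exp (S.hv x t) ≤ S.v x t :=
  (Real.exp_le_exp.2 (S.hv_le_log x t)).trans (Real.exp_log (S.v_pos x t)).le

theorem hv_ge (hα : 0 ≤ α) {c x t : ℝ} (hc : 0 < c) (h : c ≤ S.v x t) :
    Real.log c - c ^ (-α) ≤ S.hv x t := by
  have h1 := Real.log_le_log hc h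
  have h2 := Real.rpow_le_rpow_of_nonpos hc h (neg_nonpos.2 hα)
  unfold hv; linarith

variable {S}

theorem EntropyBound.integral_le {E : ℝ} (hE : S.EntropyBound E) {f : ℝ → ℝ} {c d a t : ℝ}
    (hc : 0 ≤ c) (ht : t ∈ Icc 0 T) (hf : Continuous f)
    (h : ∀ x, f x ≤ c * S.energy ent x t + d) :
    ∫ x in a..(a + 1), f x ≤ c * E + d := by
  have hcont : Continuous fun x => S.energy ent x t :=
    S.continuous_energy (fun z hz => hasDerivAt_ent hz) continuous_id continuous_const
  have h1 := integral_le_lin2 (f := f) (g₁ := fun x => S.energy ent x t) (g₂ := fun _ => 1)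
    (a := a) (b := a + 1) c d (by linarith) hf hcont continuous_const (fun x _ => by
      rw [mul_one]; exact h x)
  have h2 := mul_le_mul_of_nonneg_left (hE.energy_le t ht a (a + 1) (by linarith)) hc
  simp only [intervalIntegral.integral_const, smul_eq_mul, mul_one, add_sub_cancel_left] at h1
  linarith

theorem le_energy (x t : ℝ) : 0 ≤ S.u x t ^ 2 ∧ 0 ≤ S.v x t * (S.b 0 x t ^ 2 + S.b 1 x t ^ 2) ∧
    0 ≤ ent (S.v x t) ∧ 0 ≤ ent (S.θ x t) ∧
    1 / 2 * S.u x t ^ 2 + 1 / 2 * (S.v x t * (S.b 0 x t ^ 2 + S.b 1 x t ^ 2)) + ent (S.v x t)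
      + ent (S.θ x t) ≤ S.energy ent x t := by
  have h1 := S.v_pos x t
  refine ⟨by positivity, by positivity, ent_nonneg h1, ent_nonneg (S.θ_pos x t), ?_⟩
  have : 0 ≤ S.w 0 x t ^ 2 + S.w 1 x t ^ 2 := by positivity
  have h2 : ent (S.v x t) = S.v x t - 1 - S.lv x t := rfl
  unfold energy; linarith

theorem EntropyBound.abs_stressPotential_sub_le {E : ℝ} (hE : S.EntropyBound E) {a y t : ℝ}
    (hy : y ∈ Icc a (a + 1)) (ht : t ∈ Icc 0 T) :
    |S.stressPotential y t - S.stressPotential a t| ≤ 2 * E + 1 := by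
  rw [S.stressPotential_sub a y ht]
  refine (intervalIntegral.abs_integral_le_integral_abs hy.1).trans ?_
  refine (integral_subinterval_le le_rfl hy.1 hy.2 (by fun_prop) fun _ _ => abs_nonneg _).trans ?_
  have h0 : (0:ℝ) ∈ Icc 0 T := ⟨le_rfl, ht.1.trans ht.2⟩
  have key : ∀ r ∈ Icc 0 T, ∫ z in a..(a + 1), |S.u z r| ≤ 1 * E + 1 / 2 := by
    intro r hr
    refine hE.integral_le zero_le_one hr (by fun_prop) fun x => ?_
    obtain ⟨h1, h2, h3, h4, h5⟩ := S.le_energy x r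
    have : |S.u x r| ≤ 1 / 2 * S.u x r ^ 2 + 1 / 2 := by
      rw [← sq_abs]; nlinarith [sq_nonneg (|S.u x r| - 1)]
    linarith
  have h1 := integral_le_lin2 (f := fun z => |S.u z t - S.u z 0|) (g₁ := fun z => |S.u z t|)
    (g₂ := fun z => |S.u z 0|) (a := a) (b := a + 1) 1 1 (by linarith) (by fun_prop) (by fun_prop)
    (by fun_prop) (fun z _ => by rw [one_mul, one_mul]; exact abs_sub _ _)
  linarith [key t ht, key 0 h0]

theorem exists_volume_bounds (α β T K δ E : ℝ) (hα : 0 ≤ α) (hδ : 0 < δ) (hE0 : 0 < E) :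
    ∃ c > 0, ∃ C > 0, ∀ S : MHDFlow α β T, S.Init K δ → S.EntropyBound E →
      ∀ x, ∀ t ∈ Icc 0 T, c ≤ S.v x t ∧
        S.v x t ≤ C * (1 + ∫ s in (0:ℝ)..t,
          (S.θ x s + 1 / 2 * (S.v x s * (S.b 0 x s ^ 2 + S.b 1 x s ^ 2)))) := by
  set M := 2 * E + 1 with hM
  set lo := Real.log δ - δ ^ (-α) with hlo
  set hi := 2 + 2 * K ^ 2 with hhi
  set C₁ := Real.exp (hi + M) with hC₁
  set C₂ := Real.exp (M - lo) with hC₂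
  set c₁ := Real.exp (-(2 * E) - 1) with hc₁
  set f₁ := Real.exp (Real.log c₁ - c₁ ^ (-α)) with hf₁
  set m := f₁ * (1 / 2) with hm
  have hm0 : 0 < m := by positivity
  set A := C₁ * C₂ * (2 * E + 2) / m with hA
  have hA0 : 0 < A := by positivity
  set Y := C₁ / m * Real.exp (A * T) with hY
  have hY0 : 0 < Y := by positivity
  set c := Real.exp (lo - M) / Y with hc
  have hc0 : 0 < c := by positivity
  set Z := (2 * E + 2) * C₂ with hZ
  have hZ0 : 0 < Z := by positivity
  refine ⟨c, hc0, Real.exp (c ^ (-α)) * (Z * C₁ * (1 + C₂ * Y)), by positivity,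
    fun S hI hE a => ?_⟩
  set g : ℝ → ℝ → ℝ := fun x s => S.θ x s + 1 / 2 * (S.v x s * (S.b 0 x s ^ 2 + S.b 1 x s ^ 2))
    with hg
  have hgc : Continuous fun p : ℝ × ℝ => g p.1 p.2 := by simp only [hg]; fun_prop
  have hg0 : ∀ x s, 0 ≤ g x s := fun x s => by
    have := S.θ_pos x s
    have := S.v_pos x s
    simp only [hg]; positivity
  set q : ℝ → ℝ := fun t => S.stressPotential a t with hq
  have hqc : Continuous q := S.continuous_stressPotential a
  have hq' : ∀ y ∈ Icc a (a + 1), ∀ t ∈ Icc 0 T, |S.stressPotential y t - q t| ≤ M :=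
    fun y hy t ht => hE.abs_stressPotential_sub_le hy ht
  have h0lo : ∀ y, lo ≤ S.hv y 0 := fun y => S.hv_ge hα hδ (hI.v_ge y)
  have h0hi : ∀ y, S.hv y 0 ≤ hi := fun y => by
    have h1 := Real.log_le_sub_one_of_pos (S.v_pos y 0)
    linarith [S.hv_le_log y 0, hI.v_le y]
  have hrep : ∀ y t, S.hv y t = S.hv y 0 + S.stressPotential y t + ∫ s in (0:ℝ)..t, S.press y s :=
    fun y t => by unfold stressPotential; ring
  have hI0 : ∀ y, ∀ t ∈ Icc 0 T, 0 ≤ ∫ s in (0:ℝ)..t, S.press y s := fun y t ht =>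
    integral_nonneg_of_cont ht.1 fun s _ => S.press_nonneg y s
  have hup : ∀ y ∈ Icc a (a + 1), ∀ t ∈ Icc 0 T, Real.exp (-q t) * Real.exp (S.hv y t)
      ≤ C₁ * (1 + C₂ * ∫ s in (0:ℝ)..t, g y s * Real.exp (-q s)) := by
    intro y hy t ht
    have hd : ∀ s, HasDerivAt (fun s => Real.exp (∫ r in (0:ℝ)..s, S.press y r))
        (Real.exp (∫ r in (0:ℝ)..s, S.press y r) * S.press y s) s := fun s =>
      ((by fun_prop : Continuous fun r => S.press y r).integral_hasStrictDerivAt 0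
        s).hasDerivAt.exp
    have hFc : Continuous fun s => Real.exp (∫ r in (0:ℝ)..s, S.press y r) :=
      continuous_iff_continuousAt.2 fun s => (hd s).continuousAt
    have h1 := integral_deriv_eq 0 t hd (by fun_prop)
    simp only [intervalIntegral.integral_same, Real.exp_zero] at h1
    have h2 : ∫ s in (0:ℝ)..t, Real.exp (∫ r in (0:ℝ)..s, S.press y r) * S.press y s
        ≤ ∫ s in (0:ℝ)..t, C₂ * (g y s * Real.exp (-q s)) := by
      refine integral_le_of_cont ht.1 (by fun_prop) (by fun_prop) fun s hs => ?_
      have hs' : s ∈ Icc 0 T := ⟨hs.1, hs.2.trans ht.2⟩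
      have e1 : Real.exp (∫ r in (0:ℝ)..s, S.press y r)
          ≤ S.v y s * (C₂ * Real.exp (-q s)) := by
        have e2 : (∫ r in (0:ℝ)..s, S.press y r) ≤ S.hv y s + ((M - lo) + -q s) := by
          linarith [hrep y s, h0lo y, (abs_le.1 (hq' y hy s hs')).1]
        refine (Real.exp_le_exp.2 e2).trans ?_
        rw [Real.exp_add, Real.exp_add]
        exact mul_le_mul_of_nonneg_right (S.exp_hv_le y s) (by positivity)
      have e3 : S.v y s * S.press y s = g y s := by
        have := S.v_mul_iv y s
        simp only [press, hg]; linear_combination S.θ y s * this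
      calc _ ≤ S.v y s * (C₂ * Real.exp (-q s)) * S.press y s :=
            mul_le_mul_of_nonneg_right e1 (S.press_nonneg y s)
        _ = C₂ * (g y s * Real.exp (-q s)) := by rw [← e3]; ring
    rw [intervalIntegral.integral_const_mul] at h2
    have h3 : Real.exp (-q t) * Real.exp (S.hv y t)
        ≤ C₁ * Real.exp (∫ s in (0:ℝ)..t, S.press y s) := by
      rw [hC₁, ← Real.exp_add, ← Real.exp_add]
      refine Real.exp_le_exp.2 ?_
      linarith [hrep y t, h0hi y, (abs_le.1 (hq' y hy t ht)).2]
    refine h3.trans (mul_le_mul_of_nonneg_left ?_ (by positivity))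
    linarith
  have hlow : ∀ y ∈ Icc a (a + 1), ∀ t ∈ Icc 0 T,
      Real.exp (lo - M) * Real.exp (q t) ≤ Real.exp (S.hv y t) := by
    intro y hy t ht
    rw [← Real.exp_add]
    refine Real.exp_le_exp.2 ?_
    linarith [hrep y t, h0lo y, (abs_le.1 (hq' y hy t ht)).1, hI0 y t ht]
  have hmean : ∀ t ∈ Icc 0 T, m ≤ ∫ y in a..(a + 1), Real.exp (S.hv y t) := by
    intro t ht
    have h1 := hE.integral_le (f := fun y => -Real.exp (S.hv y t)) (c := f₁ / (2 * E)) (d := -f₁)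
      (a := a) (by positivity) ht (by fun_prop) fun y => by
        obtain ⟨e1, e2, e3, e4, e5⟩ := S.le_energy y t
        have e6 : ent (S.v y t) ≤ S.energy ent y t := by linarith
        have e7 : f₁ / (2 * E) * ent (S.v y t) ≤ f₁ / (2 * E) * S.energy ent y t :=
          mul_le_mul_of_nonneg_left e6 (by positivity)
        rcases le_or_gt c₁ (S.v y t) with h | h
        · have := Real.exp_le_exp.2 (S.hv_ge hα (Real.exp_pos _) h)
          have : 0 ≤ f₁ / (2 * E) * ent (S.v y t) := by positivity
          linarith
        · have h2 : Real.log (S.v y t) < -(2 * E) - 1 := by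
            rw [← Real.log_exp (-(2 * E) - 1)]
            exact Real.log_lt_log (S.v_pos y t) h
          have h3 : 2 * E ≤ ent (S.v y t) := by
            have := S.v_pos y t
            unfold ent; linarith
          have h4 : f₁ ≤ f₁ / (2 * E) * ent (S.v y t) := by
            rw [div_mul_eq_mul_div, le_div_iff₀ (by positivity)]
            exact mul_le_mul_of_nonneg_left h3 (Real.exp_pos _).le
          have := Real.exp_pos (S.hv y t)
          linarith
    rw [intervalIntegral.integral_neg] at h1
    have : f₁ / (2 * E) * E = f₁ * (1 / 2) := by field_simp
    rw [this] at h1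
    linarith
  have hgI : ∀ s ∈ Icc 0 T, ∫ y in a..(a + 1), g y s ≤ 2 * E + 2 := by
    intro s hs
    refine hE.integral_le zero_le_two hs (by fun_prop) fun y => ?_
    obtain ⟨e1, e2, e3, e4, e5⟩ := S.le_energy y s
    have := le_ent (S.θ_pos y s)
    simp only [hg]; linarith
  have hgron : ∀ t ∈ Icc 0 T, Real.exp (-q t) ≤ C₁ / m + ∫ s in (0:ℝ)..t, A * Real.exp (-q s) := by
    intro t ht
    have h1 := integral_le_of_cont (f := fun y => Real.exp (-q t) * Real.exp (S.hv y t))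
      (g := fun y => C₁ * (1 + C₂ * ∫ s in (0:ℝ)..t, g y s * Real.exp (-q s)))
      (by linarith : a ≤ a + 1) (by fun_prop) (by
        have := continuous_slice_integral (f := fun s y => g y s * Real.exp (-q s))
          (by fun_prop) 0 t
        fun_prop) fun y hy => hup y hy t ht
    have hsl := continuous_slice_integral (f := fun s y => g y s * Real.exp (-q s))
          (by fun_prop) 0 t
    rw [intervalIntegral.integral_const_mul, intervalIntegral.integral_const_mul,
      integral_add_cont _ _ (by fun_prop) (by fun_prop), intervalIntegral.integral_const_mul,
      integral_swap_cont (f := fun y s => g y s * Real.exp (-q s)) (by fun_prop)] at h1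
    have h2 : ∫ s in (0:ℝ)..t, ∫ y in a..(a + 1), g y s * Real.exp (-q s)
        ≤ ∫ s in (0:ℝ)..t, (2 * E + 2) * Real.exp (-q s) := by
      refine integral_le_of_cont ht.1
        (continuous_slice_integral (f := fun y s => g y s * Real.exp (-q s)) (by fun_prop) _ _)
        (by fun_prop) fun s hs => ?_
      rw [intervalIntegral.integral_mul_const]
      exact mul_le_mul_of_nonneg_right (hgI s ⟨hs.1, hs.2.trans ht.2⟩) (Real.exp_pos _).le
    rw [intervalIntegral.integral_const_mul] at h2 ⊢
    simp only [intervalIntegral.integral_const, smul_eq_mul, mul_one, add_sub_cancel_left] at h1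
    have h3 := mul_le_mul_of_nonneg_left (hmean t ht) (Real.exp_pos (-q t)).le
    have h4 : Real.exp (-q t) * m
        ≤ C₁ * (1 + C₂ * ((2 * E + 2) * ∫ s in (0:ℝ)..t, Real.exp (-q s))) := by
      refine h3.trans (h1.trans ?_)
      gcongr
    rw [← le_div_iff₀ hm0] at h4
    refine h4.trans (le_of_eq ?_)
    rw [hA]; ring
  have hY' : ∀ t ∈ Icc 0 T, Real.exp (-q t) ≤ Y := by
    intro t ht
    refine (gronwall_integral (c := C₁ / m) (by fun_prop) continuous_const
      (fun _ _ => hA0.le) hgron t ht).trans ?_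
    rw [intervalIntegral.integral_const, smul_eq_mul, sub_zero, mul_comm t A]
    exact mul_le_mul_of_nonneg_left (Real.exp_le_exp.2
      (mul_le_mul_of_nonneg_left ht.2 hA0.le)) (by positivity)
  have haI : a ∈ Icc a (a + 1) := ⟨le_rfl, by linarith⟩
  intro t ht
  have hvlow : c ≤ Real.exp (S.hv a t) := by
    refine le_trans ?_ (hlow a haI t ht)
    rw [hc, div_eq_mul_inv]
    refine mul_le_mul_of_nonneg_left ?_ (Real.exp_pos _).le
    rw [inv_le_comm₀ hY0 (Real.exp_pos _), ← Real.exp_neg]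
    exact hY' t ht
  have hcv : c ≤ S.v a t := hvlow.trans (S.exp_hv_le a t)
  refine ⟨hcv, ?_⟩
  have hqZ : Real.exp (q t) ≤ Z := by
    have h1 := integral_le_of_cont (f := fun _ => Real.exp (lo - M) * Real.exp (q t))
      (g := fun y => S.v y t) (by linarith : a ≤ a + 1) (by fun_prop) (by fun_prop)
      fun y hy => (hlow y hy t ht).trans (S.exp_hv_le y t)
    have h2 := hE.integral_le (f := fun y => S.v y t) (c := 2) (d := 2) (a := a) zero_le_two ht
      (by fun_prop) fun y => by
        obtain ⟨e1, e2, e3, e4, e5⟩ := S.le_energy y t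
        have := le_ent (S.v_pos y t)
        linarith
    simp only [intervalIntegral.integral_const, smul_eq_mul, add_sub_cancel_left,
      one_mul] at h1
    have h3 := h1.trans h2
    have h4 : C₂ * Real.exp (lo - M) = 1 := by
      rw [hC₂, ← Real.exp_add]; simp
    calc Real.exp (q t) = C₂ * (Real.exp (lo - M) * Real.exp (q t)) := by
          rw [← mul_assoc, h4, one_mul]
      _ ≤ C₂ * (2 * E + 2) := mul_le_mul_of_nonneg_left h3 (by positivity)
      _ = Z := by rw [hZ]; ring
  have h1 : S.v a t ≤ Real.exp (c ^ (-α)) * Real.exp (S.hv a t) := by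
    rw [← Real.exp_add]
    have h2 := Real.rpow_le_rpow_of_nonpos hc0 hcv (neg_nonpos.2 hα)
    calc S.v a t = Real.exp (Real.log (S.v a t)) := (Real.exp_log (S.v_pos a t)).symm
      _ ≤ _ := Real.exp_le_exp.2 (by unfold hv; linarith)
  have h2 : ∫ s in (0:ℝ)..t, g a s * Real.exp (-q s) ≤ Y * ∫ s in (0:ℝ)..t, g a s := by
    rw [← intervalIntegral.integral_const_mul]
    refine integral_le_of_cont ht.1 (by fun_prop) (by fun_prop) fun s hs => ?_
    rw [mul_comm]
    exact mul_le_mul_of_nonneg_right (hY' s ⟨hs.1, hs.2.trans ht.2⟩) (hg0 a s)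
  have h3 : 0 ≤ ∫ s in (0:ℝ)..t, g a s := integral_nonneg_of_cont ht.1 fun s _ => hg0 a s
  have h4 : Real.exp (S.hv a t) ≤ Z * (C₁ * (1 + C₂ * (Y * ∫ s in (0:ℝ)..t, g a s))) := by
    have h5 := hup a haI t ht
    have h6 : Real.exp (S.hv a t)
        = Real.exp (q t) * (Real.exp (-q t) * Real.exp (S.hv a t)) := by
      rw [← mul_assoc, ← Real.exp_add]; simp
    rw [h6]
    refine mul_le_mul hqZ (h5.trans ?_) (by positivity) hZ0.le
    gcongr
  refine h1.trans ?_
  rw [mul_assoc (Real.exp (c ^ (-α)))]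
  refine mul_le_mul_of_nonneg_left (h4.trans ?_) (Real.exp_pos _).le
  have h7 : 1 + C₂ * (Y * ∫ s in (0:ℝ)..t, g a s)
      ≤ (1 + C₂ * Y) * (1 + ∫ s in (0:ℝ)..t, g a s) := by
    have : 0 ≤ C₂ * Y := by positivity
    nlinarith
  calc _ ≤ Z * (C₁ * ((1 + C₂ * Y) * (1 + ∫ s in (0:ℝ)..t, g a s))) := by gcongr
    _ = _ := by ring

end MHDFlow

/-! ### The lower bound on the temperature -/

theorem second_deriv_nonneg_of_isLocalMin {f f' : ℝ → ℝ} {f'' x : ℝ} (hmin : IsLocalMin f x)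
    (h1 : ∀ y, HasDerivAt f (f' y) y) (h2 : HasDerivAt f' f'' x) : 0 ≤ f'' := by
  by_contra! hneg
  have hd : deriv f = f' := funext fun y => (h1 y).deriv
  have h0 : f' x = 0 := hmin.hasDerivAt_eq_zero (h1 x)
  have hmax : IsLocalMax f x := isLocalMax_of_deriv_deriv_neg (by rw [hd, h2.deriv]; exact hneg)
    (by rw [hd, h0]) (h1 x).continuousAt
  have heq : ∀ᶠ y in nhds x, f y = f x := by
    filter_upwards [hmin, hmax] with y a b using le_antisymm b a
  have heq' : ∀ᶠ y in nhds x, f' y = 0 := by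
    filter_upwards [heq.eventually_nhds] with y hy
    exact (h1 y).unique ((hasDerivAt_const y (f x)).congr_of_eventuallyEq hy)
  have := h2.unique ((hasDerivAt_const x (0:ℝ)).congr_of_eventuallyEq heq')
  linarith

theorem deriv_nonpos_of_le_left {f : ℝ → ℝ} {f' a t : ℝ} (hat : a < t) (hd : HasDerivAt f f' t)
    (h : ∀ s ∈ Ioo a t, f t ≤ f s) : f' ≤ 0 := by
  have hs := (hasDerivAt_iff_tendsto_slope.1 hd).mono_left
    (nhdsWithin_mono t (fun s (hs : s ∈ Iio t) => (ne_of_lt hs : s ≠ t)))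
  refine le_of_tendsto hs ?_
  filter_upwards [Ioo_mem_nhdsLT hat] with s hs
  rw [slope_def_field]
  exact div_nonpos_of_nonneg_of_nonpos (by linarith [h s hs]) (by linarith [hs.2])

namespace MHDFlow

variable {α β T : ℝ} {S : MHDFlow α β T}

/-- At a spatial minimum the temperature decreases at most quadratically. -/
theorem θt_ge_of_isLocalMin (hα : 0 ≤ α) {c x t : ℝ} (hc : 0 < c) (hv : c ≤ S.v x t)
    (hmin : IsLocalMin (fun y => S.θ y t) x) :
    -(1 / (4 * c) * S.θ x t ^ 2) ≤ S.θt x t := by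
  have h1 : S.θx x t = 0 := hmin.hasDerivAt_eq_zero (S.hasDeriv_θ x t)
  have h2 : 0 ≤ S.θxx x t :=
    second_deriv_nonneg_of_isLocalMin hmin (fun y => S.hasDeriv_θ y t) (S.hasDeriv_θx x t)
  have h3 := S.iv_pos x t
  have h4 := S.one_le_mu hα x t
  have h5 : S.iv x t ≤ 1 / c := by
    rw [one_div]; exact inv_anti₀ hc hv
  have h6 := mul_nonneg (S.θp_pos β x t).le h2
  have h7 : 0 ≤ S.mu x t * S.ux x t ^ 2 - S.ux x t ^ 2 := by
    nlinarith [sq_nonneg (S.ux x t)]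
  have h8 : 0 ≤ S.θp β x t * S.θxx x t + (S.mu x t * S.ux x t ^ 2 - S.ux x t ^ 2)
      + (S.ux x t - 1 / 2 * S.θ x t) ^ 2
      + (S.wx 0 x t ^ 2 + S.wx 1 x t ^ 2) + (S.bx 0 x t ^ 2 + S.bx 1 x t ^ 2) := by positivity
  have h9 := mul_nonneg h3.le h8
  have h10 := mul_le_mul_of_nonneg_left h5 (by positivity : 0 ≤ 1 / 4 * S.θ x t ^ 2)
  have h11 : 1 / (4 * c) * S.θ x t ^ 2 = 1 / 4 * S.θ x t ^ 2 * (1 / c) := by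
    field_simp
  rw [S.θt_eq, h1, h11]
  linarith

theorem temperature_lower_bound (hα : 0 ≤ α) (hT : 0 < T) {K δ c : ℝ} (hδ : 0 < δ) (hδ1 : δ ≤ 1)
    (hc : 0 < c) (hI : S.Init K δ) (hv : ∀ x, ∀ t ∈ Icc 0 T, c ≤ S.v x t) :
    ∀ x, ∀ t ∈ Icc 0 T, 1 / (1 / δ + 1 / (4 * c) * T) ≤ S.θ x t := by
  set κ := 1 / (4 * c) with hκ
  have hκ0 : 0 < κ := by positivity
  have hd1 : 1 ≤ 1 / δ := by rw [le_div_iff₀ hδ]; linarith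
  have main : ∀ t ∈ Ico 0 T, ∀ x, 1 ≤ S.θ x t * (1 / δ + κ * t) := by
    intro t₁ ht₁ x₁
    by_contra! hlt
    set m := S.θ x₁ t₁ * (1 / δ + κ * t₁) with hm
    obtain ⟨R, hR⟩ : ∃ R, ∀ x t, R ≤ |x| → m < S.θ x t := by
      have h := S.lim_θ.eventually (lt_mem_nhds hlt)
      rw [spaceInf, eventually_comap] at h
      rw [← Metric.cobounded_eq_cocompact, ← comap_norm_atTop, eventually_comap] at h
      obtain ⟨R, hR⟩ := eventually_atTop.1 h
      exact ⟨R, fun x t hx => hR _ hx x rfl (x, t) rfl⟩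
    set Q := max R |x₁| with hQ
    have hQ0 : 0 ≤ Q := (abs_nonneg _).trans (le_max_right _ _)
    obtain ⟨⟨x₀, t₀⟩, hp, hmin⟩ := (isCompact_Icc.prod isCompact_Icc :
      IsCompact (Icc (-Q) Q ×ˢ Icc 0 t₁)).exists_isMinOn (f := fun p : ℝ × ℝ =>
        S.θ p.1 p.2 * (1 / δ + κ * p.2)) ⟨(x₁, t₁),
        ⟨abs_le.1 (le_max_right _ _), ⟨ht₁.1, le_rfl⟩⟩⟩ (by fun_prop)
    rw [isMinOn_iff] at hmin
    simp only [mem_prod, Prod.forall] at hmin hp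
    obtain ⟨hx₀, ht₀⟩ := hp
    have hle : S.θ x₀ t₀ * (1 / δ + κ * t₀) ≤ m :=
      hmin x₁ t₁ ⟨abs_le.1 (le_max_right _ _), ⟨ht₁.1, le_rfl⟩⟩
    have hg0 : 1 ≤ 1 / δ + κ * t₀ := by nlinarith [ht₀.1]
    have hθ := S.θ_pos x₀ t₀
    have hxlt : |x₀| < R := by
      by_contra! h
      have := hR x₀ t₀ h
      nlinarith
    have hx : x₀ ∈ Ioo (-Q) Q := abs_lt.1 (hxlt.trans_le (le_max_left _ _))
    have ht0 : 0 < t₀ := by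
      refine ht₀.1.lt_of_ne fun h => ?_
      rw [← h, mul_zero, add_zero] at hle
      have h1 := mul_le_mul_of_nonneg_right (hI.θ_ge x₀) (by positivity : 0 ≤ 1 / δ)
      rw [mul_one_div_cancel hδ.ne', ] at h1
      linarith
    have htT : t₀ < T := ht₀.2.trans_lt ht₁.2
    have hloc : IsLocalMin (fun y => S.θ y t₀) x₀ := by
      filter_upwards [Ioo_mem_nhds hx.1 hx.2] with y hy
      exact le_of_mul_le_mul_right (hmin y t₀ ⟨Ioo_subset_Icc_self hy, ht₀⟩) (by linarith)
    have h1 := θt_ge_of_isLocalMin hα hc (hv x₀ t₀ ⟨ht0.le, htT.le⟩) hloc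
    have h2 : HasDerivAt (fun s => S.θ x₀ s * (1 / δ + κ * s))
        (S.θt x₀ t₀ * (1 / δ + κ * t₀) + S.θ x₀ t₀ * κ) t₀ := by
      refine ((S.hasTDeriv_θ x₀ t₀ ⟨ht0, htT⟩).fun_mul
        (((hasDerivAt_id' t₀).const_mul κ).const_add (1 / δ))).congr_deriv ?_
      ring
    have h3 := deriv_nonpos_of_le_left ht0 h2 fun s hs =>
      hmin x₀ s ⟨hx₀, ⟨hs.1.le, hs.2.le.trans ht₀.2⟩⟩
    have h4 := mul_le_mul_of_nonneg_right h1 (zero_le_one.trans hg0)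
    have h5 : 0 < κ * S.θ x₀ t₀ * (1 - S.θ x₀ t₀ * (1 / δ + κ * t₀)) := by
      have : 0 < 1 - S.θ x₀ t₀ * (1 / δ + κ * t₀) := by linarith
      positivity
    linarith
  intro x
  have hcl : IsClosed {t | 1 / (1 / δ + κ * T) ≤ S.θ x t} :=
    isClosed_le continuous_const (by fun_prop)
  have hsub : Ico 0 T ⊆ {t | 1 / (1 / δ + κ * T) ≤ S.θ x t} := by
    intro t ht
    have h1 := main t ht x
    have h2 : 0 < 1 / δ + κ * T := by positivity
    have h3 := S.θ_pos x t
    rw [mem_ofPred_eq, div_le_iff₀ h2]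
    refine h1.trans ?_
    have := ht.2.le
    gcongr
  have := hcl.closure_subset_iff.2 hsub
  rw [closure_Ico hT.ne] at this
  exact fun t ht => this ht

end MHDFlow

/-! ### Energy inequalities at sublinear temperature weights -/

theorem sub_one_sq_le_ent {z : ℝ} (hz : 0 < z) : (z - 1) ^ 2 ≤ 2 * (z + 1) * ent z := by
  have hs := Real.sqrt_pos.2 hz
  have h1 := Real.log_le_sub_one_of_pos hs
  rw [Real.log_sqrt hz.le] at h1
  have h2 := Real.sq_sqrt hz.le
  set s := Real.sqrt z
  have h3 : (s - 1) ^ 2 ≤ ent z := by unfold ent; nlinarith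
  have h4 : (s + 1) ^ 2 ≤ 2 * (z + 1) := by nlinarith [sq_nonneg (s - 1)]
  have h5 := mul_le_mul h4 h3 (sq_nonneg _) (by positivity)
  calc (z - 1) ^ 2 = (s + 1) ^ 2 * (s - 1) ^ 2 := by rw [← h2]; ring
    _ ≤ _ := h5

theorem sq_rpow_sub_one_mul_le {ε z : ℝ} (hε : 0 ≤ ε) (hε1 : ε ≤ 1) (hz : 0 < z) :
    (z ^ (1 - ε) - 1) ^ 2 * z ^ ε ≤ 4 * (z ^ (1 - ε) + 1) * ent z := by
  have he := ent_nonneg hz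
  have hs := sub_one_sq_le_ent hz
  rcases le_total 1 z with h | h
  · have e1 : z ^ (1 - ε) = z * z ^ (-ε) := by
      rw [sub_eq_add_neg, Real.rpow_add hz, Real.rpow_one]
    have e2 : z ^ (-ε) * z ^ ε = 1 := by rw [← Real.rpow_add hz, neg_add_cancel, Real.rpow_zero]
    have e3 : z ^ (-ε) ≤ 1 := Real.rpow_le_one_of_one_le_of_nonpos h (neg_nonpos.2 hε)
    have e4 : 1 ≤ z ^ (1 - ε) := Real.one_le_rpow h (by linarith)
    have e5 : 0 < z ^ (-ε) := Real.rpow_pos_of_pos hz _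
    have e6 : 0 < z ^ ε := Real.rpow_pos_of_pos hz _
    rw [e1] at e4 ⊢
    set r := z ^ (-ε)
    set q := z ^ ε
    have h1 : (z * r - 1) ^ 2 ≤ (r * (z - 1)) ^ 2 := by
      apply pow_le_pow_left₀ <;> nlinarith
    calc (z * r - 1) ^ 2 * q ≤ (r * (z - 1)) ^ 2 * q := by gcongr
      _ = r * (z - 1) ^ 2 * (r * q) := by ring
      _ = r * (z - 1) ^ 2 := by rw [e2, mul_one]
      _ ≤ r * (2 * (z + 1) * ent z) := by gcongr
      _ ≤ 4 * (z * r + 1) * ent z := by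
        have : 0 ≤ r * (z - 1) * ent z := mul_nonneg (mul_nonneg e5.le (by linarith)) he
        nlinarith
  · have e1 : z ^ (1 - ε) ≤ 1 := Real.rpow_le_one hz.le h (by linarith)
    have e2 : z ≤ z ^ (1 - ε) := by
      simpa using Real.rpow_le_rpow_of_exponent_ge hz h (by linarith : 1 - ε ≤ 1)
    have e3 : z ^ ε ≤ 1 := Real.rpow_le_one hz.le h hε
    have e6 : 0 < z ^ ε := Real.rpow_pos_of_pos hz _
    have h1 : (z ^ (1 - ε) - 1) ^ 2 ≤ (z - 1) ^ 2 := by nlinarith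
    calc (z ^ (1 - ε) - 1) ^ 2 * z ^ ε ≤ (z - 1) ^ 2 * 1 := by gcongr
      _ ≤ 4 * (z ^ (1 - ε) + 1) * ent z := by nlinarith

theorem exists_rpow_le_linear {ε η : ℝ} (hε : 0 < ε) (hε1 : ε ≤ 1) (hη : 0 < η) :
    ∃ C, 0 ≤ C ∧ ∀ z > 0, z ^ (1 - ε) ≤ η * z + C := by
  set R := η ^ (-(1 / ε)) with hR
  have hR0 : 0 < R := Real.rpow_pos_of_pos hη _
  refine ⟨R ^ (1 - ε), (Real.rpow_pos_of_pos hR0 _).le, fun z hz => ?_⟩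
  rcases le_total z R with h | h
  · have := Real.rpow_le_rpow hz.le h (by linarith : 0 ≤ 1 - ε)
    have := mul_pos hη hz
    linarith
  · have h1 : z ^ (-ε) ≤ η := by
      refine (Real.rpow_le_rpow_of_nonpos hR0 h (neg_nonpos.2 hε.le)).trans (le_of_eq ?_)
      rw [hR, ← Real.rpow_mul hη.le]
      have : -(1 / ε) * -ε = 1 := by field_simp
      rw [this, Real.rpow_one]
    have h2 : z ^ (1 - ε) = z ^ (-ε) * z := by
      rw [sub_eq_add_neg, add_comm, Real.rpow_add hz, Real.rpow_one]
    have := mul_le_mul_of_nonneg_right h1 hz.le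
    have := Real.rpow_pos_of_pos hR0 (1 - ε)
    linarith

/-- The temperature potential at weight `ε`. -/
def potential (ε z : ℝ) : ℝ := z - 1 - (z ^ (1 - ε) - 1) / (1 - ε)

theorem hasDerivAt_potential {ε z : ℝ} (hε : ε < 1) (hz : 0 < z) :
    HasDerivAt (potential ε) (1 - z ^ (-ε)) z := by
  have h : 1 - ε ≠ 0 := by linarith
  refine (((hasDerivAt_id z).sub_const 1).sub
    (((Real.hasDerivAt_rpow_const (p := 1 - ε) (Or.inl hz.ne')).sub_const 1).div_const
      (1 - ε))).congr_deriv ?_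
  rw [mul_div_cancel_left₀ _ h]
  ring_nf

theorem potential_nonneg {ε z : ℝ} (hε : 0 ≤ ε) (hε1 : ε < 1) (hz : 0 < z) :
    0 ≤ potential ε z := by
  have h := rpow_one_add_le_one_add_mul_self (s := z - 1) (p := 1 - ε) (by linarith)
    (by linarith) (by linarith)
  rw [add_sub_cancel] at h
  have h1 : (z ^ (1 - ε) - 1) / (1 - ε) ≤ z - 1 := by
    rw [div_le_iff₀ (by linarith)]; linarith
  unfold potential; linarith

theorem potential_le_ent {ε z : ℝ} (hε1 : ε < 1) (hz : 0 < z) :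
    potential ε z ≤ ent z := by
  have h := Real.log_le_sub_one_of_pos (Real.rpow_pos_of_pos hz (1 - ε))
  rw [Real.log_rpow hz] at h
  have h1 : Real.log z ≤ (z ^ (1 - ε) - 1) / (1 - ε) := by
    rw [le_div_iff₀ (by linarith)]; linarith
  unfold potential ent; linarith

namespace MHDFlow

variable {α β T : ℝ} (S : MHDFlow α β T)

/-- The dissipation density of the square root of the temperature. -/
def sqrtDissipation (x t : ℝ) : ℝ := S.θp (-1) x t * S.θx x t ^ 2 * S.iv x t

@[fun_prop] theorem continuous_sqrtDissipation {X : Type*} [TopologicalSpace X] {f g : X → ℝ}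
    (hf : Continuous f) (hg : Continuous g) :
    Continuous fun x => S.sqrtDissipation (f x) (g x) := by
  unfold sqrtDissipation; fun_prop

theorem sqrtDissipation_nonneg (x t : ℝ) : 0 ≤ S.sqrtDissipation x t := by
  have := S.θp_pos (-1) x t
  have := S.iv_pos x t
  unfold sqrtDissipation; positivity

variable {S}

/-- A weighted pointwise bound of the temperature by the dissipation on a unit interval. -/
theorem EntropyBound.weighted_temperature_le {E : ℝ} (hE : S.EntropyBound E) (hE0 : 0 < E)
    {k kd : ℝ → ℝ} (hk : ∀ x, HasDerivAt k (kd x) x) (hkd : Continuous kd) {a x t : ℝ}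
    (ht : t ∈ Icc 0 T) (hx : x ∈ Icc a (a + 1)) (hk0 : ∀ y ∈ Icc a (a + 1), 0 ≤ k y)
    (hk1 : ∀ y ∈ Icc a (a + 1), k y ≤ 1) (hkd2 : ∀ y ∈ Icc a (a + 1), |kd y| ≤ 2) :
    k x ^ 2 * S.θ x t ≤ (2 * (3 * E + 5) ^ 2 + (E + 1))
      * (1 + ∫ y in a..(a + 1), k y ^ 2 * S.sqrtDissipation y t) := by
  have hkc : Continuous k := continuous_iff_continuousAt.2 fun x => (hk x).continuousAt
  set f := fun y => k y * S.θp (1 / 2) y t with hf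
  set f' := fun y => kd y * S.θp (1 / 2) y t + k y * (1 / 2 * S.θp (-(1 / 2)) y t * S.θx y t)
    with hf'
  set p := fun y => |k y * S.θp (-(1 / 2)) y t * S.θx y t| * Real.sqrt (S.iv y t) with hp
  have hd : ∀ y, HasDerivAt f (f' y) y := fun y =>
    ((hk y).fun_mul (S.hasDeriv_θp (1 / 2) y t)).congr_deriv (by
      rw [hf']; norm_num)
  have hm := le_integral_unit hx hd (by fun_prop)
  have h1 : ∫ y in a..(a + 1), S.θp (1 / 2) y t ≤ 1 * E + 3 / 2 := by
    refine hE.integral_le zero_le_one ht (by fun_prop) fun y => ?_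
    obtain ⟨e1, e2, e3, e4, e5⟩ := S.le_energy y t
    have e6 := le_ent (S.θ_pos y t)
    have e7 := S.θp_add (1 / 2) (1 / 2) y t
    rw [add_halves, θp_one] at e7
    nlinarith [sq_nonneg (S.θp (1 / 2) y t - 1)]
  have hV : ∫ y in a..(a + 1), Real.sqrt (S.v y t) ^ 2 ≤ 2 * E + 2 := by
    refine hE.integral_le zero_le_two ht (by fun_prop) fun y => ?_
    obtain ⟨e1, e2, e3, e4, e5⟩ := S.le_energy y t
    have e6 := le_ent (S.v_pos y t)
    rw [Real.sq_sqrt (S.v_pos y t).le]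
    linarith
  have hB : ∀ y, |k y * S.θp (-(1 / 2)) y t * S.θx y t| = p y * Real.sqrt (S.v y t) := by
    intro y
    rw [hp]
    rw [mul_assoc |_|, ← Real.sqrt_mul (S.iv_pos y t).le, mul_comm (S.iv y t), S.v_mul_iv,
      Real.sqrt_one, mul_one]
  have h2 : ∫ y in a..(a + 1), f y ≤ ∫ y in a..(a + 1), S.θp (1 / 2) y t :=
    integral_le_of_cont (by linarith) (by fun_prop) (by fun_prop) fun y hy => by
      have := S.θp_pos (1 / 2) y t
      exact mul_le_of_le_one_left this.le (hk1 y hy)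
  have h3 := integral_le_lin2 (f := fun y => |f' y|) (g₁ := fun y => S.θp (1 / 2) y t)
    (g₂ := fun y => p y * Real.sqrt (S.v y t)) (a := a) (b := a + 1) 2 (1 / 2) (by linarith)
    (by fun_prop) (by fun_prop) (by fun_prop) fun y hy => by
      rw [← hB]
      have e1 := S.θp_pos (1 / 2) y t
      refine (abs_add_le _ _).trans (add_le_add ?_ (le_of_eq ?_))
      · rw [abs_mul, abs_of_pos e1]
        exact mul_le_mul_of_nonneg_right (hkd2 y hy) e1.le
      · rw [show k y * (1 / 2 * S.θp (-(1 / 2)) y t * S.θx y t)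
          = 1 / 2 * (k y * S.θp (-(1 / 2)) y t * S.θx y t) by ring, abs_mul,
          abs_of_pos (by norm_num : (0:ℝ) < 1 / 2)]
  have h4 := sq_integral_mul_le (f := p) (g := fun y => Real.sqrt (S.v y t)) (a := a) (b := a + 1)
    (by linarith) (by fun_prop) (by fun_prop)
  have hJ : ∫ y in a..(a + 1), p y ^ 2
      = ∫ y in a..(a + 1), k y ^ 2 * S.sqrtDissipation y t := by
    refine intervalIntegral.integral_congr fun y _ => ?_
    have e1 := S.θp_add (-(1 / 2)) (-(1 / 2)) y t
    rw [show (-(1 / 2) + -(1 / 2) : ℝ) = -1 by norm_num] at e1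
    have e2 := Real.sq_sqrt (S.iv_pos y t).le
    show (|k y * S.θp (-(1 / 2)) y t * S.θx y t| * Real.sqrt (S.iv y t)) ^ 2 = _
    rw [mul_pow, sq_abs, e2, sqrtDissipation, e1]
    ring
  rw [hJ] at h4
  set J := ∫ y in a..(a + 1), k y ^ 2 * S.sqrtDissipation y t with hJd
  have hJ0 : 0 ≤ J := integral_nonneg_of_cont (by linarith) fun y _ =>
    mul_nonneg (sq_nonneg _) (S.sqrtDissipation_nonneg y t)
  set B := ∫ y in a..(a + 1), p y * Real.sqrt (S.v y t) with hBd
  have h5 : B ^ 2 ≤ J * (2 * E + 2) := h4.trans (mul_le_mul_of_nonneg_left hV hJ0)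
  have h6 : f x ≤ (3 * E + 5) + 1 / 2 * B := by linarith
  have h7 : 0 ≤ f x := mul_nonneg (hk0 x hx) (S.θp_pos _ _ _).le
  have h8 : k x ^ 2 * S.θ x t = f x ^ 2 := by
    have e7 := S.θp_add (1 / 2) (1 / 2) x t
    rw [add_halves, θp_one] at e7
    rw [hf, e7]; ring
  rw [h8]
  have h9 := pow_le_pow_left₀ h7 h6 2
  nlinarith [sq_nonneg ((3 * E + 5) - 1 / 2 * B), mul_nonneg hJ0 (sq_nonneg (3 * E + 5))]

/-- The weighted temperature is controlled uniformly on the support of the cutoff. -/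
theorem EntropyBound.cut_temperature_le {E : ℝ} (hE : S.EntropyBound E) (hE0 : 0 < E)
    {L x t : ℝ} (hL : 1 ≤ L) (hx : x ∈ Icc (-L) L) (ht : t ∈ Icc 0 T) :
    cut L x ^ 2 * S.θ x t ≤ (2 * (3 * E + 5) ^ 2 + (E + 1))
      * (1 + ∫ y in (-L)..L, cut L y ^ 2 * S.sqrtDissipation y t) := by
  obtain ⟨a, ha, hxa, haL⟩ : ∃ a, -L ≤ a ∧ x ∈ Icc a (a + 1) ∧ a + 1 ≤ L := by
    rcases le_total x (L - 1) with h | h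
    · exact ⟨x, hx.1, ⟨le_rfl, by linarith⟩, by linarith⟩
    · exact ⟨L - 1, by linarith, ⟨h, by linarith [hx.2]⟩, by linarith⟩
  have hsub : ∀ y ∈ Icc a (a + 1), y ∈ Icc (-L) L := fun y hy =>
    ⟨ha.trans hy.1, hy.2.trans haL⟩
  refine (hE.weighted_temperature_le hE0 (k := cut L) hasDerivAt_cut (by fun_prop) ht hxa
    (fun y hy => cut_nonneg hL (hsub y hy)) (fun y _ => cut_le_one L y)
    fun y hy => (abs_cutd_le hL (hsub y hy)).trans ?_).trans ?_
  · rw [div_le_iff₀ (by linarith)]; linarith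
  · refine mul_le_mul_of_nonneg_left (add_le_add_right ?_ 1) (by positivity)
    exact integral_subinterval_le ha (by linarith) haL (by fun_prop) fun y _ =>
      mul_nonneg (sq_nonneg _) (S.sqrtDissipation_nonneg y t)

/-- The energy inequality with the compression source absorbed. -/
theorem EntropyBound.energy_inequality {E : ℝ} (hE : S.EntropyBound E) (hE0 : 0 < E) (hα : 0 ≤ α)
    (hT : 0 < T) {K δ c ε η N : ℝ} (hI : S.Init K δ) (hδ : 0 < δ) (hc : 0 < c)
    (hv : ∀ x, ∀ t ∈ Icc 0 T, c ≤ S.v x t) (hε : 0 ≤ ε) (hε1 : ε < 1) (hη : 0 ≤ η) (hN : 0 ≤ N)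
    (hlin : ∀ z > 0, z ^ (1 - ε) ≤ η * z + N) :
    ∀ᶠ L in atTop, 1 ≤ L ∧ ∀ t ∈ Icc 0 T,
      1 / 4 * (∫ s in (0:ℝ)..t, ∫ x in (-L)..L, cut L x ^ 2 * S.dissipation ε x s)
        ≤ (2 + K ^ 2 + 1 / δ) * K ^ 2 + 1
          + 4 * E / c * (η * (2 * (3 * E + 5) ^ 2 + (E + 1)) + N + 1) * T
          + 4 * E / c * (η * (2 * (3 * E + 5) ^ 2 + (E + 1)))
            * ∫ s in (0:ℝ)..t, ∫ x in (-L)..L, cut L x ^ 2 * S.sqrtDissipation x s := by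
  set C₁ := 2 * (3 * E + 5) ^ 2 + (E + 1) with hC₁
  have hC₁0 : 0 < C₁ := by positivity
  have hΨ0 : ∀ x t, 0 ≤ S.energy (potential ε) x t :=
    energy_nonneg fun z hz => potential_nonneg hε hε1 hz
  have hΨc : Continuous fun x => S.energy (potential ε) x 0 :=
    S.continuous_energy (fun z hz => hasDerivAt_potential hε1 hz) continuous_id continuous_const
  filter_upwards [S.energy_inequality hα hT hε fun z hz => hasDerivAt_potential hε1 hz]
    with L ⟨hL, h⟩
  refine ⟨hL, fun t ht => ?_⟩
  have h0 := h t ht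
  have h1 : ∫ x in (-L)..L, cut L x ^ 2 * S.energy (potential ε) x 0
      ≤ ∫ x in (-L)..L, S.energy (potential ε) x 0 :=
    integral_le_of_cont (by linarith) (by fun_prop) (by fun_prop)
      fun x hx => cut_sq_mul_le hL hx (hΨ0 x 0)
  have h2 := h1.trans (hI.energy_le hδ (fun z hz => potential_le_ent hε1 hz) (by linarith)
    (by fun_prop))
  have h3 : 0 ≤ ∫ x in (-L)..L, cut L x ^ 2 * S.energy (potential ε) x t :=
    integral_nonneg_of_cont (by linarith) fun x _ => mul_nonneg (sq_nonneg _) (hΨ0 x t)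
  have key : ∀ s ∈ Icc 0 t, ∫ x in (-L)..L, cut L x ^ 2 * S.compression ε x s
      ≤ 1 / 4 * (∫ x in (-L)..L, cut L x ^ 2 * S.dissipation ε x s)
        + 4 * E / c * (η * C₁) * (∫ x in (-L)..L, cut L x ^ 2 * S.sqrtDissipation x s)
        + 4 * E / c * (η * C₁ + N + 1) * 1 := by
    intro s hs
    have hs' : s ∈ Icc 0 T := ⟨hs.1, hs.2.trans ht.2⟩
    set J := ∫ x in (-L)..L, cut L x ^ 2 * S.sqrtDissipation x s with hJ
    have hJ0 : 0 ≤ J := integral_nonneg_of_cont (by linarith) fun x _ =>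
      mul_nonneg (sq_nonneg _) (S.sqrtDissipation_nonneg x s)
    set kk := 4 * (η * (C₁ * (1 + J)) + N + 1) / c with hkk
    have hkk0 : 0 ≤ kk := by positivity
    have hcE : Continuous fun x => S.energy ent x s :=
      S.continuous_energy (fun z hz => hasDerivAt_ent hz) continuous_id continuous_const
    have h4 := integral_le_lin2 (f := fun x => cut L x ^ 2 * S.compression ε x s)
      (g₁ := fun x => cut L x ^ 2 * S.dissipation ε x s) (g₂ := fun x => S.energy ent x s)
      (a := -L) (b := L) (1 / 4) kk (by linarith) (by fun_prop) (by fun_prop) hcE fun x hx => by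
        have hi := S.iv_pos x s
        have hic : S.iv x s ≤ 1 / c := by rw [one_div]; exact inv_anti₀ hc (hv x s hs')
        have hθ := S.θ_pos x s
        have hm := S.one_le_mu hα x s
        have q0 := S.θp_pos ε x s
        have r0 := S.θp_pos (-ε) x s
        have qr : S.θp ε x s * S.θp (-ε) x s = 1 := by rw [← θp_add, add_neg_cancel, θp_zero]
        have hsup := hE.cut_temperature_le hE0 hL hx hs'
        rw [← hJ] at hsup
        have he := ent_nonneg hθ
        obtain ⟨e1, e2, e3, e4, e5⟩ := S.le_energy x s
        have hh := sq_rpow_sub_one_mul_le hε hε1.le hθ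
        have hl := hlin _ hθ
        change (S.θp (1 - ε) x s - 1) ^ 2 * S.θp ε x s ≤ 4 * (S.θp (1 - ε) x s + 1) * _ at hh
        change S.θp (1 - ε) x s ≤ _ at hl
        have c1 : cut L x ^ 2 ≤ 1 := by
          simpa using cut_sq_mul_le hL hx (zero_le_one (α := ℝ))
        have c0 := sq_nonneg (cut L x)
        have y1 : (S.θp (1 - ε) x s - 1) * S.ux x s
            ≤ 1 / 4 * (S.θp (-ε) x s * S.ux x s ^ 2)
              + (S.θp (1 - ε) x s - 1) ^ 2 * S.θp ε x s := by
          have := mul_nonneg q0.le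
            (sq_nonneg (1 / 2 * S.θp (-ε) x s * S.ux x s - (S.θp (1 - ε) x s - 1)))
          have e : S.θp ε x s * (1 / 2 * S.θp (-ε) x s * S.ux x s - (S.θp (1 - ε) x s - 1)) ^ 2
            = 1 / 4 * (S.θp (-ε) x s * S.ux x s ^ 2)
              + (S.θp (1 - ε) x s - 1) ^ 2 * S.θp ε x s
              - (S.θp (1 - ε) x s - 1) * S.ux x s := by
            linear_combination (1 / 4 * S.θp (-ε) x s * S.ux x s ^ 2
              - S.ux x s * (S.θp (1 - ε) x s - 1)) * qr
          linarith
        have y2 : 1 / 4 * (S.θp (-ε) x s * S.ux x s ^ 2) * S.iv x s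
            ≤ 1 / 4 * S.dissipation ε x s := by
          have p1 := S.θp_pos (β - 1 - ε) x s
          have p2 : 0 ≤ (S.mu x s - 1) * S.ux x s ^ 2 :=
            mul_nonneg (by linarith) (sq_nonneg _)
          have p3 : 0 ≤ ε * S.θp (β - 1 - ε) x s * S.θx x s ^ 2 * S.iv x s
            + S.θp (-ε) x s * ((S.mu x s - 1) * S.ux x s ^ 2
              + (S.wx 0 x s ^ 2 + S.wx 1 x s ^ 2)
              + (S.bx 0 x s ^ 2 + S.bx 1 x s ^ 2)) * S.iv x s := by positivity
          unfold dissipation heating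
          linarith
        have y3 : cut L x ^ 2 * (4 * (S.θp (1 - ε) x s + 1) * ent (S.θ x s))
            ≤ 4 * (η * (C₁ * (1 + J)) + N + 1) * ent (S.θ x s) := by
          have z1 : cut L x ^ 2 * (S.θp (1 - ε) x s + 1) ≤ η * (C₁ * (1 + J)) + N + 1 := by
            have z2 := mul_le_mul_of_nonneg_left hl c0
            have z3 := mul_le_mul_of_nonneg_left hsup hη
            have z4 := mul_le_mul_of_nonneg_right c1 (by linarith : 0 ≤ N + 1)
            linarith
          have := mul_le_mul_of_nonneg_right z1 he
          linarith
        have y4 : 4 * (η * (C₁ * (1 + J)) + N + 1) * ent (S.θ x s) * S.iv x s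
            ≤ kk * S.energy ent x s := by
          calc _ ≤ 4 * (η * (C₁ * (1 + J)) + N + 1) * ent (S.θ x s) * (1 / c) := by gcongr
            _ = kk * ent (S.θ x s) := by rw [hkk]; ring
            _ ≤ _ := by
              refine mul_le_mul_of_nonneg_left ?_ hkk0
              linarith
        have y5 := mul_le_mul_of_nonneg_right
          (mul_le_mul_of_nonneg_left (y1.trans (add_le_add_right hh _)) c0) hi.le
        have y6 := mul_le_mul_of_nonneg_left y2 c0
        have y7 := mul_le_mul_of_nonneg_right y3 hi.le
        unfold compression
        linarith
    have h5 := mul_le_mul_of_nonneg_left (hE.energy_le s hs' (-L) L (by linarith)) hkk0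
    have h6 : kk * E = 4 * E / c * (η * C₁) * J + 4 * E / c * (η * C₁ + N + 1) * 1 := by
      rw [hkk]; field_simp; ring
    linarith
  have h6 := integral_le_lin3 (f := fun s => ∫ x in (-L)..L, cut L x ^ 2 * S.compression ε x s)
    (g₁ := fun s => ∫ x in (-L)..L, cut L x ^ 2 * S.dissipation ε x s)
    (g₂ := fun s => ∫ x in (-L)..L, cut L x ^ 2 * S.sqrtDissipation x s) (g₃ := fun _ => 1)
    _ _ _ ht.1
    (continuous_slice_integral (f := fun x s => cut L x ^ 2 * S.compression ε x s)
      (by fun_prop) _ _)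
    (continuous_slice_integral (f := fun x s => cut L x ^ 2 * S.dissipation ε x s)
      (by fun_prop) _ _)
    (continuous_slice_integral (f := fun x s => cut L x ^ 2 * S.sqrtDissipation x s)
      (by fun_prop) _ _) continuous_const key
  have h7 : 4 * E / c * (η * C₁ + N + 1) * ∫ s in (0:ℝ)..t, (1:ℝ)
      ≤ 4 * E / c * (η * C₁ + N + 1) * T := by
    refine mul_le_mul_of_nonneg_left ?_ (by positivity)
    simp only [intervalIntegral.integral_const, smul_eq_mul, sub_zero, mul_one]
    exact ht.2
  linarith

end MHDFlow

/-! ### Upper bound on the volume and the basic dissipation estimates -/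

namespace MHDFlow

variable {α β T : ℝ} {S : MHDFlow α β T}

theorem exists_cut_sqrtDissipation_le (α β T K δ E c : ℝ) (hα : 0 ≤ α) (hβ : 0 < β) (hT : 0 < T)
    (hδ : 0 < δ) (hE0 : 0 < E) (hc : 0 < c) :
    ∃ C > 0, ∀ S : MHDFlow α β T, S.Init K δ → S.EntropyBound E →
      (∀ x, ∀ t ∈ Icc 0 T, c ≤ S.v x t) → (∀ x, ∀ t ∈ Icc 0 T, c ≤ S.θ x t) →
      ∀ᶠ L in atTop, 1 ≤ L ∧ ∀ t ∈ Icc 0 T,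
        ∫ s in (0:ℝ)..t, ∫ x in (-L)..L, cut L x ^ 2 * S.sqrtDissipation x s ≤ C := by
  set ε := min β (1 / 2) with hε
  have hε0 : 0 < ε := lt_min hβ (by norm_num)
  have hεβ : ε ≤ β := min_le_left _ _
  have hε1 : ε < 1 := (min_le_right _ _).trans_lt (by norm_num)
  set C₁ := 2 * (3 * E + 5) ^ 2 + (E + 1) with hC₁
  have hC₁0 : 0 < C₁ := by positivity
  have hcp : 0 < c ^ (β - ε) := Real.rpow_pos_of_pos hc _
  set κ := ε * c ^ (β - ε) with hκ
  have hκ0 : 0 < κ := by positivity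
  set η := κ * c / (32 * E * C₁) with hη
  have hη0 : 0 < η := by positivity
  obtain ⟨N, hN, hlin⟩ := exists_rpow_le_linear hε0 hε1.le hη0
  set A := (2 + K ^ 2 + 1 / δ) * K ^ 2 + 1 + 4 * E / c * (η * C₁ + N + 1) * T with hA
  have hA0 : 0 < A := by positivity
  refine ⟨8 * A / κ, by positivity, fun S hI hE hv hθ => ?_⟩
  filter_upwards [hE.energy_inequality hE0 hα hT hI hδ hc hv hε0.le hε1 hη0.le hN hlin]
    with L ⟨hL, h⟩
  refine ⟨hL, fun t ht => ?_⟩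
  have h1 := h t ht
  rw [← hC₁, ← hA] at h1
  set X := ∫ s in (0:ℝ)..t, ∫ x in (-L)..L, cut L x ^ 2 * S.sqrtDissipation x s with hX
  have h2 : κ * X ≤ ∫ s in (0:ℝ)..t, ∫ x in (-L)..L, cut L x ^ 2 * S.dissipation ε x s := by
    rw [hX, ← intervalIntegral.integral_const_mul]
    refine integral_le_of_cont ht.1 ((continuous_slice_integral
      (f := fun x s => cut L x ^ 2 * S.sqrtDissipation x s) (by fun_prop) _ _).const_mul κ)
      (continuous_slice_integral (f := fun x s => cut L x ^ 2 * S.dissipation ε x s)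
        (by fun_prop) _ _) fun s hs => ?_
    rw [← intervalIntegral.integral_const_mul]
    refine integral_le_of_cont (by linarith) (by fun_prop) (by fun_prop) fun x _ => ?_
    have e1 : κ * S.sqrtDissipation x s ≤ S.dissipation ε x s := by
      have q1 : c ^ (β - ε) ≤ S.θp (β - ε) x s :=
        Real.rpow_le_rpow hc.le (hθ x s ⟨hs.1, hs.2.trans ht.2⟩) (by linarith)
      have q2 := mul_le_mul_of_nonneg_left q1 hε0.le
      have q3 := mul_le_mul_of_nonneg_right q2 (S.sqrtDissipation_nonneg x s)
      have q4 : S.θp (β - 1 - ε) x s = S.θp (β - ε) x s * S.θp (-1) x s := by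
        rw [← θp_add]; ring_nf
      have q5 := S.heating_nonneg hα x s
      have q6 := S.θp_pos (-ε) x s
      have q7 := S.iv_pos x s
      have q8 : 0 ≤ S.θp (-ε) x s * S.heating x s * S.iv x s := by positivity
      unfold dissipation
      unfold sqrtDissipation at q3 ⊢
      rw [q4]
      linarith
    have := mul_le_mul_of_nonneg_left e1 (sq_nonneg (cut L x))
    linarith
  have h3 : 4 * E / c * (η * C₁) = κ / 8 := by
    rw [hη]; field_simp; ring
  rw [h3] at h1
  rw [le_div_iff₀ hκ0]
  linarith

/-- The temperature is controlled by the dissipation on an interval of length at least one. -/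
theorem EntropyBound.temperature_le {E : ℝ} (hE : S.EntropyBound E) (hE0 : 0 < E) {a b x t : ℝ}
    (hab : a + 1 ≤ b) (hx : x ∈ Icc a b) (ht : t ∈ Icc 0 T) :
    S.θ x t ≤ (2 * (3 * E + 5) ^ 2 + (E + 1)) * (1 + ∫ y in a..b, S.sqrtDissipation y t) := by
  obtain ⟨d, hd, hxd, hdb⟩ : ∃ d, a ≤ d ∧ x ∈ Icc d (d + 1) ∧ d + 1 ≤ b := by
    rcases le_total x (b - 1) with h | h
    · exact ⟨x, hx.1, ⟨le_rfl, by linarith⟩, by linarith⟩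
    · exact ⟨b - 1, by linarith, ⟨h, by linarith [hx.2]⟩, by linarith⟩
  have h1 := hE.weighted_temperature_le hE0 (k := fun _ => 1) (kd := fun _ => 0)
    (fun x => hasDerivAt_const x 1) continuous_const ht hxd (fun _ _ => zero_le_one)
    (fun _ _ => le_rfl) (fun _ _ => by simp)
  simp only [one_pow, one_mul] at h1
  refine h1.trans (mul_le_mul_of_nonneg_left (add_le_add_right ?_ 1) (by positivity))
  exact integral_subinterval_le hd (by linarith) hdb (by fun_prop) fun y _ =>
    S.sqrtDissipation_nonneg y t

theorem EntropyBound.field_le {E : ℝ} (hE : S.EntropyBound E) (hE0 : 0 < E) (hα : 0 ≤ α) {c : ℝ}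
    (hc : 0 < c) (hv : ∀ x, ∀ t ∈ Icc 0 T, c ≤ S.v x t) (x : ℝ) {t : ℝ} (ht : t ∈ Icc 0 T) :
    S.b 0 x t ^ 2 + S.b 1 x t ^ 2 ≤ 2 / c * E
      + (2 * (3 * E + 5) ^ 2 + (E + 1)) * (1 + ∫ y in x..(x + 1), S.sqrtDissipation y t) * (2 * E)
      + ∫ y in x..(x + 1), S.dissipation 1 y t := by
  have hm := le_integral_unit (f := fun y => S.b 0 y t ^ 2 + S.b 1 y t ^ 2) (x := x) (a := x)
    ⟨le_rfl, by linarith⟩ (fun y => ((S.hasDeriv_b 0 y t).fun_pow 2).fun_add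
      ((S.hasDeriv_b 1 y t).fun_pow 2)) (by fun_prop)
  have h1 : ∫ y in x..(x + 1), (S.b 0 y t ^ 2 + S.b 1 y t ^ 2) ≤ 2 / c * E + 0 := by
    refine hE.integral_le (by positivity) ht (by fun_prop) fun y => ?_
    obtain ⟨e1, e2, e3, e4, e5⟩ := S.le_energy y t
    have e6 := mul_le_mul_of_nonneg_right (hv y t ht)
      (by positivity : 0 ≤ S.b 0 y t ^ 2 + S.b 1 y t ^ 2)
    have e7 : c * (S.b 0 y t ^ 2 + S.b 1 y t ^ 2) ≤ 2 * S.energy ent y t := by linarith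
    rw [add_zero, div_mul_eq_mul_div, le_div_iff₀ hc]
    linarith
  have h2 : ∫ y in x..(x + 1), S.v y t * (S.b 0 y t ^ 2 + S.b 1 y t ^ 2) ≤ 2 * E + 0 := by
    refine hE.integral_le zero_le_two ht (by fun_prop) fun y => ?_
    obtain ⟨e1, e2, e3, e4, e5⟩ := S.le_energy y t
    linarith
  set Θ := (2 * (3 * E + 5) ^ 2 + (E + 1))
    * (1 + ∫ y in x..(x + 1), S.sqrtDissipation y t) with hΘ
  have hJ0 : 0 ≤ ∫ y in x..(x + 1), S.sqrtDissipation y t :=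
    integral_nonneg_of_cont (by linarith) fun y _ => S.sqrtDissipation_nonneg y t
  have hΘ0 : 0 ≤ Θ := by positivity
  have h3 := integral_le_lin2
    (f := fun y => |((2:ℕ):ℝ) * S.b 0 y t ^ (2 - 1) * S.bx 0 y t
      + ((2:ℕ):ℝ) * S.b 1 y t ^ (2 - 1) * S.bx 1 y t|)
    (g₁ := fun y => S.v y t * (S.b 0 y t ^ 2 + S.b 1 y t ^ 2))
    (g₂ := fun y => S.dissipation 1 y t) (a := x) (b := x + 1) Θ 1 (by linarith) (by fun_prop)
    (by fun_prop) (by fun_prop) fun y hy => by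
      have hθ := S.θ_pos y t
      have hvp := S.v_pos y t
      have hip := S.iv_pos y t
      have e0 : S.θ y t ≤ Θ := hE.temperature_le hE0 le_rfl hy ht
      have r0 := S.θp_pos (-1) y t
      have e1 : S.θ y t * S.θp (-1) y t = 1 := by
        rw [← S.θp_one, ← θp_add, add_neg_cancel, θp_zero]
      have e2 := S.v_mul_iv y t
      have e3 : ∀ i, |2 * S.b i y t * S.bx i y t|
          ≤ S.v y t * S.θ y t * S.b i y t ^ 2 + S.θp (-1) y t * S.bx i y t ^ 2 * S.iv y t := by
        intro i
        have hr : 0 < S.θp (-1) y t * S.iv y t := by positivity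
        have k1 : ∀ σ : ℝ, σ ^ 2 = 1 → σ * (2 * S.b i y t * S.bx i y t)
          ≤ S.v y t * S.θ y t * S.b i y t ^ 2 + S.θp (-1) y t * S.bx i y t ^ 2 * S.iv y t := by
          intro σ hσ
          have k2 := mul_nonneg hr.le
            (sq_nonneg (S.v y t * S.θ y t * S.b i y t - σ * S.bx i y t))
          have k3 : S.θp (-1) y t * S.iv y t
            * (S.v y t * S.θ y t * S.b i y t - σ * S.bx i y t) ^ 2
            = S.v y t * S.θ y t * S.b i y t ^ 2 - σ * (2 * S.b i y t * S.bx i y t)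
              + S.θp (-1) y t * S.bx i y t ^ 2 * S.iv y t := by
            have k4 : S.θp (-1) y t * S.iv y t * (S.v y t * S.θ y t) = 1 := by
              linear_combination S.v y t * S.iv y t * e1 + e2
            linear_combination (S.v y t * S.θ y t * S.b i y t ^ 2
              - 2 * σ * S.b i y t * S.bx i y t) * k4
              + S.θp (-1) y t * S.iv y t * S.bx i y t ^ 2 * hσ
          linarith
        rw [abs_le]
        have := k1 1 (by norm_num)
        have := k1 (-1) (by norm_num)
        constructor <;> linarith
      have e4 : S.θp (-1) y t * S.bx 0 y t ^ 2 * S.iv y t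
          + S.θp (-1) y t * S.bx 1 y t ^ 2 * S.iv y t ≤ S.dissipation 1 y t := by
        have hm := zero_le_one.trans (S.one_le_mu hα y t)
        have p1 := S.θp_pos (β - 1 - 1) y t
        have : 0 ≤ 1 * S.θp (β - 1 - 1) y t * S.θx y t ^ 2 * S.iv y t
          + S.θp (-1) y t * (S.mu y t * S.ux y t ^ 2
            + (S.wx 0 y t ^ 2 + S.wx 1 y t ^ 2)) * S.iv y t := by positivity
        unfold dissipation heating
        linarith
      have e5 := mul_le_mul_of_nonneg_right e0
        (by positivity : 0 ≤ S.v y t * (S.b 0 y t ^ 2 + S.b 1 y t ^ 2))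
      have e6 := abs_add_le (2 * S.b 0 y t * S.bx 0 y t) (2 * S.b 1 y t * S.bx 1 y t)
      have := e3 0
      have := e3 1
      norm_num
      linarith
  have h4 := mul_le_mul_of_nonneg_left h2 hΘ0
  linarith

theorem exists_volume_le (α β T E c C₀ J : ℝ) (hα : 0 ≤ α) (hT : 0 < T) (hE0 : 0 < E)
    (hc : 0 < c) (hC₀ : 0 < C₀) (hJ : 0 < J) :
    ∃ C > 0, ∀ S : MHDFlow α β T, S.EntropyBound E → (∀ x, ∀ t ∈ Icc 0 T, c ≤ S.v x t) →
      (∀ t ∈ Icc 0 T, ∀ a b, a ≤ b →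
        ∫ s in (0:ℝ)..t, ∫ x in a..b, S.sqrtDissipation x s ≤ J) →
      (∀ x, ∀ t ∈ Icc 0 T, S.v x t ≤ C₀ * (1 + ∫ s in (0:ℝ)..t,
        (S.θ x s + 1 / 2 * (S.v x s * (S.b 0 x s ^ 2 + S.b 1 x s ^ 2))))) →
      ∀ x, ∀ t ∈ Icc 0 T, S.v x t ≤ C := by
  set C₁ := 2 * (3 * E + 5) ^ 2 + (E + 1) with hC₁
  have hC₁0 : 0 < C₁ := by positivity
  set P := C₁ * (T + J) with hP
  set Q := (2 / c * E + C₁ * (2 * E)) * T + C₁ * (2 * E) * J + E with hQ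
  have hQ0 : 0 < Q := by positivity
  have hP0 : 0 < P := by positivity
  refine ⟨C₀ * (1 + P) * Real.exp (C₀ / 2 * Q), by positivity, fun S hE hv hD hup x => ?_⟩
  have hJc : Continuous fun s => ∫ y in x..(x + 1), S.sqrtDissipation y s :=
    continuous_slice_integral (f := fun y s => S.sqrtDissipation y s) (by fun_prop) _ _
  have hDc : Continuous fun s => ∫ y in x..(x + 1), S.dissipation 1 y s :=
    continuous_slice_integral (f := fun y s => S.dissipation 1 y s) (by fun_prop) _ _
  have one_int : ∀ t : ℝ, ∫ s in (0:ℝ)..t, (1:ℝ) = t := fun t => by simp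
  have hθint : ∀ t ∈ Icc 0 T, ∫ s in (0:ℝ)..t, S.θ x s ≤ P := by
    intro t ht
    have h1 := integral_le_lin2 (f := fun s => S.θ x s) (g₁ := fun _ => 1)
      (g₂ := fun s => ∫ y in x..(x + 1), S.sqrtDissipation y s) C₁ C₁ ht.1 (by fun_prop)
      continuous_const hJc fun s hs => by
        have := hE.temperature_le hE0 le_rfl (x := x) (a := x) ⟨le_rfl, by linarith⟩
          ⟨hs.1, hs.2.trans ht.2⟩
        linarith
    rw [one_int] at h1
    have h2 := mul_le_mul_of_nonneg_left (hD t ht x (x + 1) (by linarith)) hC₁0.le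
    have h3 := mul_le_mul_of_nonneg_left ht.2 hC₁0.le
    linarith
  have hbint : ∀ t ∈ Icc 0 T, ∫ s in (0:ℝ)..t, (S.b 0 x s ^ 2 + S.b 1 x s ^ 2) ≤ Q := by
    intro t ht
    have h1 := integral_le_lin3 (f := fun s => S.b 0 x s ^ 2 + S.b 1 x s ^ 2) (g₁ := fun _ => 1)
      (g₂ := fun s => ∫ y in x..(x + 1), S.sqrtDissipation y s)
      (g₃ := fun s => ∫ y in x..(x + 1), S.dissipation 1 y s)
      (2 / c * E + C₁ * (2 * E)) (C₁ * (2 * E)) 1 ht.1 (by fun_prop)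
      continuous_const hJc hDc fun s hs => by
        have := hE.field_le hE0 hα hc hv x (t := s) ⟨hs.1, hs.2.trans ht.2⟩
        linarith
    rw [one_int] at h1
    have h2 := mul_le_mul_of_nonneg_left (hD t ht x (x + 1) (by linarith))
      (by positivity : 0 ≤ C₁ * (2 * E))
    have h3 := mul_le_mul_of_nonneg_left ht.2 (by positivity : 0 ≤ 2 / c * E + C₁ * (2 * E))
    have h4 := hE.dissipation_le t ht x (x + 1) (by linarith)
    linarith
  have hgr : ∀ t ∈ Icc 0 T, S.v x t ≤ C₀ * (1 + P) + ∫ s in (0:ℝ)..t,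
      C₀ / 2 * (S.b 0 x s ^ 2 + S.b 1 x s ^ 2) * S.v x s := by
    intro t ht
    refine (hup x t ht).trans ?_
    rw [integral_add_cont _ _ (by fun_prop) (by fun_prop)]
    have h1 : ∫ s in (0:ℝ)..t, C₀ / 2 * (S.b 0 x s ^ 2 + S.b 1 x s ^ 2) * S.v x s
        = C₀ * ∫ s in (0:ℝ)..t, 1 / 2 * (S.v x s * (S.b 0 x s ^ 2 + S.b 1 x s ^ 2)) := by
      rw [← intervalIntegral.integral_const_mul]
      exact intervalIntegral.integral_congr fun s _ => by ring
    rw [h1]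
    have := mul_le_mul_of_nonneg_left (hθint t ht) hC₀.le
    linarith
  intro t ht
  refine (gronwall_integral (A := fun s => C₀ / 2 * (S.b 0 x s ^ 2 + S.b 1 x s ^ 2))
    (by fun_prop) (by fun_prop) (fun s _ => by positivity) hgr t ht).trans ?_
  refine mul_le_mul_of_nonneg_left (Real.exp_le_exp.2 ?_) (by positivity)
  rw [intervalIntegral.integral_const_mul]
  exact mul_le_mul_of_nonneg_left (hbint t ht) (by positivity)

/-- The consequences of the basic energy estimates. -/
structure BasicBound (S : MHDFlow α β T) (M : ℝ) : Prop where
  one_le : 1 ≤ M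
  entropy : S.EntropyBound M
  init_le : ∀ a b, a ≤ b → ∫ x in a..b, S.initDensity x ≤ M
  v_le : ∀ x, ∀ t ∈ Icc 0 T, S.v x t ≤ M
  iv_le : ∀ x, ∀ t ∈ Icc 0 T, S.iv x t ≤ M
  mu_le : ∀ x, ∀ t ∈ Icc 0 T, S.mu x t ≤ M
  dmu_le : ∀ x, ∀ t ∈ Icc 0 T, |S.dmu x t| ≤ M
  θ_ge : ∀ x, ∀ t ∈ Icc 0 T, 1 / M ≤ S.θ x t
  sqrtDissipation_le : ∀ t ∈ Icc 0 T, ∀ a b, a ≤ b →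
    ∫ s in (0:ℝ)..t, ∫ x in a..b, S.sqrtDissipation x s ≤ M
  heating_le : ∀ t ∈ Icc 0 T, ∀ a b, a ≤ b →
    ∫ s in (0:ℝ)..t, ∫ x in a..b, S.heating x s ≤ M

theorem exists_basicBound (α β T K δ : ℝ) (hα : 0 ≤ α) (hβ : 0 < β) (hT : 0 < T)
    (hδ : 0 < δ) (hδ1 : δ ≤ 1) :
    ∃ M, 1 ≤ M ∧ ∀ S : MHDFlow α β T, S.Init K δ → S.BasicBound M := by
  obtain ⟨E, hE0, hE⟩ := exists_entropyBound α β T K δ hα hT hδ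
  obtain ⟨c₁, hc₁, C₀, hC₀, hvol⟩ := exists_volume_bounds α β T K δ E hα hδ hE0
  set c₂ := 1 / (1 / δ + 1 / (4 * c₁) * T) with hc₂
  have hc₂0 : 0 < c₂ := by positivity
  set c := min c₁ c₂ with hc
  have hc0 : 0 < c := lt_min hc₁ hc₂0
  obtain ⟨J, hJ0, hJ⟩ := exists_cut_sqrtDissipation_le α β T K δ E c hα hβ hT hδ hE0 hc0
  obtain ⟨V, hV0, hV⟩ := exists_volume_le α β T E c C₀ (2 * J) hα hT hE0 hc0 hC₀ (by positivity)
  set C₁ := 2 * (3 * E + 5) ^ 2 + (E + 1) with hC₁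
  have hC₁0 : 0 < C₁ := by positivity
  set A := (2 + K ^ 2 + 1 / δ) * K ^ 2 + 1 + 4 * E / c * (1 * C₁ + 0 + 1) * T
    + 4 * E / c * (1 * C₁) * J with hA
  have hA0 : 0 < A := by positivity
  have hca : 0 < c ^ (-α) := Real.rpow_pos_of_pos hc0 _
  have hca' : 0 < c ^ (-α - 1) := Real.rpow_pos_of_pos hc0 _
  set M := 1 + E + K ^ 2 + V + 1 / c + α * c ^ (-α) + α * α * c ^ (-α - 1) + 2 * J
    + 8 * A * V with hM
  have p1 : 0 ≤ α * c ^ (-α) := by positivity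
  have p2 : 0 ≤ α * α * c ^ (-α - 1) := by positivity
  have p3 : 0 < 1 / c := by positivity
  have p4 : 0 < 8 * A * V := by positivity
  have p5 := sq_nonneg K
  have hM1 : 1 ≤ M := by linarith
  refine ⟨M, hM1, fun S hI => ?_⟩
  have hES := hE S hI
  have hvS := hvol S hI hES
  have hθS := temperature_lower_bound hα hT hδ hδ1 hc₁ hI fun x t ht => (hvS x t ht).1
  have hv : ∀ x, ∀ t ∈ Icc 0 T, c ≤ S.v x t := fun x t ht =>
    (min_le_left _ _).trans (hvS x t ht).1
  have hθ : ∀ x, ∀ t ∈ Icc 0 T, c ≤ S.θ x t := fun x t ht =>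
    (min_le_right _ _).trans (hθS x t ht)
  have hJS := hJ S hI hES hv hθ
  have hJ' : ∀ t ∈ Icc 0 T, ∀ a b, a ≤ b →
      ∫ s in (0:ℝ)..t, ∫ x in a..b, S.sqrtDissipation x s ≤ 2 * J := fun t ht a b hab =>
    integral2_le_of_cut ht.1 (by fun_prop) S.sqrtDissipation_nonneg
      (hJS.mono fun L hL => hL.2 t ht) hab
  have hVS := hV S hES hv hJ' fun x t ht => (hvS x t ht).2
  refine ⟨hM1, ⟨fun t ht a b hab => (hES.energy_le t ht a b hab).trans (by linarith),
    fun t ht a b hab => (hES.dissipation_le t ht a b hab).trans (by linarith)⟩,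
    fun a b hab => (hI.int_le a b hab).trans (by linarith),
    fun x t ht => (hVS x t ht).trans (by linarith), fun x t ht => ?_, fun x t ht => ?_,
    fun x t ht => ?_, fun x t ht => ?_,
    fun t ht a b hab => (hJ' t ht a b hab).trans (by linarith), ?_⟩
  · have : S.iv x t ≤ 1 / c := by rw [one_div]; exact inv_anti₀ hc0 (hv x t ht)
    linarith
  · have := mul_le_mul_of_nonneg_left
      (Real.rpow_le_rpow_of_nonpos hc0 (hv x t ht) (neg_nonpos.2 hα)) hα
    unfold mu visc
    linarith
  · have := mul_le_mul_of_nonneg_left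
      (Real.rpow_le_rpow_of_nonpos hc0 (hv x t ht) (by linarith : -α - 1 ≤ 0))
      (by positivity : 0 ≤ α * α)
    have h2 := Real.rpow_pos_of_pos (S.v_pos x t) (-α - 1)
    have h3 : |S.dmu x t| = α * α * S.v x t ^ (-α - 1) := by
      have : S.dmu x t = -(α * α * S.v x t ^ (-α - 1)) := by unfold dmu dvisc; ring
      rw [this, abs_neg, abs_of_nonneg (by positivity)]
    linarith
  · refine le_trans ?_ (hθ x t ht)
    rw [div_le_iff₀ (by linarith)]
    have : c * (1 / c) = 1 := by field_simp
    nlinarith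
  · intro t ht a b hab
    have h1 : ∀ᶠ L in atTop, ∫ s in (0:ℝ)..t, ∫ x in (-L)..L,
        cut L x ^ 2 * S.dissipation 0 x s ≤ 4 * A := by
      filter_upwards [hES.energy_inequality hE0 hα hT hI hδ hc0 hv le_rfl zero_lt_one
        (zero_le_one (α := ℝ)) le_rfl (fun z hz => by simp), hJS] with L ⟨hL, h⟩ ⟨_, hJL⟩
      have e1 := h t ht
      have e2 := mul_le_mul_of_nonneg_left (hJL t ht)
        (by positivity : 0 ≤ 4 * E / c * (1 * C₁))
      linarith
    have h2 := integral2_le_of_cut ht.1 (by fun_prop)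
      (S.dissipation_nonneg hα (le_refl (0:ℝ))) h1 hab
    have h3 : ∫ s in (0:ℝ)..t, ∫ x in a..b, S.heating x s
        ≤ ∫ s in (0:ℝ)..t, V * ∫ x in a..b, S.dissipation 0 x s := by
      refine integral_le_of_cont ht.1
        (continuous_slice_integral (f := fun x s => S.heating x s) (by fun_prop) _ _)
        ((continuous_slice_integral (f := fun x s => S.dissipation 0 x s)
          (by fun_prop) _ _).const_mul V) fun s hs => ?_
      rw [← intervalIntegral.integral_const_mul]
      refine integral_le_of_cont hab (by fun_prop) (by fun_prop) fun x _ => ?_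
      have e1 := S.heating_nonneg hα x s
      have e2 := S.v_mul_iv x s
      have e3 := mul_le_mul_of_nonneg_right (hVS x s ⟨hs.1, hs.2.trans ht.2⟩)
        (mul_nonneg e1 (S.iv_pos x s).le)
      have e4 : S.dissipation 0 x s = S.heating x s * S.iv x s := by
        simp [dissipation, θp_zero]
      rw [e4]
      linear_combination e3 - S.heating x s * e2
    rw [intervalIntegral.integral_const_mul] at h3
    have h4 := mul_le_mul_of_nonneg_left h2 hV0.le
    linarith

end MHDFlow

/-! ### The first derivative of the specific volume -/

namespace MHDFlow

variable {α β T : ℝ} {S : MHDFlow α β T} {M : ℝ}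

theorem BasicBound.integral_u_sq_le (hB : S.BasicBound M) {a b t : ℝ} (hab : a ≤ b)
    (ht : t ∈ Icc 0 T) : ∫ x in a..b, S.u x t ^ 2 ≤ 2 * M := by
  have h1 := hB.entropy.energy_le t ht a b hab
  have h2 : ∫ x in a..b, S.u x t ^ 2 ≤ ∫ x in a..b, 2 * S.energy ent x t := by
    refine integral_le_of_cont hab (by fun_prop) ((S.continuous_energy
      (fun z hz => hasDerivAt_ent hz) continuous_id continuous_const).const_mul 2) fun x _ => ?_
    obtain ⟨e1, e2, e3, e4, e5⟩ := S.le_energy x t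
    linarith
  rw [intervalIntegral.integral_const_mul] at h2
  linarith

theorem BasicBound.integral_b_sq_le (hB : S.BasicBound M) {a b t : ℝ} (hab : a ≤ b)
    (ht : t ∈ Icc 0 T) : ∫ x in a..b, (S.b 0 x t ^ 2 + S.b 1 x t ^ 2) ≤ 2 * M ^ 2 := by
  have hM := hB.one_le
  have h1 := hB.entropy.energy_le t ht a b hab
  have h2 : ∫ x in a..b, (S.b 0 x t ^ 2 + S.b 1 x t ^ 2)
      ≤ ∫ x in a..b, 2 * M * S.energy ent x t := by
    refine integral_le_of_cont hab (by fun_prop) ((S.continuous_energy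
      (fun z hz => hasDerivAt_ent hz) continuous_id continuous_const).const_mul _) fun x _ => ?_
    obtain ⟨e1, e2, e3, e4, e5⟩ := S.le_energy x t
    have e6 : S.v x t * (S.b 0 x t ^ 2 + S.b 1 x t ^ 2) ≤ 2 * S.energy ent x t := by linarith
    have e7 := mul_le_mul (hB.iv_le x t ht) e6 e2 (by linarith)
    have e8 := S.v_mul_iv x t
    linear_combination e7 - (S.b 0 x t ^ 2 + S.b 1 x t ^ 2) * e8
  rw [intervalIntegral.integral_const_mul] at h2
  nlinarith

theorem exists_unit_subinterval {a b x : ℝ} (hab : a + 1 ≤ b) (hx : x ∈ Icc a b) :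
    ∃ d, a ≤ d ∧ x ∈ Icc d (d + 1) ∧ d + 1 ≤ b := by
  rcases le_total x (b - 1) with h | h
  · exact ⟨x, hx.1, ⟨le_rfl, by linarith⟩, by linarith⟩
  · exact ⟨b - 1, by linarith, ⟨h, by linarith [hx.2]⟩, by linarith⟩

theorem BasicBound.field_le (hB : S.BasicBound M) (hα : 0 ≤ α) {a b x t : ℝ} (hab : a + 1 ≤ b)
    (hx : x ∈ Icc a b) (ht : t ∈ Icc 0 T) :
    S.b 0 x t ^ 2 + S.b 1 x t ^ 2 ≤ 4 * M ^ 2 + ∫ y in a..b, S.heating y t := by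
  obtain ⟨d, hd, hxd, hdb⟩ := exists_unit_subinterval hab hx
  have hm := le_integral_unit (f := fun y => S.b 0 y t ^ 2 + S.b 1 y t ^ 2) hxd
    (fun y => ((S.hasDeriv_b 0 y t).fun_pow 2).fun_add ((S.hasDeriv_b 1 y t).fun_pow 2))
    (by fun_prop)
  refine hm.trans ?_
  have h1 := hB.integral_b_sq_le (by linarith : d ≤ d + 1) ht
  have h2 := integral_subinterval_le (f := fun y => S.heating y t) hd (by linarith : d ≤ d + 1) hdb
    (by fun_prop) fun y _ => S.heating_nonneg hα y t
  have h3 := integral_le_lin2 1 1 (by linarith : d ≤ d + 1) (f := fun y =>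
    |((2:ℕ):ℝ) * S.b 0 y t ^ (2 - 1) * S.bx 0 y t + ((2:ℕ):ℝ) * S.b 1 y t ^ (2 - 1) * S.bx 1 y t|)
    (g₁ := fun y => S.b 0 y t ^ 2 + S.b 1 y t ^ 2) (g₂ := fun y => S.heating y t)
    (by fun_prop) (by fun_prop) (by fun_prop) fun y _ => by
      have hmu := S.one_le_mu hα y t
      have : 0 ≤ (S.mu y t * S.ux y t ^ 2) := by positivity
      have e0 := sq_nonneg (S.wx 0 y t)
      have e1 := sq_nonneg (S.wx 1 y t)
      unfold heating
      rw [abs_le]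
      push_cast
      constructor
      · nlinarith [sq_nonneg (S.b 0 y t + S.bx 0 y t), sq_nonneg (S.b 1 y t + S.bx 1 y t)]
      · nlinarith [sq_nonneg (S.b 0 y t - S.bx 0 y t), sq_nonneg (S.b 1 y t - S.bx 1 y t)]
  linarith

/-- The effective velocity `μ(v) v_x / v - u`. -/
def effVel (S : MHDFlow α β T) (x t : ℝ) : ℝ := S.mu x t * S.iv x t * S.vx x t - S.u x t

@[fun_prop] theorem continuous_effVel {X : Type*} [TopologicalSpace X] {f g : X → ℝ}
    (hf : Continuous f) (hg : Continuous g) :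
    Continuous fun x => S.effVel (f x) (g x) := by
  unfold effVel; fun_prop

/-- The spatial derivative of the total pressure. -/
def pressx (S : MHDFlow α β T) (x t : ℝ) : ℝ :=
  S.θx x t * S.iv x t - S.θ x t * S.vx x t * S.iv x t ^ 2
    + (S.b 0 x t * S.bx 0 x t + S.b 1 x t * S.bx 1 x t)

@[fun_prop] theorem continuous_pressx {X : Type*} [TopologicalSpace X] {f g : X → ℝ}
    (hf : Continuous f) (hg : Continuous g) :
    Continuous fun x => S.pressx (f x) (g x) := by
  unfold pressx; fun_prop

theorem hasTDeriv_effVel (S : MHDFlow α β T) (x : ℝ) {t : ℝ} (ht : t ∈ Ioo 0 T) :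
    HasDerivAt (fun s => S.effVel x s) (S.pressx x t) t := by
  have hv := S.hasTDeriv_v x t ht
  have h1 : HasDerivAt (fun s => S.mu x s) (S.dmu x t * S.ux x t) t :=
    (hasDerivAt_visc α (S.v_pos x t)).comp t hv
  have h2 : HasDerivAt (fun s => S.iv x s) (-S.ux x t / S.v x t ^ 2) t :=
    hv.fun_inv (S.v_pos x t).ne'
  refine (((h1.fun_mul h2).fun_mul (S.hasTDeriv_vx x ht)).fun_sub
    (S.hasTDeriv_u x t ht)).congr_deriv ?_
  have e : -S.ux x t / S.v x t ^ 2 = -(S.ux x t * S.iv x t ^ 2) := by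
    unfold iv; rw [inv_pow, neg_div]; rfl
  rw [S.ut_eq, e]; unfold pressx; ring

theorem BasicBound.effVel_rate_le (hB : S.BasicBound M) (hα : 0 ≤ α) (x : ℝ) {t : ℝ}
    (ht : t ∈ Icc 0 T) :
    2 * S.effVel x t * S.pressx x t ≤ M * S.sqrtDissipation x t + M * (S.θ x t * S.u x t ^ 2)
      + S.heating x t + (S.b 0 x t ^ 2 + S.b 1 x t ^ 2) * S.effVel x t ^ 2 := by
  have hmu := S.one_le_mu hα x t
  have hmu' := hB.mu_le x t ht
  have hiv := S.iv_pos x t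
  have hiv' := hB.iv_le x t ht
  have hθ := S.θ_pos x t
  have hM := hB.one_le
  have hmu0 : 0 < S.mu x t := by linarith
  obtain ⟨P, hP⟩ : ∃ P, P = S.θ x t * S.iv x t / S.mu x t := ⟨_, rfl⟩
  have hP0 : 0 < P := by rw [hP]; positivity
  have hPmu : P * S.mu x t = S.θ x t * S.iv x t := by rw [hP]; field_simp
  have hPle : P ≤ S.θ x t * M := by
    rw [hP, div_le_iff₀ hmu0]
    have := mul_le_mul_of_nonneg_left hiv' hθ.le
    have := mul_le_mul_of_nonneg_left hmu (by positivity : 0 ≤ S.θ x t * M)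
    linarith
  obtain ⟨z, hz⟩ : ∃ z, z = S.effVel x t := ⟨_, rfl⟩
  have e1 : S.θ x t * S.vx x t * S.iv x t ^ 2 = P * (z + S.u x t) := by
    rw [hz]; unfold effVel
    linear_combination (-(S.iv x t * S.vx x t)) * hPmu
  have hsd : S.sqrtDissipation x t * S.θ x t = S.θx x t ^ 2 * S.iv x t := by
    have : S.θp (-1) x t * S.θ x t = 1 := by
      unfold θp; rw [Real.rpow_neg_one, inv_mul_cancel₀ hθ.ne']
    unfold sqrtDissipation
    linear_combination (S.θx x t ^ 2 * S.iv x t) * this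
  have e2 : 2 * (z * (S.θx x t * S.iv x t)) ≤ P * z ^ 2 + S.mu x t * S.sqrtDissipation x t := by
    have key : 0 ≤ P * (P * z ^ 2 + S.mu x t * S.sqrtDissipation x t
        - 2 * (z * (S.θx x t * S.iv x t))) := by
      have := sq_nonneg (P * z - S.θx x t * S.iv x t)
      have e : P * (S.mu x t * S.sqrtDissipation x t) = S.θx x t ^ 2 * S.iv x t ^ 2 := by
        linear_combination S.sqrtDissipation x t * hPmu + S.iv x t * hsd
      linear_combination this - e
    linarith [nonneg_of_mul_nonneg_right key hP0]
  have e3 : -(2 * (P * (z * S.u x t))) ≤ P * z ^ 2 + P * S.u x t ^ 2 := by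
    have := mul_nonneg hP0.le (sq_nonneg (z + S.u x t))
    linear_combination this
  have e4 : 2 * (z * (S.b 0 x t * S.bx 0 x t + S.b 1 x t * S.bx 1 x t))
      ≤ (S.b 0 x t ^ 2 + S.b 1 x t ^ 2) * z ^ 2 + (S.bx 0 x t ^ 2 + S.bx 1 x t ^ 2) := by
    have := sq_nonneg (z * S.b 0 x t - S.bx 0 x t)
    have := sq_nonneg (z * S.b 1 x t - S.bx 1 x t)
    linarith
  have e5 : S.bx 0 x t ^ 2 + S.bx 1 x t ^ 2 ≤ S.heating x t := by
    unfold heating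
    have : 0 ≤ S.mu x t * S.ux x t ^ 2 := by positivity
    have := sq_nonneg (S.wx 0 x t)
    have := sq_nonneg (S.wx 1 x t)
    linarith
  have e6 := mul_le_mul_of_nonneg_right hPle (sq_nonneg (S.u x t))
  have e7 := mul_le_mul_of_nonneg_right hmu' (S.sqrtDissipation_nonneg x t)
  rw [← hz]
  unfold pressx
  rw [e1]
  linarith

theorem BasicBound.vx_sq_le (hB : S.BasicBound M) (hα : 0 ≤ α) (x : ℝ) {t : ℝ}
    (ht : t ∈ Icc 0 T) : S.vx x t ^ 2 ≤ 2 * M ^ 2 * (S.effVel x t ^ 2 + S.u x t ^ 2) := by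
  have hmu := S.one_le_mu hα x t
  have hv := S.v_pos x t
  have e : S.mu x t * S.vx x t = S.v x t * (S.effVel x t + S.u x t) := by
    unfold effVel
    linear_combination (-(S.mu x t * S.vx x t)) * S.v_mul_iv x t
  have h1 : S.vx x t ^ 2 ≤ (S.mu x t * S.vx x t) ^ 2 := by
    rw [mul_pow]
    exact le_mul_of_one_le_left (sq_nonneg _) (one_le_pow₀ hmu)
  have h2 : S.v x t ^ 2 ≤ M ^ 2 := pow_le_pow_left₀ hv.le (hB.v_le x t ht) 2
  rw [e, mul_pow] at h1
  have h3 : (S.effVel x t + S.u x t) ^ 2 ≤ 2 * (S.effVel x t ^ 2 + S.u x t ^ 2) := by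
    linarith [sq_nonneg (S.effVel x t - S.u x t)]
  have := mul_le_mul h2 h3 (sq_nonneg _) (sq_nonneg M)
  linarith

theorem BasicBound.effVel_sq_zero_le (hB : S.BasicBound M) (hα : 0 ≤ α) (hT : 0 < T) (x : ℝ) :
    S.effVel x 0 ^ 2 ≤ 2 * M ^ 4 * S.initDensity x := by
  have h0 : (0:ℝ) ∈ Icc 0 T := ⟨le_rfl, hT.le⟩
  have hmu := S.one_le_mu hα x 0
  have hM := hB.one_le
  have h1 : (S.mu x 0 * S.iv x 0) ^ 2 ≤ (M * M) ^ 2 := by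
    have := S.iv_pos x 0
    exact pow_le_pow_left₀ (by positivity) (mul_le_mul (hB.mu_le x 0 h0) (hB.iv_le x 0 h0)
      this.le (by linarith)) 2
  have h2 : S.effVel x 0 ^ 2
      ≤ 2 * ((S.mu x 0 * S.iv x 0) ^ 2 * S.vx x 0 ^ 2) + 2 * S.u x 0 ^ 2 := by
    unfold effVel
    linarith [sq_nonneg (S.mu x 0 * S.iv x 0 * S.vx x 0 + S.u x 0)]
  have h3 := mul_le_mul_of_nonneg_right h1 (sq_nonneg (S.vx x 0))
  have h4 : S.vx x 0 ^ 2 + S.u x 0 ^ 2 ≤ S.initDensity x := by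
    unfold initDensity
    linarith [sq_nonneg (S.v x 0 - 1), sq_nonneg (S.θ x 0 - 1), sq_nonneg (S.b 0 x 0),
      sq_nonneg (S.b 1 x 0), sq_nonneg (S.w 0 x 0), sq_nonneg (S.w 1 x 0), sq_nonneg (S.ux x 0),
      sq_nonneg (S.θx x 0), sq_nonneg (S.bx 0 x 0), sq_nonneg (S.bx 1 x 0),
      sq_nonneg (S.wx 0 x 0), sq_nonneg (S.wx 1 x 0)]
  have h5 : 1 ≤ M ^ 4 := one_le_pow₀ hM
  have h6 := mul_le_mul_of_nonneg_left h4 (by linarith : 0 ≤ M ^ 4)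
  have h7 := mul_le_mul_of_nonneg_right h5 (sq_nonneg (S.u x 0))
  linarith

theorem exists_integral_vx_sq_le (α β T M : ℝ) (hα : 0 ≤ α) (hT : 0 < T) (hM : 1 ≤ M) :
    ∃ C, 0 < C ∧ ∀ S : MHDFlow α β T, S.BasicBound M → ∀ t ∈ Icc 0 T, ∀ a b, a ≤ b →
      ∫ x in a..b, S.vx x t ^ 2 ≤ C := by
  set D := 2 * (3 * M + 5) ^ 2 + (M + 1) with hD
  have hD0 : 0 < D := by positivity
  set c₀ := 2 * M ^ 4 * M + (M * M + 2 * M ^ 2 * D * (T + M) + M) with hc₀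
  have hc₀0 : 0 < c₀ := by positivity
  set Q := c₀ * Real.exp (4 * M ^ 2 * T + M) with hQ
  have hQ0 : 0 < Q := by positivity
  refine ⟨2 * M ^ 2 * (Q + 2 * M), by positivity, fun S hB t ht a b hab => ?_⟩
  have hab' : a + 1 ≤ b + 1 := by linarith
  have hab1 : a ≤ b + 1 := by linarith
  have cJ : Continuous fun s => ∫ x in a..(b + 1), S.sqrtDissipation x s :=
    continuous_slice_integral (f := fun x s => S.sqrtDissipation x s) (by fun_prop) _ _
  have cH : Continuous fun s => ∫ x in a..(b + 1), S.heating x s :=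
    continuous_slice_integral (f := fun x s => S.heating x s) (by fun_prop) _ _
  have cz : Continuous fun s => ∫ x in a..(b + 1), S.effVel x s ^ 2 :=
    continuous_slice_integral (f := fun x s => S.effVel x s ^ 2) (by fun_prop) _ _
  have hJ0 : ∀ s, 0 ≤ ∫ x in a..(b + 1), S.sqrtDissipation x s := fun s =>
    intervalIntegral.integral_nonneg hab1 fun x _ => S.sqrtDissipation_nonneg x s
  have hH0 : ∀ s, 0 ≤ ∫ x in a..(b + 1), S.heating x s := fun s =>
    intervalIntegral.integral_nonneg hab1 fun x _ => S.heating_nonneg hα x s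
  have hz0 : ∫ x in a..(b + 1), S.effVel x 0 ^ 2 ≤ 2 * M ^ 4 * M := by
    have h1 : ∫ x in a..(b + 1), S.effVel x 0 ^ 2
        ≤ ∫ x in a..(b + 1), 2 * M ^ 4 * S.initDensity x :=
      integral_le_of_cont hab1 (by fun_prop) (by fun_prop) fun x _ =>
        hB.effVel_sq_zero_le hα hT x
    rw [intervalIntegral.integral_const_mul] at h1
    exact h1.trans (mul_le_mul_of_nonneg_left (hB.init_le a _ hab1) (by positivity))
  have hrate : ∀ s ∈ Icc 0 T, ∫ x in a..(b + 1), 2 * S.effVel x s * S.pressx x s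
      ≤ M * (∫ x in a..(b + 1), S.sqrtDissipation x s)
        + M * (D * (1 + ∫ x in a..(b + 1), S.sqrtDissipation x s) * (2 * M))
        + (∫ x in a..(b + 1), S.heating x s)
        + (4 * M ^ 2 + ∫ x in a..(b + 1), S.heating x s)
          * ∫ x in a..(b + 1), S.effVel x s ^ 2 := by
    intro s hs
    set J := ∫ x in a..(b + 1), S.sqrtDissipation x s with hJ
    set H := ∫ x in a..(b + 1), S.heating x s with hH
    have hJn : 0 ≤ J := hJ0 s
    have h1 := integral_le_lin4 (f := fun x => 2 * S.effVel x s * S.pressx x s)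
      (g₁ := fun x => S.sqrtDissipation x s) (g₂ := fun x => S.u x s ^ 2)
      (g₃ := fun x => S.heating x s) (g₄ := fun x => S.effVel x s ^ 2)
      M (M * (D * (1 + J))) 1 (4 * M ^ 2 + H) hab1 (by fun_prop) (by fun_prop) (by fun_prop)
      (by fun_prop) (by fun_prop) fun x hx => by
        have e1 := hB.effVel_rate_le hα x hs
        have e2 := mul_le_mul_of_nonneg_right (hB.field_le hα hab' hx hs)
          (sq_nonneg (S.effVel x s))
        have e3 := mul_le_mul_of_nonneg_left (mul_le_mul_of_nonneg_right
          (hB.entropy.temperature_le (by linarith) hab' hx hs) (sq_nonneg (S.u x s)))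
          (by linarith : 0 ≤ M)
        linarith
    have h2 := mul_le_mul_of_nonneg_left (hB.integral_u_sq_le hab1 hs)
      (by positivity : 0 ≤ M * (D * (1 + J)))
    linarith
  have hgr : ∀ r ∈ Icc 0 T, ∫ x in a..(b + 1), S.effVel x r ^ 2
      ≤ c₀ + ∫ s in (0:ℝ)..r, (4 * M ^ 2 + ∫ x in a..(b + 1), S.heating x s)
          * ∫ x in a..(b + 1), S.effVel x s ^ 2 := by
    intro r hr
    have h1 := weighted_evolution (φ := fun _ => 1) (F := fun x s => S.effVel x s ^ 2)
      (Ft := fun x s => 2 * S.effVel x s * S.pressx x s) continuous_const (by fun_prop)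
      (by fun_prop) (fun x s hs => ((S.hasTDeriv_effVel x hs).fun_pow 2).congr_deriv
        (by push_cast; ring)) a (b + 1) hr
    simp only [one_mul] at h1
    rw [h1]
    have h2 := integral_le_lin4
      (f := fun s => ∫ x in a..(b + 1), 2 * S.effVel x s * S.pressx x s)
      (g₁ := fun s => ∫ x in a..(b + 1), S.sqrtDissipation x s) (g₂ := fun _ => 1)
      (g₃ := fun s => ∫ x in a..(b + 1), S.heating x s)
      (g₄ := fun s => (4 * M ^ 2 + ∫ x in a..(b + 1), S.heating x s)
          * ∫ x in a..(b + 1), S.effVel x s ^ 2)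
      (M + 2 * M ^ 2 * D) (2 * M ^ 2 * D) 1 1 hr.1
      (continuous_slice_integral (f := fun x s => 2 * S.effVel x s * S.pressx x s)
        (by fun_prop) _ _) cJ continuous_const cH ((cH.const_add _).mul cz) fun s hs => by
          have := hrate s ⟨hs.1, hs.2.trans hr.2⟩
          linarith
    have h3 : ∫ s in (0:ℝ)..r, (1:ℝ) = r := by simp
    rw [h3] at h2
    have h4 := mul_le_mul_of_nonneg_left (hB.sqrtDissipation_le r hr a (b + 1) hab1)
      (by positivity : 0 ≤ M + 2 * M ^ 2 * D)
    have h5 := mul_le_mul_of_nonneg_left hr.2 (by positivity : 0 ≤ 2 * M ^ 2 * D)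
    have h6 := hB.heating_le r hr a (b + 1) hab1
    linarith
  have hz := gronwall_integral cz (cH.const_add (4 * M ^ 2))
    (fun s _ => by have := hH0 s; positivity) hgr t ht
  have hA : ∫ s in (0:ℝ)..t, (4 * M ^ 2 + ∫ x in a..(b + 1), S.heating x s)
      ≤ 4 * M ^ 2 * T + M := by
    rw [integral_add_cont _ _ continuous_const cH, intervalIntegral.integral_const]
    have h6 := hB.heating_le t ht a (b + 1) hab1
    have h5 := mul_le_mul_of_nonneg_left ht.2 (by positivity : 0 ≤ 4 * M ^ 2)
    rw [smul_eq_mul, sub_zero]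
    linarith
  have hzQ : ∫ x in a..(b + 1), S.effVel x t ^ 2 ≤ Q :=
    hz.trans (mul_le_mul_of_nonneg_left (Real.exp_le_exp.2 hA) hc₀0.le)
  have hfin := integral_le_lin2 (f := fun x => S.vx x t ^ 2)
    (g₁ := fun x => S.effVel x t ^ 2) (g₂ := fun x => S.u x t ^ 2) (2 * M ^ 2) (2 * M ^ 2) hab1
    (by fun_prop) (by fun_prop) (by fun_prop) fun x _ => by
      have := hB.vx_sq_le hα x ht
      linarith
  have h7 := mul_le_mul_of_nonneg_left hzQ (by positivity : 0 ≤ 2 * M ^ 2)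
  have h8 := mul_le_mul_of_nonneg_left (hB.integral_u_sq_le hab1 ht)
    (by positivity : 0 ≤ 2 * M ^ 2)
  have h9 := integral_subinterval_le (f := fun x => S.vx x t ^ 2) (le_refl a) hab
    (by linarith : b ≤ b + 1) (by fun_prop) fun x _ => sq_nonneg _
  linarith

end MHDFlow

/-! ### First order estimates for parabolic equations with a rough drift -/

theorem neg_mul_le_young {N : ℝ} (hN : 0 < N) (x y : ℝ) :
    -(x * y) ≤ 1 / N * (x ^ 2 / 4) + N * y ^ 2 := by
  have h := mul_nonneg (by positivity : 0 ≤ 1 / N) (sq_nonneg (x / 2 + N * y))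
  have e : 1 / N * N = 1 := by field_simp
  linear_combination h + (x * y + N * y ^ 2) * e

theorem parabolic_pointwise_le {N c d p r q Y F g : ℝ} (hN : 1 ≤ N) (hp : 1 / N ≤ p) (hpN : p ≤ N)
    (hr : |r| ≤ N) (hd : |d| ≤ 2) :
    -2 * (2 * c * d * Y + c ^ 2 * F) * (p * F + r * q * Y + g)
      ≤ -(5 / 4 * (1 / N)) * (c ^ 2 * F ^ 2) + 8 * N ^ 3 * (q ^ 2 * (c * Y) ^ 2) + 72 * N ^ 3 * Y ^ 2
        + 8 * N * (c ^ 2 * g ^ 2) := by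
  have hN0 : 0 < N := by linarith
  have hp0 : 0 < p := lt_of_lt_of_le (by positivity) hp
  obtain ⟨X, hX⟩ : ∃ X, X = c * F := ⟨_, rfl⟩
  obtain ⟨W, hW⟩ : ∃ W, W = q * (c * Y) := ⟨_, rfl⟩
  obtain ⟨G, hG⟩ : ∃ G, G = c * g := ⟨_, rfl⟩
  have e1 := mul_le_mul_of_nonneg_right hp (sq_nonneg X)
  have e2 := neg_mul_le_young hN0 X (2 * r * W)
  have e3 := neg_mul_le_young hN0 X (2 * G)
  have e4 := neg_mul_le_young hN0 X (4 * d * Y * p)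
  have hr2 : r ^ 2 ≤ N ^ 2 := sq_le_sq' (by linarith [abs_le.1 hr]) (abs_le.1 hr).2
  have hd2 : d ^ 2 ≤ 2 ^ 2 := sq_le_sq' (abs_le.1 hd).1 (abs_le.1 hd).2
  have hp2 : p ^ 2 ≤ N ^ 2 := pow_le_pow_left₀ hp0.le hpN 2
  have e5 : N * (2 * r * W) ^ 2 ≤ 4 * N ^ 3 * W ^ 2 := by
    have := mul_le_mul_of_nonneg_left hr2 (by positivity : 0 ≤ 4 * N * W ^ 2)
    linear_combination this
  have e6 : N * (4 * d * Y * p) ^ 2 ≤ 64 * N ^ 3 * Y ^ 2 := by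
    have := mul_le_mul_of_nonneg_left (mul_le_mul hd2 hp2 (sq_nonneg _) (by norm_num))
      (by positivity : 0 ≤ 16 * N * Y ^ 2)
    linear_combination this
  have e7 : -(4 * d * Y * (r * W)) ≤ 4 * N * (Y ^ 2 + W ^ 2) := by
    have h1 : |d * r| ≤ 2 * N := by
      rw [abs_mul]; exact mul_le_mul hd hr (abs_nonneg _) (by norm_num)
    have h2 : |Y * W| ≤ (Y ^ 2 + W ^ 2) / 2 := by
      rw [abs_le]
      constructor <;> linarith [sq_nonneg (Y + W), sq_nonneg (Y - W)]
    have h3 := mul_le_mul h1 h2 (abs_nonneg _) (by positivity)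
    rw [← abs_mul] at h3
    have h4 := neg_le_abs (d * r * (Y * W))
    linarith
  have e8 : -(4 * d * Y * G) ≤ 4 * (Y ^ 2 + G ^ 2) := by
    have h2 : |Y * G| ≤ (Y ^ 2 + G ^ 2) / 2 := by
      rw [abs_le]
      constructor <;> linarith [sq_nonneg (Y + G), sq_nonneg (Y - G)]
    have h3 := mul_le_mul hd h2 (abs_nonneg _) (by positivity)
    rw [← abs_mul] at h3
    have h4 := neg_le_abs (d * (Y * G))
    linarith
  have hN3 : N ≤ N ^ 3 := le_self_pow₀ hN (by norm_num)
  have e9 := mul_le_mul_of_nonneg_right hN3 (sq_nonneg W)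
  have e10 := mul_le_mul_of_nonneg_right (by linarith : 4 * N + 4 ≤ 8 * N ^ 3) (sq_nonneg Y)
  have e11 := mul_le_mul_of_nonneg_right (by linarith : 4 * N + 4 ≤ 8 * N) (sq_nonneg G)
  have l1 : -2 * (2 * c * d * Y + c ^ 2 * F) * (p * F + r * q * Y + g)
      = -2 * (p * X ^ 2) + -(X * (2 * r * W)) + -(X * (2 * G)) + -(X * (4 * d * Y * p))
        + -(4 * d * Y * (r * W)) + -(4 * d * Y * G) := by
    rw [hX, hW, hG]; ring
  have l2 : -(5 / 4 * (1 / N)) * (c ^ 2 * F ^ 2) + 8 * N ^ 3 * (q ^ 2 * (c * Y) ^ 2)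
      + 72 * N ^ 3 * Y ^ 2 + 8 * N * (c ^ 2 * g ^ 2)
      = -(5 / 4 * (1 / N)) * X ^ 2 + 8 * N ^ 3 * W ^ 2 + 72 * N ^ 3 * Y ^ 2 + 8 * N * G ^ 2 := by
    rw [hX, hW, hG]; ring
  rw [l1, l2]
  linarith

/-- The constant in the first order parabolic estimate. -/
def parabolicConst (N : ℝ) : ℝ := 8 * N ^ 4 * (5 + 32 * N ^ 5) + 72 * N ^ 3

theorem parabolicConst_pos {N : ℝ} (hN : 0 < N) : 0 < parabolicConst N := by
  unfold parabolicConst; positivity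

theorem parabolic_rate_le {N L : ℝ} {fx fxx p r q g : ℝ → ℝ} (hN : 1 ≤ N) (hL : 1 ≤ L)
    (hd : ∀ x, HasDerivAt fx (fxx x) x) (hfxx : Continuous fxx) (hp : Continuous p)
    (hr : Continuous r) (hq : Continuous q) (hg : Continuous g) (hpN : ∀ x, 1 / N ≤ p x ∧ p x ≤ N)
    (hrN : ∀ x, |r x| ≤ N) (hqN : ∫ x in (-L)..L, q x ^ 2 ≤ N) :
    ∫ x in (-L)..L, -2 * (2 * cut L x * cutd L x * fx x + cut L x ^ 2 * fxx x)
        * (p x * fxx x + r x * q x * fx x + g x)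
      ≤ -(1 / N) * (∫ x in (-L)..L, cut L x ^ 2 * fxx x ^ 2)
        + parabolicConst N * (∫ x in (-L)..L, fx x ^ 2)
        + parabolicConst N * ∫ x in (-L)..L, cut L x ^ 2 * g x ^ 2 := by
  have hN0 : 0 < N := by linarith
  have hLL : -L ≤ L := by linarith
  have hfx : Continuous fx := continuous_iff_continuousAt.2 fun x => (hd x).continuousAt
  have h1 := integral_le_lin4
    (f := fun x => -2 * (2 * cut L x * cutd L x * fx x + cut L x ^ 2 * fxx x)
        * (p x * fxx x + r x * q x * fx x + g x))
    (g₁ := fun x => cut L x ^ 2 * fxx x ^ 2) (g₂ := fun x => q x ^ 2 * (cut L x * fx x) ^ 2)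
    (g₃ := fun x => fx x ^ 2) (g₄ := fun x => cut L x ^ 2 * g x ^ 2)
    (-(5 / 4 * (1 / N))) (8 * N ^ 3) (72 * N ^ 3) (8 * N) hLL (by fun_prop) (by fun_prop)
    (by fun_prop) (by fun_prop) (by fun_prop) fun x hx =>
      parabolic_pointwise_le hN (hpN x).1 (hpN x).2 (hrN x)
        ((abs_cutd_le hL hx).trans (by rw [div_le_iff₀ (by linarith)]; linarith))
  set D := ∫ x in (-L)..L, cut L x ^ 2 * fxx x ^ 2
  set U := ∫ x in (-L)..L, fx x ^ 2
  set G := ∫ x in (-L)..L, cut L x ^ 2 * g x ^ 2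
  have hU0 : 0 ≤ U := intervalIntegral.integral_nonneg hLL fun x _ => sq_nonneg _
  have hD0 : 0 ≤ D := intervalIntegral.integral_nonneg hLL fun x _ => by positivity
  have hG0 : 0 ≤ G := intervalIntegral.integral_nonneg hLL fun x _ => by positivity
  have hcU : ∫ x in (-L)..L, cut L x ^ 2 * fx x ^ 2 ≤ U :=
    integral_le_of_cont hLL (by fun_prop) (by fun_prop) fun x hx =>
      cut_sq_mul_le hL hx (sq_nonneg _)
  set B := (5 + 32 * N ^ 5) * U + 1 / (32 * N ^ 5) * D with hB
  have hsup : ∀ x ∈ Icc (-L) L, (cut L x * fx x) ^ 2 ≤ B := by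
    intro x hx
    have h2 := cut_sobolev hL (by positivity : 0 < 1 / (32 * N ^ 5)) hx hd hfxx
    have h3 : 1 / (1 / (32 * N ^ 5)) = 32 * N ^ 5 := by rw [one_div_one_div]
    rw [h3] at h2
    have h4 := mul_le_mul_of_nonneg_left hcU (by positivity : 0 ≤ 1 + 32 * N ^ 5)
    have h5 : 4 / L * U ≤ 4 * U := mul_le_mul_of_nonneg_right
      (by rw [div_le_iff₀ (by linarith)]; linarith) hU0
    linarith
  have h6 : ∫ x in (-L)..L, q x ^ 2 * (cut L x * fx x) ^ 2 ≤ N * B := by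
    have h7 : ∫ x in (-L)..L, q x ^ 2 * (cut L x * fx x) ^ 2 ≤ ∫ x in (-L)..L, q x ^ 2 * B :=
      integral_le_of_cont hLL (by fun_prop) (by fun_prop) fun x hx =>
        mul_le_mul_of_nonneg_left (hsup x hx) (sq_nonneg _)
    rw [intervalIntegral.integral_mul_const] at h7
    exact h7.trans (mul_le_mul_of_nonneg_right hqN (by positivity))
  have h8 := mul_le_mul_of_nonneg_left h6 (by positivity : 0 ≤ 8 * N ^ 3)
  have h9 : 8 * N ^ 3 * (N * (1 / (32 * N ^ 5) * D)) = 1 / 4 * (1 / N) * D := by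
    field_simp; ring
  have h10 : 8 * N * G ≤ parabolicConst N * G := by
    refine mul_le_mul_of_nonneg_right ?_ hG0
    have : N ≤ N ^ 3 := le_self_pow₀ hN (by norm_num)
    have : 0 < 8 * N ^ 4 * (5 + 32 * N ^ 5) := by positivity
    unfold parabolicConst; linarith
  unfold parabolicConst at h10 ⊢
  rw [hB] at h8
  linear_combination h1 + h8 + h10 + h9

/-- First order energy estimate for `f_t = p f_xx + r q f_x + g` with `q` bounded in `L²`. -/
theorem parabolic_estimate {N L T : ℝ} {f fx fxx ft p r q g : ℝ → ℝ → ℝ} (hN : 1 ≤ N) (hL : 1 ≤ L)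
    (hf : Continuous fun z : ℝ × ℝ => f z.1 z.2) (hfx : Continuous fun z : ℝ × ℝ => fx z.1 z.2)
    (hfxx : Continuous fun z : ℝ × ℝ => fxx z.1 z.2)
    (hft : Continuous fun z : ℝ × ℝ => ft z.1 z.2)
    (hp : Continuous fun z : ℝ × ℝ => p z.1 z.2) (hr : Continuous fun z : ℝ × ℝ => r z.1 z.2)
    (hq : Continuous fun z : ℝ × ℝ => q z.1 z.2) (hg : Continuous fun z : ℝ × ℝ => g z.1 z.2)
    (hdx : ∀ x t, HasDerivAt (fun y => f y t) (fx x t) x)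
    (hdxx : ∀ x t, HasDerivAt (fun y => fx y t) (fxx x t) x)
    (hdt : ∀ x, ∀ t ∈ Ioo 0 T, HasDerivAt (fun s => f x s) (ft x t) t)
    (heq : ∀ x t, ft x t = p x t * fxx x t + r x t * q x t * fx x t + g x t)
    (hpN : ∀ x, ∀ t ∈ Icc 0 T, 1 / N ≤ p x t ∧ p x t ≤ N)
    (hrN : ∀ x, ∀ t ∈ Icc 0 T, |r x t| ≤ N)
    (hqN : ∀ t ∈ Icc 0 T, ∫ x in (-L)..L, q x t ^ 2 ≤ N) {t : ℝ} (ht : t ∈ Icc 0 T) :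
    (∫ x in (-L)..L, cut L x ^ 2 * fx x t ^ 2)
        + 1 / N * (∫ s in (0:ℝ)..t, ∫ x in (-L)..L, cut L x ^ 2 * fxx x s ^ 2)
      ≤ (∫ x in (-L)..L, fx x 0 ^ 2)
        + parabolicConst N * (∫ s in (0:ℝ)..t, ∫ x in (-L)..L, fx x s ^ 2)
        + parabolicConst N * ∫ s in (0:ℝ)..t, ∫ x in (-L)..L, cut L x ^ 2 * g x s ^ 2 := by
  rw [cut_deriv_sq_evolution hL hf hfx hfxx hft hdx hdxx hdt ht]
  have h0 : ∫ x in (-L)..L, cut L x ^ 2 * fx x 0 ^ 2 ≤ ∫ x in (-L)..L, fx x 0 ^ 2 :=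
    integral_le_of_cont (by linarith) (by fun_prop) (by fun_prop) fun x hx =>
      cut_sq_mul_le hL hx (sq_nonneg _)
  have h1 := integral_le_lin3
    (f := fun s => ∫ x in (-L)..L, -2 * (2 * cut L x * cutd L x * fx x s
      + cut L x ^ 2 * fxx x s) * ft x s)
    (g₁ := fun s => ∫ x in (-L)..L, cut L x ^ 2 * fxx x s ^ 2)
    (g₂ := fun s => ∫ x in (-L)..L, fx x s ^ 2)
    (g₃ := fun s => ∫ x in (-L)..L, cut L x ^ 2 * g x s ^ 2)
    (-(1 / N)) (parabolicConst N) (parabolicConst N) ht.1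
    (continuous_slice_integral (f := fun x s => -2 * (2 * cut L x * cutd L x * fx x s
      + cut L x ^ 2 * fxx x s) * ft x s) (by fun_prop) _ _)
    (continuous_slice_integral (f := fun x s => cut L x ^ 2 * fxx x s ^ 2) (by fun_prop) _ _)
    (continuous_slice_integral (f := fun x s => fx x s ^ 2) (by fun_prop) _ _)
    (continuous_slice_integral (f := fun x s => cut L x ^ 2 * g x s ^ 2) (by fun_prop) _ _)
    fun s hs => by
      have hsT : s ∈ Icc 0 T := ⟨hs.1, hs.2.trans ht.2⟩
      have h2 := parabolic_rate_le hN hL (fun x => hdxx x s) (p := fun x => p x s)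
        (r := fun x => r x s) (q := fun x => q x s) (g := fun x => g x s) (by fun_prop)
        (by fun_prop) (by fun_prop) (by fun_prop) (by fun_prop) (fun x => hpN x s hsT)
        (fun x => hrN x s hsT) (hqN s hsT)
      refine le_trans (le_of_eq ?_) h2
      exact intervalIntegral.integral_congr fun x _ => by rw [heq]
  linarith

namespace MHDFlow

variable {α β T : ℝ} {S : MHDFlow α β T} {M V : ℝ}

theorem BasicBound.one_div_le_iv (hB : S.BasicBound M) (x : ℝ) {t : ℝ} (ht : t ∈ Icc 0 T) :
    1 / M ≤ S.iv x t := by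
  unfold iv
  rw [one_div]
  exact inv_anti₀ (S.v_pos x t) (hB.v_le x t ht)

theorem sq_le_heating (S : MHDFlow α β T) (hα : 0 ≤ α) (i : Fin 2) (x t : ℝ) :
    S.ux x t ^ 2 + S.wx i x t ^ 2 + S.bx i x t ^ 2 ≤ S.heating x t := by
  have h1 := mul_le_mul_of_nonneg_right (S.one_le_mu hα x t) (sq_nonneg (S.ux x t))
  have h2 := sq_nonneg (S.wx 0 x t)
  have h3 := sq_nonneg (S.wx 1 x t)
  have h4 := sq_nonneg (S.bx 0 x t)
  have h5 := sq_nonneg (S.bx 1 x t)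
  unfold heating
  fin_cases i <;> simp <;> linarith

theorem sq_le_initDensity (S : MHDFlow α β T) (i : Fin 2) (x : ℝ) :
    (S.θ x 0 - 1) ^ 2 + S.ux x 0 ^ 2 + S.wx i x 0 ^ 2 + S.bx i x 0 ^ 2 ≤ S.initDensity x := by
  unfold initDensity
  fin_cases i <;> simp <;> linarith [sq_nonneg (S.v x 0 - 1), sq_nonneg (S.u x 0),
    sq_nonneg (S.b 0 x 0), sq_nonneg (S.b 1 x 0), sq_nonneg (S.w 0 x 0), sq_nonneg (S.w 1 x 0),
    sq_nonneg (S.θx x 0), sq_nonneg (S.vx x 0), sq_nonneg (S.bx 0 x 0), sq_nonneg (S.bx 1 x 0),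
    sq_nonneg (S.wx 0 x 0), sq_nonneg (S.wx 1 x 0)]

theorem BasicBound.b_equation_coeff (hB : S.BasicBound M) (hV : 0 ≤ V) (x : ℝ) {t : ℝ}
    (ht : t ∈ Icc 0 T) :
    (1 / (2 * M ^ 3 + V) ≤ S.iv x t ^ 2 ∧ S.iv x t ^ 2 ≤ 2 * M ^ 3 + V)
      ∧ |-S.iv x t ^ 3| ≤ 2 * M ^ 3 + V := by
  have hM := hB.one_le
  have hi := S.iv_pos x t
  have h1 := hB.iv_le x t ht
  have h2 := hB.one_div_le_iv x ht
  have h3 : M ^ 2 ≤ M ^ 3 := pow_le_pow_right₀ hM (by norm_num)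
  have h4 : (0:ℝ) < M ^ 2 := by positivity
  refine ⟨⟨?_, ?_⟩, ?_⟩
  · refine le_trans ?_ (pow_le_pow_left₀ (by positivity) h2 2)
    rw [one_div_pow]
    exact one_div_le_one_div_of_le h4 (by linarith)
  · linarith [pow_le_pow_left₀ hi.le h1 2]
  · rw [abs_neg, abs_of_pos (by positivity)]
    linarith [pow_le_pow_left₀ hi.le h1 3]

theorem BasicBound.w_equation_coeff (hB : S.BasicBound M) (hV : 0 ≤ V) (x : ℝ) {t : ℝ}
    (ht : t ∈ Icc 0 T) :
    (1 / (2 * M ^ 3 + V) ≤ S.iv x t ∧ S.iv x t ≤ 2 * M ^ 3 + V)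
      ∧ |-S.iv x t ^ 2| ≤ 2 * M ^ 3 + V := by
  have hM := hB.one_le
  have hi := S.iv_pos x t
  have h1 := hB.iv_le x t ht
  have h2 := hB.one_div_le_iv x ht
  have h3 : M ^ 2 ≤ M ^ 3 := pow_le_pow_right₀ hM (by norm_num)
  have h4 : M ≤ M ^ 3 := le_self_pow₀ hM (by norm_num)
  refine ⟨⟨?_, by linarith⟩, ?_⟩
  · exact le_trans (one_div_le_one_div_of_le (by linarith) (by linarith)) h2
  · rw [abs_neg, abs_of_pos (by positivity)]
    linarith [pow_le_pow_left₀ hi.le h1 2]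

theorem BasicBound.u_equation_coeff (hB : S.BasicBound M) (hα : 0 ≤ α) (hV : 0 ≤ V) (x : ℝ)
    {t : ℝ} (ht : t ∈ Icc 0 T) :
    (1 / (2 * M ^ 3 + V) ≤ S.mu x t * S.iv x t ∧ S.mu x t * S.iv x t ≤ 2 * M ^ 3 + V)
      ∧ |S.dmu x t * S.iv x t - S.mu x t * S.iv x t ^ 2| ≤ 2 * M ^ 3 + V := by
  have hM := hB.one_le
  have hi := S.iv_pos x t
  have h1 := hB.iv_le x t ht
  have h2 := hB.one_div_le_iv x ht
  have hm := S.one_le_mu hα x t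
  have hm' := hB.mu_le x t ht
  have h3 : M ^ 2 ≤ M ^ 3 := pow_le_pow_right₀ hM (by norm_num)
  have h4 : M ≤ M ^ 3 := le_self_pow₀ hM (by norm_num)
  refine ⟨⟨?_, ?_⟩, ?_⟩
  · refine le_trans (one_div_le_one_div_of_le (by linarith) (by linarith)) (h2.trans ?_)
    exact le_mul_of_one_le_left hi.le hm
  · have := mul_le_mul hm' h1 hi.le (by linarith)
    linarith
  · have e1 : |S.dmu x t * S.iv x t| ≤ M * M := by
      rw [abs_mul, abs_of_pos hi]
      exact mul_le_mul (hB.dmu_le x t ht) h1 hi.le (by linarith)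
    have e2 : |S.mu x t * S.iv x t ^ 2| ≤ M * M ^ 2 := by
      rw [abs_of_pos (by positivity)]
      exact mul_le_mul hm' (pow_le_pow_left₀ hi.le h1 2) (by positivity) (by linarith)
    have e3 := abs_sub (S.dmu x t * S.iv x t) (S.mu x t * S.iv x t ^ 2)
    linarith

theorem BasicBound.integral_init_le (hB : S.BasicBound M) {f : ℝ → ℝ} (hf : Continuous f)
    (h : ∀ x, f x ≤ S.initDensity x) {a b : ℝ} (hab : a ≤ b) : ∫ x in a..b, f x ≤ M :=
  (integral_le_of_cont hab hf (by fun_prop) fun x _ => h x).trans (hB.init_le a b hab)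

theorem BasicBound.integral2_heating_le (hB : S.BasicBound M) {f : ℝ → ℝ → ℝ}
    (hf : Continuous fun z : ℝ × ℝ => f z.1 z.2) (h : ∀ x t, f x t ≤ S.heating x t) {a b t : ℝ}
    (hab : a ≤ b) (ht : t ∈ Icc 0 T) : ∫ s in (0:ℝ)..t, ∫ x in a..b, f x s ≤ M :=
  (integral_le_of_cont ht.1 (continuous_slice_integral hf _ _)
    (continuous_slice_integral (f := fun x s => S.heating x s) (by fun_prop) _ _)
    fun s _ => integral_le_of_cont hab (by fun_prop) (by fun_prop) fun x _ => h x s).trans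
    (hB.heating_le t ht a b hab)

theorem BasicBound.cut_b_sq_le (hB : S.BasicBound M) (i : Fin 2) {L x t : ℝ} (hL : 1 ≤ L)
    (hx : x ∈ Icc (-L) L) (ht : t ∈ Icc 0 T) :
    cut L x ^ 2 * S.b i x t ^ 2 ≤ 12 * M ^ 2 + ∫ y in (-L)..L, cut L y ^ 2 * S.bx i y t ^ 2 := by
  have hLL : -L ≤ L := by linarith
  have h1 := cut_sobolev hL one_pos hx (fun y => S.hasDeriv_b i y t) (by fun_prop)
  have h2 : ∫ y in (-L)..L, S.b i y t ^ 2 ≤ 2 * M ^ 2 :=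
    (integral_le_of_cont hLL (by fun_prop) (by fun_prop) fun y _ => by
      have h2 := sq_nonneg (S.b 0 y t)
      have h3 := sq_nonneg (S.b 1 y t)
      fin_cases i <;> simp <;> linarith).trans (hB.integral_b_sq_le hLL ht)
  have h3 : ∫ y in (-L)..L, cut L y ^ 2 * S.b i y t ^ 2 ≤ ∫ y in (-L)..L, S.b i y t ^ 2 :=
    integral_le_of_cont hLL (by fun_prop) (by fun_prop) fun y hy =>
      cut_sq_mul_le hL hy (sq_nonneg _)
  have h4 : 4 / L * ∫ y in (-L)..L, S.b i y t ^ 2 ≤ 4 * (2 * M ^ 2) :=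
    mul_le_mul (by rw [div_le_iff₀ (by linarith)]; linarith) h2
      (intervalIntegral.integral_nonneg hLL fun _ _ => sq_nonneg _) (by norm_num)
  norm_num at h1
  linarith

/-- The bound for the first derivative of the magnetic field. -/
def fieldConst (M V : ℝ) : ℝ :=
  (M + parabolicConst (2 * M ^ 3 + V) * (M + 2 * M ^ 3 * (1 + 12 * M ^ 2)))
    + (2 * parabolicConst (2 * M ^ 3 + V) * M ^ 3)
      * ((M + parabolicConst (2 * M ^ 3 + V) * (M + 2 * M ^ 3 * (1 + 12 * M ^ 2)))
        * Real.exp (2 * parabolicConst (2 * M ^ 3 + V) * M ^ 3))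

theorem BasicBound.cut_bx_sq_le (hB : S.BasicBound M) (hα : 0 ≤ α) (hT : 0 < T) (hV : 0 ≤ V)
    (hvx : ∀ t ∈ Icc 0 T, ∀ a b, a ≤ b → ∫ x in a..b, S.vx x t ^ 2 ≤ V) (i : Fin 2) {L : ℝ}
    (hL : 1 ≤ L) {t : ℝ} (ht : t ∈ Icc 0 T) :
    (∫ x in (-L)..L, cut L x ^ 2 * S.bx i x t ^ 2) + 1 / (2 * M ^ 3 + V)
      * (∫ s in (0:ℝ)..t, ∫ x in (-L)..L, cut L x ^ 2 * S.bxx i x s ^ 2) ≤ fieldConst M V := by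
  have hM := hB.one_le
  have hLL : -L ≤ L := by linarith
  have hM3 : 1 ≤ M ^ 3 := one_le_pow₀ hM
  set N := 2 * M ^ 3 + V with hN
  have hN1 : 1 ≤ N := by linarith
  have hN0 : 0 < N := by linarith
  set A := parabolicConst N with hA
  have hA0 : 0 < A := parabolicConst_pos hN0
  set H : ℝ → ℝ := fun s => ∫ x in (-L)..L, S.heating x s with hH
  have cH : Continuous H :=
    continuous_slice_integral (f := fun x s => S.heating x s) (by fun_prop) _ _
  have hH0 : ∀ s, 0 ≤ H s := fun s =>
    intervalIntegral.integral_nonneg hLL fun x _ => S.heating_nonneg hα x s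
  set y : ℝ → ℝ := fun s => ∫ x in (-L)..L, cut L x ^ 2 * S.bx i x s ^ 2 with hy
  have cy : Continuous y :=
    continuous_slice_integral (f := fun x s => cut L x ^ 2 * S.bx i x s ^ 2) (by fun_prop) _ _
  set g : ℝ → ℝ → ℝ := fun x s => S.iv x s * (S.wx i x s - S.ux x s * S.b i x s) with hg
  have cg : Continuous fun z : ℝ × ℝ => g z.1 z.2 := by rw [hg]; fun_prop
  have hsrc : ∀ s ∈ Icc 0 T, ∫ x in (-L)..L, cut L x ^ 2 * g x s ^ 2
      ≤ 2 * M ^ 2 * (1 + 12 * M ^ 2) * H s + 2 * M ^ 2 * (H s * y s) := by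
    intro s hs
    have h1 : ∫ x in (-L)..L, cut L x ^ 2 * g x s ^ 2
        ≤ ∫ x in (-L)..L, 2 * M ^ 2 * (1 + (12 * M ^ 2 + y s)) * S.heating x s := by
      refine integral_le_of_cont hLL (by fun_prop) (by fun_prop) fun x hx => ?_
      have e1 := hB.cut_b_sq_le i hL hx hs
      have e2 := S.sq_le_heating hα i x s
      have e3 := cut_sq_mul_le hL hx (sq_nonneg (S.wx i x s))
      have e4 : S.iv x s ^ 2 ≤ M ^ 2 := pow_le_pow_left₀ (S.iv_pos x s).le (hB.iv_le x s hs) 2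
      have e5 := sq_nonneg (S.wx i x s)
      have e6 := sq_nonneg (S.bx i x s)
      have e7 := sq_nonneg (S.ux x s)
      have e8 : cut L x ^ 2 * (S.wx i x s - S.ux x s * S.b i x s) ^ 2
          ≤ 2 * (S.heating x s * (1 + (12 * M ^ 2 + y s))) := by
        have f1 := mul_le_mul e1 (by linarith : S.ux x s ^ 2 ≤ S.heating x s) e7
          ((by positivity : 0 ≤ cut L x ^ 2 * S.b i x s ^ 2).trans e1)
        have f2 := mul_nonneg (sq_nonneg (cut L x)) (sq_nonneg (S.wx i x s + S.ux x s * S.b i x s))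
        linear_combination 2 * f1 + f2 + 2 * e3 + 2 * (by linarith : S.wx i x s ^ 2 ≤ S.heating x s)
      have e9 := mul_le_mul e4 e8 (by positivity) (by positivity)
      have e10 : cut L x ^ 2 * g x s ^ 2
          = S.iv x s ^ 2 * (cut L x ^ 2 * (S.wx i x s - S.ux x s * S.b i x s) ^ 2) := by
        rw [hg]; ring
      rw [e10]; linarith
    rw [intervalIntegral.integral_const_mul] at h1
    linear_combination h1
  have hd0 : ∀ r ∈ Icc 0 T,
      0 ≤ 1 / N * ∫ s in (0:ℝ)..r, ∫ x in (-L)..L, cut L x ^ 2 * S.bxx i x s ^ 2 := fun r hr =>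
    mul_nonneg (by positivity) (intervalIntegral.integral_nonneg hr.1 fun s _ =>
      intervalIntegral.integral_nonneg hLL fun x _ => by positivity)
  have hest : ∀ r ∈ Icc 0 T,
      y r + 1 / N * (∫ s in (0:ℝ)..r, ∫ x in (-L)..L, cut L x ^ 2 * S.bxx i x s ^ 2)
      ≤ (M + A * (M + 2 * M ^ 3 * (1 + 12 * M ^ 2)))
        + ∫ s in (0:ℝ)..r, 2 * A * M ^ 2 * H s * y s := by
    intro r hr
    have h1 := parabolic_estimate (f := S.b i) (fx := S.bx i) (fxx := S.bxx i) (ft := S.bt i)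
      (p := fun x s => S.iv x s ^ 2) (r := fun x s => -S.iv x s ^ 3) (q := S.vx) (g := g) hN1 hL
      (by fun_prop) (by fun_prop) (by fun_prop) (by fun_prop) (by fun_prop) (by fun_prop)
      (by fun_prop) cg (fun x s => S.hasDeriv_b i x s) (fun x s => S.hasDeriv_bx i x s)
      (fun x s hs => S.hasTDeriv_b i x s hs)
      (fun x s => by rw [S.bt_eq, hg]; ring) (fun x s hs => (hB.b_equation_coeff hV x hs).1)
      (fun x s hs => (hB.b_equation_coeff hV x hs).2)
      (fun s hs => (hvx s hs _ _ hLL).trans (by linarith)) hr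
    have h3 : ∫ x in (-L)..L, S.bx i x 0 ^ 2 ≤ M :=
      hB.integral_init_le (by fun_prop) (fun x => by
        linarith [S.sq_le_initDensity i x, sq_nonneg (S.θ x 0 - 1), sq_nonneg (S.ux x 0),
          sq_nonneg (S.wx i x 0)]) hLL
    have h4 : ∫ s in (0:ℝ)..r, ∫ x in (-L)..L, S.bx i x s ^ 2 ≤ M :=
      hB.integral2_heating_le (f := fun x s => S.bx i x s ^ 2) (by fun_prop) (fun x s => by
        linarith [S.sq_le_heating hα i x s, sq_nonneg (S.wx i x s), sq_nonneg (S.ux x s)]) hLL hr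
    have h5 := integral_le_lin2
      (f := fun s => ∫ x in (-L)..L, cut L x ^ 2 * g x s ^ 2) (g₁ := H)
      (g₂ := fun s => H s * y s) (2 * M ^ 2 * (1 + 12 * M ^ 2)) (2 * M ^ 2) hr.1
      (continuous_slice_integral (f := fun x s => cut L x ^ 2 * g x s ^ 2) (by fun_prop) _ _)
      cH (cH.mul cy) fun s hs => hsrc s ⟨hs.1, hs.2.trans hr.2⟩
    have h6 : ∫ s in (0:ℝ)..r, 2 * A * M ^ 2 * H s * y s
        = 2 * A * M ^ 2 * ∫ s in (0:ℝ)..r, H s * y s := by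
      rw [← intervalIntegral.integral_const_mul]
      exact intervalIntegral.integral_congr fun s _ => by ring
    rw [h6]
    have h7 := mul_le_mul_of_nonneg_left (hB.heating_le r hr (-L) L hLL)
      (by positivity : 0 ≤ 2 * M ^ 2 * (1 + 12 * M ^ 2))
    have h8 := mul_le_mul_of_nonneg_left (h5.trans (add_le_add_left h7 _)) hA0.le
    have h9 := mul_le_mul_of_nonneg_left h4 hA0.le
    change y r + _ ≤ _ at h1
    linear_combination h1 + h3 + h8 + h9
  exact gronwall_dissipation (M := 2 * A * M ^ 3) cy
    (cH.const_mul (2 * A * M ^ 2))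
    (fun s _ => mul_nonneg (by positivity) (hH0 s)) hd0 (by positivity)
    (by
      rw [intervalIntegral.integral_const_mul]
      have := mul_le_mul_of_nonneg_left (hB.heating_le T ⟨hT.le, le_rfl⟩ (-L) L hLL)
        (by positivity : 0 ≤ 2 * A * M ^ 2)
      linear_combination this) hest t ht

end MHDFlow

/-! ### Bounds for the gradients of the volume and of the transverse fields -/

theorem cut_sq_le {f f' : ℝ → ℝ} {L x : ℝ} (hL : 1 ≤ L) (hx : x ∈ Icc (-L) L)
    (hd : ∀ x, HasDerivAt f (f' x) x) (hf' : Continuous f') :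
    cut L x ^ 2 * f x ^ 2
      ≤ 6 * (∫ y in (-L)..L, f y ^ 2) + ∫ y in (-L)..L, cut L y ^ 2 * f' y ^ 2 := by
  have hf : Continuous f := continuous_iff_continuousAt.2 fun x => (hd x).continuousAt
  have hLL : -L ≤ L := by linarith
  have h1 := cut_sobolev hL one_pos hx hd hf'
  have h3 : ∫ y in (-L)..L, cut L y ^ 2 * f y ^ 2 ≤ ∫ y in (-L)..L, f y ^ 2 :=
    integral_le_of_cont hLL (by fun_prop) (by fun_prop) fun y hy =>
      cut_sq_mul_le hL hy (sq_nonneg _)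
  have h4 : 4 / L * ∫ y in (-L)..L, f y ^ 2 ≤ 4 * ∫ y in (-L)..L, f y ^ 2 :=
    mul_le_mul_of_nonneg_right (by rw [div_le_iff₀ (by linarith)]; linarith)
      (intervalIntegral.integral_nonneg hLL fun _ _ => sq_nonneg _)
  norm_num at h1
  linarith

theorem cut_fourth_le {f f' : ℝ → ℝ} {L : ℝ} (hL : 1 ≤ L)
    (hd : ∀ x, HasDerivAt f (f' x) x) (hf' : Continuous f') :
    ∫ y in (-L)..L, cut L y ^ 2 * f y ^ 4
      ≤ (6 * (∫ y in (-L)..L, f y ^ 2) + ∫ y in (-L)..L, cut L y ^ 2 * f' y ^ 2)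
        * ∫ y in (-L)..L, f y ^ 2 := by
  have hf : Continuous f := continuous_iff_continuousAt.2 fun x => (hd x).continuousAt
  rw [← intervalIntegral.integral_const_mul]
  refine integral_le_of_cont (by linarith) (by fun_prop) (by fun_prop) fun y hy => ?_
  have := mul_le_mul_of_nonneg_right (cut_sq_le hL hy hd hf') (sq_nonneg (f y))
  linear_combination this

/-- Time-integrated form of `cut_fourth_le` for a function with bounded energy. -/
theorem integral_cut_fourth_le {fx fxx : ℝ → ℝ → ℝ} {L T R B t : ℝ} (hL : 1 ≤ L) (hR : 0 ≤ R)
    (hfx : Continuous fun z : ℝ × ℝ => fx z.1 z.2)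
    (hfxx : Continuous fun z : ℝ × ℝ => fxx z.1 z.2)
    (hd : ∀ x t, HasDerivAt (fun y => fx y t) (fxx x t) x) (ht : t ∈ Icc 0 T)
    (h1 : ∀ s ∈ Icc 0 T, ∫ x in (-L)..L, fx x s ^ 2 ≤ R)
    (h2 : ∫ s in (0:ℝ)..t, ∫ x in (-L)..L, cut L x ^ 2 * fxx x s ^ 2 ≤ B) :
    ∫ s in (0:ℝ)..t, ∫ x in (-L)..L, cut L x ^ 2 * fx x s ^ 4 ≤ 6 * R ^ 2 * T + R * B := by
  have hLL : -L ≤ L := by linarith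
  have h3 := integral_le_lin2
    (f := fun s => ∫ x in (-L)..L, cut L x ^ 2 * fx x s ^ 4) (g₁ := fun _ => 1)
    (g₂ := fun s => ∫ x in (-L)..L, cut L x ^ 2 * fxx x s ^ 2) (6 * R ^ 2) R ht.1
    (continuous_slice_integral (f := fun x s => cut L x ^ 2 * fx x s ^ 4) (by fun_prop) _ _)
    continuous_const
    (continuous_slice_integral (f := fun x s => cut L x ^ 2 * fxx x s ^ 2) (by fun_prop) _ _)
    fun s hs => by
      have e1 := h1 s ⟨hs.1, hs.2.trans ht.2⟩
      have e2 : 0 ≤ ∫ x in (-L)..L, fx x s ^ 2 :=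
        intervalIntegral.integral_nonneg hLL fun _ _ => sq_nonneg _
      have e3 : 0 ≤ ∫ x in (-L)..L, cut L x ^ 2 * fxx x s ^ 2 :=
        intervalIntegral.integral_nonneg hLL fun _ _ => by positivity
      refine (cut_fourth_le hL (fun x => hd x s) (by fun_prop)).trans ?_
      have := mul_le_mul (by linarith : 6 * (∫ x in (-L)..L, fx x s ^ 2)
        + (∫ x in (-L)..L, cut L x ^ 2 * fxx x s ^ 2)
        ≤ 6 * R + ∫ x in (-L)..L, cut L x ^ 2 * fxx x s ^ 2) e1 e2 (by linarith)
      linear_combination this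
  have h4 : ∫ s in (0:ℝ)..t, (1:ℝ) = t := by simp
  rw [h4] at h3
  have h5 := mul_le_mul_of_nonneg_left ht.2 (by positivity : 0 ≤ 6 * R ^ 2)
  have h6 := mul_le_mul_of_nonneg_left h2 hR
  linarith

namespace MHDFlow

variable {α β T : ℝ} {S : MHDFlow α β T} {M V : ℝ}

theorem BasicBound.cut_wx_sq_le (hB : S.BasicBound M) (hα : 0 ≤ α) (hV : 0 ≤ V)
    (hvx : ∀ t ∈ Icc 0 T, ∀ a b, a ≤ b → ∫ x in a..b, S.vx x t ^ 2 ≤ V) (i : Fin 2) {L : ℝ}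
    (hL : 1 ≤ L) {t : ℝ} (ht : t ∈ Icc 0 T) :
    (∫ x in (-L)..L, cut L x ^ 2 * S.wx i x t ^ 2) + 1 / (2 * M ^ 3 + V)
      * (∫ s in (0:ℝ)..t, ∫ x in (-L)..L, cut L x ^ 2 * S.wxx i x s ^ 2)
        ≤ M + 2 * parabolicConst (2 * M ^ 3 + V) * M := by
  have hM := hB.one_le
  have hLL : -L ≤ L := by linarith
  have hM3 : 1 ≤ M ^ 3 := one_le_pow₀ hM
  have hA0 := parabolicConst_pos (by linarith : 0 < 2 * M ^ 3 + V)
  have h1 := parabolic_estimate (N := 2 * M ^ 3 + V) (f := S.w i) (fx := S.wx i) (fxx := S.wxx i)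
    (ft := S.wt i)
    (p := S.iv) (r := fun x s => -S.iv x s ^ 2) (q := S.vx) (g := S.bx i) (by linarith) hL
    (by fun_prop) (by fun_prop) (by fun_prop) (by fun_prop) (by fun_prop) (by fun_prop)
    (by fun_prop) (by fun_prop) (fun x s => S.hasDeriv_w i x s) (fun x s => S.hasDeriv_wx i x s)
    (fun x s hs => S.hasTDeriv_w i x s hs)
    (fun x s => by rw [S.wt_eq]; ring) (fun x s hs => (hB.w_equation_coeff hV x hs).1)
    (fun x s hs => (hB.w_equation_coeff hV x hs).2)
    (fun s hs => (hvx s hs _ _ hLL).trans (by linarith)) ht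
  have h3 : ∫ x in (-L)..L, S.wx i x 0 ^ 2 ≤ M :=
    hB.integral_init_le (by fun_prop) (fun x => by
      linarith [S.sq_le_initDensity i x, sq_nonneg (S.θ x 0 - 1), sq_nonneg (S.ux x 0),
        sq_nonneg (S.bx i x 0)]) hLL
  have h4 : ∫ s in (0:ℝ)..t, ∫ x in (-L)..L, S.wx i x s ^ 2 ≤ M :=
    hB.integral2_heating_le (f := fun x s => S.wx i x s ^ 2) (by fun_prop) (fun x s => by
      linarith [S.sq_le_heating hα i x s, sq_nonneg (S.bx i x s), sq_nonneg (S.ux x s)]) hLL ht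
  have h5 : ∫ s in (0:ℝ)..t, ∫ x in (-L)..L, cut L x ^ 2 * S.bx i x s ^ 2 ≤ M := by
    refine le_trans (integral_le_of_cont ht.1 (continuous_slice_integral
      (f := fun x s => cut L x ^ 2 * S.bx i x s ^ 2) (by fun_prop) _ _)
      (continuous_slice_integral (f := fun x s => S.bx i x s ^ 2) (by fun_prop) _ _)
      fun s _ => integral_le_of_cont hLL (by fun_prop) (by fun_prop) fun x hx =>
        cut_sq_mul_le hL hx (sq_nonneg _))
      (hB.integral2_heating_le (f := fun x s => S.bx i x s ^ 2) (by fun_prop) (fun x s => by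
      linarith [S.sq_le_heating hα i x s, sq_nonneg (S.wx i x s), sq_nonneg (S.ux x s)]) hLL ht)
  have h6 := mul_le_mul_of_nonneg_left h4 hA0.le
  have h7 := mul_le_mul_of_nonneg_left h5 hA0.le
  linarith

/-- Bounds for the gradients of the specific volume and of the transverse fields. -/
structure GradientBound (S : MHDFlow α β T) (V : ℝ) : Prop where
  one_le : 1 ≤ V
  vx_le : ∀ t ∈ Icc 0 T, ∀ a b, a ≤ b → ∫ x in a..b, S.vx x t ^ 2 ≤ V
  b_le : ∀ x, ∀ t ∈ Icc 0 T, S.b 0 x t ^ 2 + S.b 1 x t ^ 2 ≤ V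
  wx_le : ∀ i, ∀ L, 1 ≤ L → ∀ t ∈ Icc 0 T,
    ∫ s in (0:ℝ)..t, ∫ x in (-L)..L, cut L x ^ 2 * S.wx i x s ^ 4 ≤ V
  bx_le : ∀ i, ∀ L, 1 ≤ L → ∀ t ∈ Icc 0 T,
    ∫ s in (0:ℝ)..t, ∫ x in (-L)..L, cut L x ^ 2 * S.bx i x s ^ 4 ≤ V

theorem exists_gradientBound (α β T M : ℝ) (hα : 0 ≤ α) (hT : 0 < T) (hM : 1 ≤ M) :
    ∃ V, 1 ≤ V ∧ ∀ S : MHDFlow α β T, S.BasicBound M → S.GradientBound V := by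
  obtain ⟨C, hC, hvx⟩ := exists_integral_vx_sq_le α β T M hα hT hM
  have hM3 : 1 ≤ M ^ 3 := one_le_pow₀ hM
  set N := 2 * M ^ 3 + C with hN
  have hN0 : 0 < N := by linarith
  have hA0 := parabolicConst_pos hN0
  set B := fieldConst M C with hB
  have hB0 : 0 < B := by rw [hB]; unfold fieldConst; positivity
  set W := M + 2 * parabolicConst N * M with hW
  have hW0 : 0 < W := by positivity
  set V := 1 + C + (4 * M ^ 2 + 4 * B) + (6 * (2 * W) ^ 2 * T + 2 * W * (N * W))
    + (6 * (2 * B) ^ 2 * T + 2 * B * (N * B)) with hV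
  have p1 : 0 < 6 * (2 * W) ^ 2 * T + 2 * W * (N * W) := by positivity
  have p2 : 0 < 6 * (2 * B) ^ 2 * T + 2 * B * (N * B) := by positivity
  have p3 : 0 < 4 * M ^ 2 + 4 * B := by positivity
  refine ⟨V, by linarith, fun S hS => ?_⟩
  have hvS := hvx S hS
  have hwc := fun i L hL t ht => hS.cut_wx_sq_le hα hC.le hvS i (L := L) hL (t := t) ht
  have hbc := fun i L hL t ht => hS.cut_bx_sq_le hα hT hC.le hvS i (L := L) hL (t := t) ht
  have hpos : ∀ (F : ℝ → ℝ → ℝ) (L t : ℝ), 1 ≤ L → 0 ≤ t →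
      0 ≤ ∫ s in (0:ℝ)..t, ∫ x in (-L)..L, cut L x ^ 2 * F x s ^ 2 := fun F L t hL ht =>
    intervalIntegral.integral_nonneg ht fun s _ =>
      intervalIntegral.integral_nonneg (by linarith) fun x _ => by positivity
  have hpos' : ∀ (F : ℝ → ℝ) (L : ℝ), 1 ≤ L → 0 ≤ ∫ x in (-L)..L, cut L x ^ 2 * F x ^ 2 :=
    fun F L hL => intervalIntegral.integral_nonneg (by linarith) fun x _ => by positivity
  have hwx : ∀ i, ∀ t ∈ Icc 0 T, ∀ a b, a ≤ b → ∫ x in a..b, S.wx i x t ^ 2 ≤ 2 * W :=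
    fun i t ht a b hab => integral_le_of_cut (by fun_prop) (fun _ => sq_nonneg _) (by
      filter_upwards [eventually_ge_atTop 1] with L hL
      have h1 := hwc i L hL t ht
      have h2 := mul_nonneg (by positivity : 0 ≤ 1 / N) (hpos (S.wxx i) L t hL ht.1)
      linarith) hab
  have hbx : ∀ i, ∀ t ∈ Icc 0 T, ∀ a b, a ≤ b → ∫ x in a..b, S.bx i x t ^ 2 ≤ 2 * B :=
    fun i t ht a b hab => integral_le_of_cut (by fun_prop) (fun _ => sq_nonneg _) (by
      filter_upwards [eventually_ge_atTop 1] with L hL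
      have h1 := hbc i L hL t ht
      have h2 := mul_nonneg (by positivity : 0 ≤ 1 / N) (hpos (S.bxx i) L t hL ht.1)
      linarith) hab
  refine ⟨by linarith, fun t ht a b hab => (hvS t ht a b hab).trans (by linarith), ?_, ?_, ?_⟩
  · intro x t ht
    have hm := le_integral_unit (f := fun y => S.b 0 y t ^ 2 + S.b 1 y t ^ 2) (a := x) (x := x)
      ⟨le_rfl, by linarith⟩
      (fun y => ((S.hasDeriv_b 0 y t).fun_pow 2).fun_add ((S.hasDeriv_b 1 y t).fun_pow 2))
      (by fun_prop)
    refine hm.trans ?_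
    have h1 := hS.integral_b_sq_le (by linarith : x ≤ x + 1) ht
    have h3 := integral_le_lin3 1 1 1 (by linarith : x ≤ x + 1) (f := fun y =>
      |((2:ℕ):ℝ) * S.b 0 y t ^ (2 - 1) * S.bx 0 y t
        + ((2:ℕ):ℝ) * S.b 1 y t ^ (2 - 1) * S.bx 1 y t|)
      (g₁ := fun y => S.b 0 y t ^ 2 + S.b 1 y t ^ 2) (g₂ := fun y => S.bx 0 y t ^ 2)
      (g₃ := fun y => S.bx 1 y t ^ 2)
      (by fun_prop) (by fun_prop) (by fun_prop) (by fun_prop) fun y _ => by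
        rw [abs_le]
        push_cast
        constructor
        · linarith [sq_nonneg (S.b 0 y t + S.bx 0 y t), sq_nonneg (S.b 1 y t + S.bx 1 y t)]
        · linarith [sq_nonneg (S.b 0 y t - S.bx 0 y t), sq_nonneg (S.b 1 y t - S.bx 1 y t)]
    have h4 := hbx 0 t ht x (x + 1) (by linarith)
    have h5 := hbx 1 t ht x (x + 1) (by linarith)
    linarith
  · intro i L hL t ht
    refine (integral_cut_fourth_le (fx := S.wx i) (fxx := S.wxx i) (B := N * W)
      (R := 2 * W) hL (by positivity)
      (by fun_prop) (by fun_prop) (fun x s => S.hasDeriv_wx i x s) ht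
      (fun s hs => hwx i s hs _ _ (by linarith)) ?_).trans (by linarith)
    have h1 := hwc i L hL t ht
    have h2 := hpos' (fun x => S.wx i x t) L hL
    rw [← div_le_iff₀' hN0]
    rw [one_div_mul_eq_div] at h1
    linarith
  · intro i L hL t ht
    refine (integral_cut_fourth_le (fx := S.bx i) (fxx := S.bxx i) (B := N * B)
      (R := 2 * B) hL (by positivity)
      (by fun_prop) (by fun_prop) (fun x s => S.hasDeriv_bx i x s) ht
      (fun s hs => hbx i s hs _ _ (by linarith)) ?_).trans (by linarith)
    have h1 := hbc i L hL t ht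
    have h2 := hpos' (fun x => S.bx i x t) L hL
    rw [← div_le_iff₀' hN0]
    rw [one_div_mul_eq_div] at h1
    linarith

end MHDFlow

/-! ### The coupled estimate for the temperature and the velocity gradient -/

theorem le_young_of_sq_le {Z A B k : ℝ} (hA : 0 ≤ A) (hB : 0 ≤ B) (hk : 0 < k)
    (h : Z ^ 2 ≤ A * B) : Z ≤ k * A + 1 / (4 * k) * B := by
  refine (le_abs_self Z).trans (abs_le_of_sq_le_sq (h.trans ?_) (by positivity))
  have e : k * (1 / (4 * k)) = 1 / 4 := by field_simp
  have := sq_nonneg (k * A - 1 / (4 * k) * B)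
  linear_combination this - 4 * A * B * e

namespace MHDFlow

variable {α β T : ℝ} {S : MHDFlow α β T} {M V : ℝ}

/-- The density of the error produced by the cutoff in the temperature estimate. -/
def tempError (S : MHDFlow α β T) (x t : ℝ) : ℝ :=
  (4 + 16 * (S.θp β x t * S.iv x t)) * (S.θ x t - 1) ^ 2

@[fun_prop] theorem continuous_tempError {X : Type*} [TopologicalSpace X] {f g : X → ℝ}
    (hf : Continuous f) (hg : Continuous g) :
    Continuous fun x => S.tempError (f x) (g x) := by
  unfold tempError; fun_prop

theorem eventually_tempError_le (S : MHDFlow α β T) :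
    ∀ᶠ L in atTop, ∀ t ∈ Icc 0 T, ∫ x in (-L)..L, S.tempError x t ≤ L := by
  have hlim : Tendsto (fun p : ℝ × ℝ => S.tempError p.1 p.2) spaceInf (nhds 0) := by
    have := ((((S.lim_θp β).mul S.lim_iv).const_mul 16).const_add 4).mul
      ((S.lim_θ.sub_const 1).pow 2)
    simpa [tempError] using this
  filter_upwards [average_tendsto_zero T (g := S.tempError) (by fun_prop) hlim 1 one_pos,
    eventually_ge_atTop 1] with L hL hL1 t ht
  refine le_trans (integral_le_of_cont (by linarith) (by fun_prop) (by fun_prop)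
    fun x _ => le_abs_self _) ((hL t ht).trans (by linarith))

theorem cut_temp_sq_le {L x t : ℝ} (hL : 1 ≤ L) (hx : x ∈ Icc (-L) L)
    (herr : ∫ x in (-L)..L, S.tempError x t ≤ L) :
    cut L x ^ 2 * (S.θ x t - 1) ^ 2
      ≤ 2 * (∫ y in (-L)..L, cut L y ^ 2 * (S.θ y t - 1) ^ 2)
        + (∫ y in (-L)..L, cut L y ^ 2 * S.θx y t ^ 2) + 1 := by
  have hL0 : 0 < L := by linarith
  have h1 := cut_sobolev hL one_pos hx (fun y => (S.hasDeriv_θ y t).sub_const 1) (by fun_prop)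
  have h2 : ∫ y in (-L)..L, 4 * (S.θ y t - 1) ^ 2 ≤ ∫ y in (-L)..L, S.tempError y t :=
    integral_le_of_cont (by linarith) (by fun_prop) (by fun_prop) fun y _ => by
      have := S.iv_pos y t
      have := S.θp_pos β y t
      have : 0 ≤ (S.θp β y t * S.iv y t) * (S.θ y t - 1) ^ 2 := by positivity
      unfold tempError; linarith
  rw [intervalIntegral.integral_const_mul] at h2
  have h3 : 4 / L * ∫ y in (-L)..L, (S.θ y t - 1) ^ 2 ≤ 1 := by
    rw [div_mul_eq_mul_div, div_le_iff₀ hL0]; linarith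
  norm_num at h1
  linarith

theorem BasicBound.cut_pressx_sq_le (hB : S.BasicBound M) (hα : 0 ≤ α) (hG : S.GradientBound V)
    {L t : ℝ} (hL : 1 ≤ L) (ht : t ∈ Icc 0 T) (herr : ∫ x in (-L)..L, S.tempError x t ≤ L) :
    ∫ x in (-L)..L, cut L x ^ 2 * (-S.pressx x t) ^ 2
      ≤ (3 * M ^ 2 + 24 * M ^ 4 * V + 3 * V)
        * ((∫ y in (-L)..L, cut L y ^ 2 * S.θx y t ^ 2)
          + (∫ y in (-L)..L, cut L y ^ 2 * (S.θ y t - 1) ^ 2)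
          + (∫ y in (-L)..L, S.heating y t) + 1) := by
  have hM := hB.one_le
  have hV := hG.one_le
  have hLL : -L ≤ L := by linarith
  have hsup := fun x hx => cut_temp_sq_le (x := x) hL hx herr
  set Y := ∫ y in (-L)..L, cut L y ^ 2 * (S.θ y t - 1) ^ 2
  set G := ∫ y in (-L)..L, cut L y ^ 2 * S.θx y t ^ 2
  set H := ∫ y in (-L)..L, S.heating y t
  have hY0 : 0 ≤ Y := intervalIntegral.integral_nonneg hLL fun x _ => by positivity
  have hG0 : 0 ≤ G := intervalIntegral.integral_nonneg hLL fun x _ => by positivity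
  have hH0 : 0 ≤ H := intervalIntegral.integral_nonneg hLL fun x _ => S.heating_nonneg hα x t
  have h1 := integral_le_lin3 (f := fun x => cut L x ^ 2 * (-S.pressx x t) ^ 2)
    (g₁ := fun x => cut L x ^ 2 * S.θx x t ^ 2) (g₂ := fun x => S.vx x t ^ 2)
    (g₃ := fun x => S.heating x t) (3 * M ^ 2) (3 * M ^ 4 * (2 * (2 * Y + G + 1) + 2)) (3 * V) hLL
    (by fun_prop) (by fun_prop) (by fun_prop) (by fun_prop) fun x hx => by
      have e1 := hsup x hx
      have e2 : S.iv x t ^ 2 ≤ M ^ 2 := pow_le_pow_left₀ (S.iv_pos x t).le (hB.iv_le x t ht) 2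
      have e3 : (S.iv x t ^ 2) ^ 2 ≤ (M ^ 2) ^ 2 := pow_le_pow_left₀ (sq_nonneg _) e2 2
      have e4 := hG.b_le x t ht
      have e5 := cut_sq_mul_le hL hx zero_le_one
      have e6 : cut L x ^ 2 * S.θ x t ^ 2 ≤ 2 * (2 * Y + G + 1) + 2 := by
        have := mul_nonneg (sq_nonneg (cut L x)) (sq_nonneg (S.θ x t - 2))
        linear_combination 2 * e1 + 2 * e5 + this
      have e7 : S.bx 0 x t ^ 2 + S.bx 1 x t ^ 2 ≤ S.heating x t := by
        unfold heating
        have : 0 ≤ S.mu x t * S.ux x t ^ 2 :=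
          mul_nonneg (by linarith [S.one_le_mu hα x t]) (sq_nonneg _)
        linarith [sq_nonneg (S.wx 0 x t), sq_nonneg (S.wx 1 x t)]
      have e8 : cut L x ^ 2 * (S.b 0 x t * S.bx 0 x t + S.b 1 x t * S.bx 1 x t) ^ 2
          ≤ V * S.heating x t := by
        refine (cut_sq_mul_le hL hx (sq_nonneg _)).trans ?_
        have f1 := mul_le_mul e4 e7 (by positivity) (by linarith)
        have f2 := sq_nonneg (S.b 0 x t * S.bx 1 x t - S.b 1 x t * S.bx 0 x t)
        linear_combination f1 + f2
      have e9 := mul_le_mul_of_nonneg_right e2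
        (by positivity : 0 ≤ cut L x ^ 2 * S.θx x t ^ 2)
      have e10 := mul_le_mul_of_nonneg_right (mul_le_mul e3 e6 (by positivity) (by positivity))
        (sq_nonneg (S.vx x t))
      have e11 : ∀ p q r : ℝ, (-(p - q + r)) ^ 2 ≤ 3 * (p ^ 2 + q ^ 2 + r ^ 2) := fun p q r => by
        linarith [sq_nonneg (p + q), sq_nonneg (p - r), sq_nonneg (q + r)]
      have e12 := mul_le_mul_of_nonneg_left (e11 (S.θx x t * S.iv x t)
        (S.θ x t * S.vx x t * S.iv x t ^ 2)
        (S.b 0 x t * S.bx 0 x t + S.b 1 x t * S.bx 1 x t)) (sq_nonneg (cut L x))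
      unfold pressx
      linear_combination e12 + 3 * e8 + 3 * e9 + 3 * e10
  have h2 := mul_le_mul_of_nonneg_left (hG.vx_le t ht (-L) L hLL)
    (by positivity : 0 ≤ 3 * M ^ 4 * (2 * (2 * Y + G + 1) + 2))
  have p1 : 0 ≤ M ^ 4 * V * G := by positivity
  have p2 : 0 ≤ M ^ 4 * V * Y := by positivity
  have p3 : 0 ≤ M ^ 4 * V * H := by positivity
  have p4 : 0 ≤ M ^ 4 * V := by positivity
  have p5 : 0 ≤ M ^ 2 * Y := by positivity
  have p6 : 0 ≤ M ^ 2 * H := by positivity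
  have p7 : 0 ≤ V * Y := by positivity
  have p8 : 0 ≤ V * G := by positivity
  have p9 : 0 ≤ M ^ 2 := by positivity
  linarith

/-- The heat flux. -/
def heatFlux (S : MHDFlow α β T) (x t : ℝ) : ℝ := S.θp β x t * S.θx x t * S.iv x t

theorem temp_pointwise_le (hB : S.BasicBound M) (hα : 0 ≤ α) (hβ : 0 < β) {L x t : ℝ} (hL : 1 ≤ L)
    (hx : x ∈ Icc (-L) L) (ht : t ∈ Icc 0 T) :
    -2 * (2 * cut L x * cutd L x * ((S.θ x t - 1) * S.heatFlux x t))
      - 2 * (cut L x ^ 2 * (S.θx x t * S.heatFlux x t))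
      - 2 * (cut L x ^ 2 * ((S.θ x t - 1) * (S.θ x t * S.iv x t * S.ux x t)))
      + 2 * (cut L x ^ 2 * ((S.θ x t - 1) * (S.heating x t * S.iv x t)))
    ≤ -((1 / M) ^ β * (1 / M)) * (cut L x ^ 2 * S.θx x t ^ 2) + 1 / L * S.tempError x t
      + 2 * M * (cut L x * (S.θ x t - 1) * (cut L x * (S.θ x t - 1) * |S.ux x t|))
      + (5 * M * (cut L x ^ 2 * (S.θ x t - 1) ^ 2) + M * S.ux x t ^ 2
      + M * (cut L x ^ 2 * S.wx 0 x t ^ 4 + cut L x ^ 2 * S.wx 1 x t ^ 4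
        + cut L x ^ 2 * S.bx 0 x t ^ 4 + cut L x ^ 2 * S.bx 1 x t ^ 4))
      + 2 * M ^ 2 * (cut L x * |S.θ x t - 1| * (cut L x * S.ux x t ^ 2)) := by
  have hM := hB.one_le
  have hi := S.iv_pos x t
  have hi' := hB.iv_le x t ht
  have hp := S.θp_pos β x t
  have hmu := S.one_le_mu hα x t
  have hmu' := hB.mu_le x t ht
  have hL0 : 0 < L := by linarith
  set c := cut L x with hc
  set q := S.θ x t - 1 with hq
  have hc2 : 0 ≤ c ^ 2 := sq_nonneg c
  have e1 : -2 * (2 * c * cutd L x * (q * S.heatFlux x t))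
      ≤ c ^ 2 * (S.θx x t * S.heatFlux x t)
        + 16 * (q ^ 2 * (S.θp β x t * S.iv x t)) / L := by
    have h1 := abs_cut_mul_le (c := c) (Z := q * S.heatFlux x t)
      (A := S.θx x t * S.heatFlux x t) (B := q ^ 2 * (S.θp β x t * S.iv x t)) hL
      (abs_cutd_le hL hx) (by
        unfold heatFlux
        have : 0 ≤ S.θp β x t * S.iv x t * S.θx x t ^ 2 := by positivity
        linarith) (by positivity)
      (le_of_eq (by unfold heatFlux; ring))
    have h2 := neg_le_abs (2 * c * cutd L x * (q * S.heatFlux x t))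
    linear_combination 2 * h1 + 2 * h2
  have e2 : (1 / M) ^ β * (1 / M) * (c ^ 2 * S.θx x t ^ 2)
      ≤ c ^ 2 * (S.θx x t * S.heatFlux x t) := by
    have h1 : (1 / M) ^ β ≤ S.θp β x t :=
      Real.rpow_le_rpow (by positivity) (hB.θ_ge x t ht) hβ.le
    have h2 := mul_le_mul_of_nonneg_right (mul_le_mul h1 (hB.one_div_le_iv x ht)
      (by positivity) hp.le) (by positivity : 0 ≤ c ^ 2 * S.θx x t ^ 2)
    unfold heatFlux
    linear_combination h2
  have e3 : 1 / L * S.tempError x t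
      = 4 / L * q ^ 2 + 16 * (q ^ 2 * (S.θp β x t * S.iv x t)) / L := by
    unfold tempError; ring
  have e3' : 0 ≤ 4 / L * q ^ 2 := by positivity
  have e4 : -2 * (c ^ 2 * (q * (S.θ x t * S.iv x t * S.ux x t)))
      ≤ 2 * M * (c * q * (c * q * |S.ux x t|)) + M * (c ^ 2 * q ^ 2) + M * S.ux x t ^ 2 := by
    have f1 : -(q * (S.θ x t * S.ux x t)) ≤ q ^ 2 * |S.ux x t| + (q ^ 2 + S.ux x t ^ 2) / 2 := by
      have g1 := mul_le_mul_of_nonneg_left (neg_le_abs (S.ux x t)) (sq_nonneg q)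
      have g2 := sq_nonneg (q + S.ux x t)
      have g3 : S.θ x t = q + 1 := by rw [hq]; ring
      rw [g3]
      linear_combination g1 + g2 / 2
    have f2 : 0 ≤ q ^ 2 * |S.ux x t| + (q ^ 2 + S.ux x t ^ 2) / 2 := by positivity
    have f3 := mul_le_mul_of_nonneg_left f1 (by positivity : 0 ≤ 2 * c ^ 2 * S.iv x t)
    have f4 := mul_le_mul_of_nonneg_left hi' (mul_nonneg (by positivity : 0 ≤ 2 * c ^ 2) f2)
    have f5 := mul_le_mul_of_nonneg_left (cut_sq_mul_le hL hx (sq_nonneg (S.ux x t)))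
      (by linarith : 0 ≤ M)
    linear_combination f3 + f4 + f5
  have e5 : 2 * (c ^ 2 * (q * (S.heating x t * S.iv x t)))
      ≤ 2 * M ^ 2 * (c * |q| * (c * S.ux x t ^ 2)) + 4 * M * (c ^ 2 * q ^ 2)
      + M * (c ^ 2 * S.wx 0 x t ^ 4 + c ^ 2 * S.wx 1 x t ^ 4
        + c ^ 2 * S.bx 0 x t ^ 4 + c ^ 2 * S.bx 1 x t ^ 4) := by
    have f0 := S.heating_nonneg hα x t
    have f1 : q * (S.heating x t * S.iv x t) ≤ |q| * (S.heating x t * M) :=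
      mul_le_mul (le_abs_self q) (mul_le_mul_of_nonneg_left hi' f0) (by positivity)
        (abs_nonneg q)
    have f2 : ∀ z : ℝ, |q| * z ^ 2 ≤ (q ^ 2 + z ^ 4) / 2 := fun z => by
      have := sq_nonneg (|q| - z ^ 2)
      have h := sq_abs q
      linear_combination (1 / 2) * this + (1 / 2) * h
    have f3 := mul_le_mul_of_nonneg_left (mul_le_mul_of_nonneg_right hmu'
      (sq_nonneg (S.ux x t))) (abs_nonneg q)
    have f4 : |q| * S.heating x t ≤ M * (|q| * S.ux x t ^ 2) + 2 * q ^ 2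
        + (S.wx 0 x t ^ 4 + S.wx 1 x t ^ 4 + S.bx 0 x t ^ 4 + S.bx 1 x t ^ 4) / 2 := by
      unfold heating
      linear_combination f3 + f2 (S.wx 0 x t) + f2 (S.wx 1 x t) + f2 (S.bx 0 x t)
        + f2 (S.bx 1 x t)
    have f5 := mul_le_mul_of_nonneg_left f1 (by positivity : 0 ≤ 2 * c ^ 2)
    have f6 := mul_le_mul_of_nonneg_left f4 (by positivity : 0 ≤ 2 * c ^ 2 * M)
    linear_combination f5 + f6
  linarith

end MHDFlow

namespace MHDFlow

variable {α β T : ℝ} {S : MHDFlow α β T} {M V : ℝ}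

@[fun_prop] theorem continuous_heatFlux {X : Type*} [TopologicalSpace X] {f g : X → ℝ}
    (hf : Continuous f) (hg : Continuous g) :
    Continuous fun x => S.heatFlux (f x) (g x) := by
  unfold heatFlux; fun_prop

theorem hasDeriv_heatFlux (S : MHDFlow α β T) (x t : ℝ) :
    HasDerivAt (fun y => S.heatFlux y t)
      (S.θt x t + S.θ x t * S.iv x t * S.ux x t - S.heating x t * S.iv x t) x := by
  refine (((S.hasDeriv_θp β x t).fun_mul (S.hasDeriv_θx x t)).fun_mul
    (S.hasDeriv_iv x t)).congr_deriv ?_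
  rw [S.θt_eq]
  unfold heating
  ring

theorem integral_cut_temp_mul_θt (S : MHDFlow α β T) {L : ℝ} (hL : 1 ≤ L) (t : ℝ) :
    ∫ x in (-L)..L, cut L x ^ 2 * (2 * (S.θ x t - 1) * S.θt x t)
      = ∫ x in (-L)..L, (-2 * (2 * cut L x * cutd L x * ((S.θ x t - 1) * S.heatFlux x t))
      - 2 * (cut L x ^ 2 * (S.θx x t * S.heatFlux x t))
      - 2 * (cut L x ^ 2 * ((S.θ x t - 1) * (S.θ x t * S.iv x t * S.ux x t)))
      + 2 * (cut L x ^ 2 * ((S.θ x t - 1) * (S.heating x t * S.iv x t)))) := by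
  have h1 := cut_integral_by_parts hL
    (fun x => ((S.hasDeriv_θ x t).sub_const 1).fun_mul (S.hasDeriv_heatFlux x t)) (by fun_prop)
  rw [← sub_eq_zero, ← integral_sub_cont _ _ (by fun_prop) (by fun_prop)]
  rw [eq_neg_iff_add_eq_zero, ← integral_add_cont _ _ (by fun_prop) (by fun_prop)] at h1
  have h2 := congrArg (fun z : ℝ => 2 * z) h1
  rw [mul_zero, ← intervalIntegral.integral_const_mul] at h2
  refine Eq.trans ?_ h2
  exact intervalIntegral.integral_congr fun x _ => by ring

theorem integral_cut_temp_sq_mul_abs_le (S : MHDFlow α β T) {L t k : ℝ} (hL : 1 ≤ L) (hk : 0 < k)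
    (herr : ∫ x in (-L)..L, S.tempError x t ≤ L) :
    ∫ x in (-L)..L, cut L x * (S.θ x t - 1) * (cut L x * (S.θ x t - 1) * |S.ux x t|)
      ≤ k * (2 * (∫ y in (-L)..L, cut L y ^ 2 * (S.θ y t - 1) ^ 2)
        + (∫ y in (-L)..L, cut L y ^ 2 * S.θx y t ^ 2) + 1)
      + 1 / (4 * k) * ((∫ y in (-L)..L, cut L y ^ 2 * (S.θ y t - 1) ^ 2)
        * ∫ y in (-L)..L, S.ux y t ^ 2) := by
  have hLL : -L ≤ L := by linarith
  have hsup := fun x hx => cut_temp_sq_le (S := S) (x := x) hL hx herr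
  set Y := ∫ y in (-L)..L, cut L y ^ 2 * (S.θ y t - 1) ^ 2 with hY
  set G := ∫ y in (-L)..L, cut L y ^ 2 * S.θx y t ^ 2
  set U := ∫ y in (-L)..L, S.ux y t ^ 2
  have hY0 : 0 ≤ Y := intervalIntegral.integral_nonneg hLL fun x _ => by positivity
  have hG0 : 0 ≤ G := intervalIntegral.integral_nonneg hLL fun x _ => by positivity
  have hU0 : 0 ≤ U := intervalIntegral.integral_nonneg hLL fun x _ => by positivity
  have h1 := sq_integral_mul_le (f := fun x => cut L x * (S.θ x t - 1))
    (g := fun x => cut L x * (S.θ x t - 1) * |S.ux x t|) hLL (by fun_prop) (by fun_prop)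
  have h2 : ∫ x in (-L)..L, (cut L x * (S.θ x t - 1)) ^ 2 = Y :=
    intervalIntegral.integral_congr fun x _ => by ring
  have h3 : ∫ x in (-L)..L, (cut L x * (S.θ x t - 1) * |S.ux x t|) ^ 2 ≤ (2 * Y + G + 1) * U := by
    rw [← intervalIntegral.integral_const_mul]
    refine integral_le_of_cont hLL (by fun_prop) (by fun_prop) fun x hx => ?_
    rw [mul_pow, sq_abs, mul_pow]
    exact mul_le_mul_of_nonneg_right (hsup x hx) (sq_nonneg _)
  rw [h2] at h1
  refine le_young_of_sq_le (by positivity) (by positivity) hk (h1.trans ?_)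
  have := mul_le_mul_of_nonneg_left h3 hY0
  linarith

theorem integral_cut_abs_temp_mul_le (S : MHDFlow α β T) {L t k : ℝ} (hL : 1 ≤ L) (hk : 0 < k) :
    ∫ x in (-L)..L, cut L x * |S.θ x t - 1| * (cut L x * S.ux x t ^ 2)
      ≤ k * (6 * (∫ y in (-L)..L, S.ux y t ^ 2) + ∫ y in (-L)..L, cut L y ^ 2 * S.uxx y t ^ 2)
      + 1 / (4 * k) * ((∫ y in (-L)..L, cut L y ^ 2 * (S.θ y t - 1) ^ 2)
        * ∫ y in (-L)..L, S.ux y t ^ 2) := by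
  have hLL : -L ≤ L := by linarith
  have h3 := cut_fourth_le hL (fun x => S.hasDeriv_ux x t) (by fun_prop)
  set Y := ∫ y in (-L)..L, cut L y ^ 2 * (S.θ y t - 1) ^ 2 with hY
  set D := ∫ y in (-L)..L, cut L y ^ 2 * S.uxx y t ^ 2
  set U := ∫ y in (-L)..L, S.ux y t ^ 2
  have hY0 : 0 ≤ Y := intervalIntegral.integral_nonneg hLL fun x _ => by positivity
  have hD0 : 0 ≤ D := intervalIntegral.integral_nonneg hLL fun x _ => by positivity
  have hU0 : 0 ≤ U := intervalIntegral.integral_nonneg hLL fun x _ => by positivity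
  have h1 := sq_integral_mul_le (f := fun x => cut L x * |S.θ x t - 1|)
    (g := fun x => cut L x * S.ux x t ^ 2) hLL (by fun_prop) (by fun_prop)
  have h2 : ∫ x in (-L)..L, (cut L x * |S.θ x t - 1|) ^ 2 = Y :=
    intervalIntegral.integral_congr fun x _ => by
      rw [mul_pow, sq_abs]
  have h4 : ∫ x in (-L)..L, (cut L x * S.ux x t ^ 2) ^ 2
      = ∫ x in (-L)..L, cut L x ^ 2 * S.ux x t ^ 4 :=
    intervalIntegral.integral_congr fun x _ => by ring
  rw [h2, h4] at h1
  refine le_young_of_sq_le (by positivity) (by positivity) hk (h1.trans ?_)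
  have := mul_le_mul_of_nonneg_left h3 hY0
  linarith

/-- The sum of the fourth powers of the gradients of the transverse fields. -/
def quartic (S : MHDFlow α β T) (L x t : ℝ) : ℝ :=
  cut L x ^ 2 * S.wx 0 x t ^ 4 + cut L x ^ 2 * S.wx 1 x t ^ 4
        + cut L x ^ 2 * S.bx 0 x t ^ 4 + cut L x ^ 2 * S.bx 1 x t ^ 4

@[fun_prop] theorem continuous_quartic {X : Type*} [TopologicalSpace X] {L : ℝ} {f g : X → ℝ}
    (hf : Continuous f) (hg : Continuous g) :
    Continuous fun x => S.quartic L (f x) (g x) := by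
  unfold quartic; fun_prop

theorem GradientBound.integral2_quartic_le (hG : S.GradientBound V) {L t : ℝ} (hL : 1 ≤ L)
    (ht : t ∈ Icc 0 T) :
    ∫ s in (0:ℝ)..t, ∫ x in (-L)..L, S.quartic L x s ≤ 4 * V := by
  have hc : ∀ i, (Continuous fun s => ∫ x in (-L)..L, cut L x ^ 2 * S.wx i x s ^ 4)
      ∧ Continuous fun s => ∫ x in (-L)..L, cut L x ^ 2 * S.bx i x s ^ 4 := fun i =>
    ⟨continuous_slice_integral (f := fun x s => cut L x ^ 2 * S.wx i x s ^ 4) (by fun_prop) _ _,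
      continuous_slice_integral (f := fun x s => cut L x ^ 2 * S.bx i x s ^ 4) (by fun_prop) _ _⟩
  have h := integral_le_lin4 (f := fun s => ∫ x in (-L)..L, S.quartic L x s) 1 1 1 1 ht.1
    (continuous_slice_integral (f := fun x s => S.quartic L x s) (by fun_prop) _ _)
    (hc 0).1 (hc 1).1 (hc 0).2 (hc 1).2 fun s _ => by
      have := integral_le_lin4 (f := fun x => S.quartic L x s) 1 1 1 1 (by linarith : -L ≤ L)
        (g₁ := fun x => cut L x ^ 2 * S.wx 0 x s ^ 4) (g₂ := fun x => cut L x ^ 2 * S.wx 1 x s ^ 4)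
        (g₃ := fun x => cut L x ^ 2 * S.bx 0 x s ^ 4) (g₄ := fun x => cut L x ^ 2 * S.bx 1 x s ^ 4)
        (by fun_prop) (by fun_prop) (by fun_prop) (by fun_prop) (by fun_prop) fun x _ => by
          unfold quartic; linarith
      exact this
  linarith [hG.wx_le 0 L hL t ht, hG.wx_le 1 L hL t ht, hG.bx_le 0 L hL t ht,
    hG.bx_le 1 L hL t ht]

theorem BasicBound.temp_rate_le (hB : S.BasicBound M) (hα : 0 ≤ α) (hβ : 0 < β) {L t κ e : ℝ}
    (hL : 1 ≤ L) (ht : t ∈ Icc 0 T) (hκ : κ = (1 / M) ^ β * (1 / M)) (he : 0 < e)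
    (herr : ∫ x in (-L)..L, S.tempError x t ≤ L) :
    ∫ x in (-L)..L, cut L x ^ 2 * (2 * (S.θ x t - 1) * S.θt x t)
      ≤ -(3 / 4 * κ) * (∫ x in (-L)..L, cut L x ^ 2 * S.θx x t ^ 2) + (1 + κ / 4)
        + (M + 6 * e) * (∫ x in (-L)..L, S.ux x t ^ 2)
        + e * (∫ x in (-L)..L, cut L x ^ 2 * S.uxx x t ^ 2)
        + M * (∫ x in (-L)..L, S.quartic L x t)
        + (κ / 2 + 5 * M + (4 * M ^ 2 / κ + M ^ 4 / e) * ∫ x in (-L)..L, S.ux x t ^ 2)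
          * ∫ x in (-L)..L, cut L x ^ 2 * (S.θ x t - 1) ^ 2 := by
  have hM := hB.one_le
  have hM0 : 0 < M := by linarith
  have hL0 : 0 < L := by linarith
  have hLL : -L ≤ L := by linarith
  have hκ0 : 0 < κ := by rw [hκ]; positivity
  have hZ1 := S.integral_cut_temp_sq_mul_abs_le (t := t) (k := κ / (8 * M)) hL (by positivity) herr
  have hZ2 := S.integral_cut_abs_temp_mul_le (t := t) (k := e / (2 * M ^ 2)) hL (by positivity)
  rw [S.integral_cut_temp_mul_θt hL]
  have h1 := integral_le_lin4
    (f := fun x => -2 * (2 * cut L x * cutd L x * ((S.θ x t - 1) * S.heatFlux x t))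
      - 2 * (cut L x ^ 2 * (S.θx x t * S.heatFlux x t))
      - 2 * (cut L x ^ 2 * ((S.θ x t - 1) * (S.θ x t * S.iv x t * S.ux x t)))
      + 2 * (cut L x ^ 2 * ((S.θ x t - 1) * (S.heating x t * S.iv x t))))
    (g₁ := fun x => cut L x ^ 2 * S.θx x t ^ 2) (g₂ := fun x => S.tempError x t)
    (g₃ := fun x => cut L x * (S.θ x t - 1) * (cut L x * (S.θ x t - 1) * |S.ux x t|))
    (g₄ := fun x => (5 * M * (cut L x ^ 2 * (S.θ x t - 1) ^ 2) + M * S.ux x t ^ 2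
      + M * S.quartic L x t) + 2 * M ^ 2 * (cut L x * |S.θ x t - 1| * (cut L x * S.ux x t ^ 2)))
    (-κ) (1 / L) (2 * M) 1 hLL
    (by fun_prop) (by fun_prop) (by fun_prop) (by fun_prop) (by fun_prop) fun x hx => by
      have := temp_pointwise_le hB hα hβ hL hx ht
      rw [hκ]
      unfold quartic
      linarith
  have h2 := integral_le_lin4
    (f := fun x => (5 * M * (cut L x ^ 2 * (S.θ x t - 1) ^ 2) + M * S.ux x t ^ 2
      + M * S.quartic L x t) + 2 * M ^ 2 * (cut L x * |S.θ x t - 1| * (cut L x * S.ux x t ^ 2)))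
    (g₁ := fun x => cut L x ^ 2 * (S.θ x t - 1) ^ 2) (g₂ := fun x => S.ux x t ^ 2)
    (g₃ := fun x => S.quartic L x t)
    (g₄ := fun x => cut L x * |S.θ x t - 1| * (cut L x * S.ux x t ^ 2))
    (5 * M) M M (2 * M ^ 2) hLL
    (by fun_prop) (by fun_prop) (by fun_prop) (by fun_prop) (by fun_prop) fun x _ => le_rfl
  have h3 : 1 / L * ∫ x in (-L)..L, S.tempError x t ≤ 1 := by
    rw [one_div_mul_eq_div, div_le_one hL0]; exact herr
  set Y := ∫ y in (-L)..L, cut L y ^ 2 * (S.θ y t - 1) ^ 2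
  set G := ∫ y in (-L)..L, cut L y ^ 2 * S.θx y t ^ 2
  set U := ∫ y in (-L)..L, S.ux y t ^ 2
  set D := ∫ y in (-L)..L, cut L y ^ 2 * S.uxx y t ^ 2
  have h4 := mul_le_mul_of_nonneg_left hZ1 (by positivity : 0 ≤ 2 * M)
  have h5 := mul_le_mul_of_nonneg_left hZ2 (by positivity : 0 ≤ 2 * M ^ 2)
  have e1 : 2 * M * (κ / (8 * M)) = κ / 4 := by field_simp; norm_num
  have e2 : 2 * M * (1 / (4 * (κ / (8 * M)))) = 4 * M ^ 2 / κ := by field_simp; norm_num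
  have e3 : 2 * M ^ 2 * (e / (2 * M ^ 2)) = e := by field_simp
  have e4 : 2 * M ^ 2 * (1 / (4 * (e / (2 * M ^ 2)))) = M ^ 4 / e := by field_simp; norm_num
  linear_combination h1 + h2 + h3 + h4 + h5 + (2 * Y + G + 1) * e1 + Y * U * e2
    + (6 * U + D) * e3 + Y * U * e4

/-- The constant bounding the square of the pressure gradient. -/
def pressConst (M V : ℝ) : ℝ := 3 * M ^ 2 + 24 * M ^ 4 * V + 3 * V

/-- The constant in the conditional estimate for the velocity gradient. -/
def velConst (M V T : ℝ) : ℝ :=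
  M + parabolicConst (2 * M ^ 3 + V) * M
    + parabolicConst (2 * M ^ 3 + V) * pressConst M V * (T + M + 1)

theorem velConst_pos (hM : 1 ≤ M) (hV : 1 ≤ V) (hT : 0 < T) : 0 < velConst M V T := by
  have := parabolicConst_pos (by positivity : 0 < 2 * M ^ 3 + V)
  unfold velConst pressConst
  positivity

theorem BasicBound.integral2_cut_pressx_sq_le (hB : S.BasicBound M) (hα : 0 ≤ α)
    (hG : S.GradientBound V) {L t : ℝ} (hL : 1 ≤ L) (ht : t ∈ Icc 0 T)
    (herr : ∀ t ∈ Icc 0 T, ∫ x in (-L)..L, S.tempError x t ≤ L) :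
    ∫ s in (0:ℝ)..t, ∫ x in (-L)..L, cut L x ^ 2 * (-S.pressx x s) ^ 2
      ≤ pressConst M V * ((∫ s in (0:ℝ)..t, ∫ y in (-L)..L, cut L y ^ 2 * S.θx y s ^ 2)
          + (∫ s in (0:ℝ)..t, ∫ y in (-L)..L, cut L y ^ 2 * (S.θ y s - 1) ^ 2) + M + T) := by
  have hM := hB.one_le
  have hV := hG.one_le
  have hc : 0 < pressConst M V := by unfold pressConst; positivity
  have h1 := integral_le_lin4
    (f := fun s => ∫ x in (-L)..L, cut L x ^ 2 * (-S.pressx x s) ^ 2)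
    (g₁ := fun s => ∫ x in (-L)..L, cut L x ^ 2 * S.θx x s ^ 2)
    (g₂ := fun s => ∫ x in (-L)..L, cut L x ^ 2 * (S.θ x s - 1) ^ 2)
    (g₃ := fun s => ∫ x in (-L)..L, S.heating x s) (g₄ := fun _ => 1)
    (pressConst M V) (pressConst M V) (pressConst M V) (pressConst M V) ht.1
    (continuous_slice_integral (f := fun x s => cut L x ^ 2 * (-S.pressx x s) ^ 2)
      (by fun_prop) _ _)
    (continuous_slice_integral (f := fun x s => cut L x ^ 2 * S.θx x s ^ 2) (by fun_prop) _ _)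
    (continuous_slice_integral (f := fun x s => cut L x ^ 2 * (S.θ x s - 1) ^ 2)
      (by fun_prop) _ _)
    (continuous_slice_integral (f := fun x s => S.heating x s) (by fun_prop) _ _)
    continuous_const fun s hs => by
      have hsT : s ∈ Icc 0 T := ⟨hs.1, hs.2.trans ht.2⟩
      have := hB.cut_pressx_sq_le hα hG hL hsT (herr s hsT)
      unfold pressConst
      linarith
  have h2 : ∫ s in (0:ℝ)..t, (1:ℝ) = t := by simp
  rw [h2] at h1
  have h3 := mul_le_mul_of_nonneg_left (hB.heating_le t ht (-L) L (by linarith)) hc.le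
  have h4 := mul_le_mul_of_nonneg_left ht.2 hc.le
  linarith

theorem BasicBound.cut_ux_sq_le (hB : S.BasicBound M) (hα : 0 ≤ α) (hT : 0 < T)
    (hG : S.GradientBound V) {L t : ℝ} (hL : 1 ≤ L) (ht : t ∈ Icc 0 T)
    (herr : ∀ t ∈ Icc 0 T, ∫ x in (-L)..L, S.tempError x t ≤ L) :
    (∫ x in (-L)..L, cut L x ^ 2 * S.ux x t ^ 2) + 1 / (2 * M ^ 3 + V)
      * (∫ s in (0:ℝ)..t, ∫ x in (-L)..L, cut L x ^ 2 * S.uxx x s ^ 2)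
      ≤ velConst M V T * (1 + (∫ s in (0:ℝ)..t, ∫ y in (-L)..L, cut L y ^ 2 * S.θx y s ^ 2)
          + ∫ s in (0:ℝ)..t, ∫ y in (-L)..L, cut L y ^ 2 * (S.θ y s - 1) ^ 2) := by
  have hM := hB.one_le
  have hV := hG.one_le
  have hLL : -L ≤ L := by linarith
  have hM3 : 1 ≤ M ^ 3 := one_le_pow₀ hM
  have hA0 := parabolicConst_pos (by linarith : 0 < 2 * M ^ 3 + V)
  have h1 := parabolic_estimate (N := 2 * M ^ 3 + V) (f := S.u) (fx := S.ux) (fxx := S.uxx)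
    (ft := S.ut) (p := fun x s => S.mu x s * S.iv x s)
    (r := fun x s => S.dmu x s * S.iv x s - S.mu x s * S.iv x s ^ 2) (q := S.vx)
    (g := fun x s => -S.pressx x s) (by linarith) hL
    (by fun_prop) (by fun_prop) (by fun_prop) (by fun_prop) (by fun_prop) (by fun_prop)
    (by fun_prop) (by fun_prop) (fun x s => S.hasDeriv_u x s) (fun x s => S.hasDeriv_ux x s)
    (fun x s hs => S.hasTDeriv_u x s hs)
    (fun x s => by rw [S.ut_eq]; unfold pressx; ring)
    (fun x s hs => (hB.u_equation_coeff hα (by linarith) x hs).1)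
    (fun x s hs => (hB.u_equation_coeff hα (by linarith) x hs).2)
    (fun s hs => (hG.vx_le s hs _ _ hLL).trans (by linarith)) ht
  have h2 := hB.integral2_cut_pressx_sq_le hα hG hL ht herr
  have h3 : ∫ x in (-L)..L, S.ux x 0 ^ 2 ≤ M :=
    hB.integral_init_le (by fun_prop) (fun x => by
      linarith [S.sq_le_initDensity 0 x, sq_nonneg (S.θ x 0 - 1), sq_nonneg (S.wx 0 x 0),
        sq_nonneg (S.bx 0 x 0)]) hLL
  have h4 : ∫ s in (0:ℝ)..t, ∫ x in (-L)..L, S.ux x s ^ 2 ≤ M :=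
    hB.integral2_heating_le (f := fun x s => S.ux x s ^ 2) (by fun_prop) (fun x s => by
      linarith [S.sq_le_heating hα 0 x s, sq_nonneg (S.bx 0 x s), sq_nonneg (S.wx 0 x s)]) hLL ht
  have hY0 : 0 ≤ ∫ s in (0:ℝ)..t, ∫ y in (-L)..L, cut L y ^ 2 * (S.θ y s - 1) ^ 2 :=
    intervalIntegral.integral_nonneg ht.1 fun s _ =>
      intervalIntegral.integral_nonneg hLL fun x _ => by positivity
  have hG0 : 0 ≤ ∫ s in (0:ℝ)..t, ∫ y in (-L)..L, cut L y ^ 2 * S.θx y s ^ 2 :=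
    intervalIntegral.integral_nonneg ht.1 fun s _ =>
      intervalIntegral.integral_nonneg hLL fun x _ => by positivity
  set IY := ∫ s in (0:ℝ)..t, ∫ y in (-L)..L, cut L y ^ 2 * (S.θ y s - 1) ^ 2
  set IG := ∫ s in (0:ℝ)..t, ∫ y in (-L)..L, cut L y ^ 2 * S.θx y s ^ 2
  set A := parabolicConst (2 * M ^ 3 + V) with hA
  have hc : 0 < pressConst M V := by unfold pressConst; positivity
  have h5 := mul_le_mul_of_nonneg_left h2 hA0.le
  have h6 := mul_le_mul_of_nonneg_left h4 hA0.le
  have h7 : 0 ≤ (M + A * M + A * pressConst M V * (T + M)) * (IG + IY) := by positivity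
  have h8 : 0 ≤ A * pressConst M V := by positivity
  unfold velConst
  linarith

end MHDFlow

namespace MHDFlow

variable {α β T : ℝ} {S : MHDFlow α β T} {M V : ℝ}

theorem exists_cut_temp_sq_le (α β T M V : ℝ) (hα : 0 ≤ α) (hβ : 0 < β) (hT : 0 < T)
    (hM : 1 ≤ M) (hV : 1 ≤ V) :
    ∃ R, 0 ≤ R ∧ ∀ S : MHDFlow α β T, S.BasicBound M → S.GradientBound V → ∀ L, 1 ≤ L →
      (∀ t ∈ Icc 0 T, ∫ x in (-L)..L, S.tempError x t ≤ L) → ∀ t ∈ Icc 0 T,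
      (∫ x in (-L)..L, cut L x ^ 2 * (S.θ x t - 1) ^ 2)
        + (∫ s in (0:ℝ)..t, ∫ x in (-L)..L, cut L x ^ 2 * S.θx x s ^ 2) ≤ R := by
  obtain ⟨κ, hκ⟩ : ∃ κ : ℝ, κ = (1 / M) ^ β * (1 / M) := ⟨_, rfl⟩
  have hκ0 : 0 < κ := by rw [hκ]; positivity
  have hN0 : 0 < 2 * M ^ 3 + V := by positivity
  obtain ⟨E, hE⟩ : ∃ E : ℝ, E = (2 * M ^ 3 + V) * velConst M V T := ⟨_, rfl⟩
  have hE0 : 0 < E := by rw [hE]; exact mul_pos hN0 (velConst_pos hM hV hT)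
  obtain ⟨e, he⟩ : ∃ e : ℝ, e = κ / (4 * E) := ⟨_, rfl⟩
  have he0 : 0 < e := by rw [he]; positivity
  set c := M + (1 + κ / 4) * T + (M + 6 * e) * M + κ / 4 + 4 * M * V with hc
  have hc0 : 0 < c := by positivity
  set c₄ := 3 / 4 * κ + 5 * M with hc₄
  have hc₄0 : 0 < c₄ := by positivity
  set c₅ := 4 * M ^ 2 / κ + M ^ 4 / e with hc₅
  have hc₅0 : 0 < c₅ := by positivity
  set B := c + (c₄ * T + c₅ * M) * (c * Real.exp (c₄ * T + c₅ * M)) with hB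
  have hB0 : 0 < B := by positivity
  refine ⟨B + 2 / κ * B, by positivity, fun S hS hG L hL herr => ?_⟩
  have hLL : -L ≤ L := by linarith
  set Y : ℝ → ℝ := fun s => ∫ x in (-L)..L, cut L x ^ 2 * (S.θ x s - 1) ^ 2 with hY
  set G : ℝ → ℝ := fun s => ∫ x in (-L)..L, cut L x ^ 2 * S.θx x s ^ 2 with hGd
  set U : ℝ → ℝ := fun s => ∫ x in (-L)..L, S.ux x s ^ 2 with hU
  set D : ℝ → ℝ := fun s => ∫ x in (-L)..L, cut L x ^ 2 * S.uxx x s ^ 2 with hD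
  set Q : ℝ → ℝ := fun s => ∫ x in (-L)..L, S.quartic L x s with hQ
  have cY : Continuous Y := continuous_slice_integral
    (f := fun x s => cut L x ^ 2 * (S.θ x s - 1) ^ 2) (by fun_prop) _ _
  have cG : Continuous G := continuous_slice_integral
    (f := fun x s => cut L x ^ 2 * S.θx x s ^ 2) (by fun_prop) _ _
  have cU : Continuous U := continuous_slice_integral
    (f := fun x s => S.ux x s ^ 2) (by fun_prop) _ _
  have cD : Continuous D := continuous_slice_integral
    (f := fun x s => cut L x ^ 2 * S.uxx x s ^ 2) (by fun_prop) _ _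
  have cQ : Continuous Q := continuous_slice_integral
    (f := fun x s => S.quartic L x s) (by fun_prop) _ _
  have hY0 : ∀ s, 0 ≤ Y s := fun s => intervalIntegral.integral_nonneg hLL fun x _ => by positivity
  have hG0 : ∀ s, 0 ≤ G s := fun s => intervalIntegral.integral_nonneg hLL fun x _ => by positivity
  have hU0 : ∀ s, 0 ≤ U s := fun s => intervalIntegral.integral_nonneg hLL fun x _ => by positivity
  have hU2 : ∀ r ∈ Icc 0 T, ∫ s in (0:ℝ)..r, U s ≤ M := fun r hr =>
    hS.integral2_heating_le (f := fun x s => S.ux x s ^ 2) (by fun_prop) (fun x s => by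
      linarith [S.sq_le_heating hα 0 x s, sq_nonneg (S.bx 0 x s), sq_nonneg (S.wx 0 x s)]) hLL hr
  have hIG0 : ∀ r ∈ Icc 0 T, 0 ≤ ∫ s in (0:ℝ)..r, G s := fun r hr =>
    intervalIntegral.integral_nonneg hr.1 fun s _ => hG0 s
  have hYinit : Y 0 ≤ M := le_trans (integral_le_of_cont hLL (by fun_prop) (by fun_prop)
    fun x hx => cut_sq_mul_le hL hx (sq_nonneg (S.θ x 0 - 1)))
    (hS.integral_init_le (f := fun x => (S.θ x 0 - 1) ^ 2) (by fun_prop) (fun x => by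
      linarith [S.sq_le_initDensity 0 x, sq_nonneg (S.ux x 0), sq_nonneg (S.wx 0 x 0),
        sq_nonneg (S.bx 0 x 0)]) hLL)
  have hest : ∀ r ∈ Icc 0 T, Y r + κ / 2 * (∫ s in (0:ℝ)..r, G s)
      ≤ c + ∫ s in (0:ℝ)..r, (c₄ + c₅ * U s) * Y s := by
    intro r hr
    have h1 : Y r = Y 0 + ∫ s in (0:ℝ)..r, ∫ x in (-L)..L,
        cut L x ^ 2 * (2 * (S.θ x s - 1) * S.θt x s) :=
      weighted_evolution (φ := fun x => cut L x ^ 2) (F := fun x s => (S.θ x s - 1) ^ 2)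
        (Ft := fun x s => 2 * (S.θ x s - 1) * S.θt x s) (by fun_prop) (by fun_prop)
        (by fun_prop) (fun x s hs => (((S.hasTDeriv_θ x s hs).sub_const 1).fun_pow 2).congr_deriv
          (by push_cast; ring)) _ _ hr
    have h2 := integral_le_lin4
      (f := fun s => ∫ x in (-L)..L, cut L x ^ 2 * (2 * (S.θ x s - 1) * S.θt x s))
      (g₁ := fun s => -(3 / 4 * κ) * G s + (1 + κ / 4)) (g₂ := fun s => (M + 6 * e) * U s + e * D s)
      (g₃ := fun s => M * Q s) (g₄ := fun s => (κ / 2 + 5 * M + c₅ * U s) * Y s) 1 1 1 1 hr.1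
      (continuous_slice_integral
        (f := fun x s => cut L x ^ 2 * (2 * (S.θ x s - 1) * S.θt x s)) (by fun_prop) _ _)
      (by fun_prop) (by fun_prop) (by fun_prop) (by fun_prop) fun s hs => by
        have hsT : s ∈ Icc 0 T := ⟨hs.1, hs.2.trans hr.2⟩
        have := hS.temp_rate_le hα hβ hL hsT hκ he0 (herr s hsT)
        linarith
    have h3 := hS.cut_ux_sq_le hα hT hG hL hr herr
    have h4 := hG.integral2_quartic_le hL hr
    have h5 : 0 ≤ ∫ x in (-L)..L, cut L x ^ 2 * S.ux x r ^ 2 :=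
      intervalIntegral.integral_nonneg hLL fun x _ => by positivity
    change _ + _ * (∫ s in (0:ℝ)..r, D s)
      ≤ _ * (1 + (∫ s in (0:ℝ)..r, G s) + ∫ s in (0:ℝ)..r, Y s) at h3
    change ∫ s in (0:ℝ)..r, Q s ≤ _ at h4
    have i1 : ∫ s in (0:ℝ)..r, (-(3 / 4 * κ) * G s + (1 + κ / 4))
        = -(3 / 4 * κ) * (∫ s in (0:ℝ)..r, G s) + (1 + κ / 4) * r := by
      rw [integral_add_cont _ _ (by fun_prop) (by fun_prop), intervalIntegral.integral_const_mul,
        intervalIntegral.integral_const, sub_zero, smul_eq_mul, mul_comm r]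
    have i2 : ∫ s in (0:ℝ)..r, ((M + 6 * e) * U s + e * D s)
        = (M + 6 * e) * (∫ s in (0:ℝ)..r, U s) + e * ∫ s in (0:ℝ)..r, D s := by
      rw [integral_add_cont _ _ (by fun_prop) (by fun_prop), intervalIntegral.integral_const_mul,
        intervalIntegral.integral_const_mul]
    have i3 : ∫ s in (0:ℝ)..r, (κ / 2 + 5 * M + c₅ * U s) * Y s
        = (∫ s in (0:ℝ)..r, (c₄ + c₅ * U s) * Y s) - κ / 4 * ∫ s in (0:ℝ)..r, Y s := by
      rw [← intervalIntegral.integral_const_mul, ← integral_sub_cont _ _ (by fun_prop)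
        (by fun_prop)]
      exact intervalIntegral.integral_congr fun s _ => by rw [hc₄]; ring
    rw [i1, i2, i3, intervalIntegral.integral_const_mul] at h2
    have h6 : ∫ s in (0:ℝ)..r, D s
        ≤ E * (1 + (∫ s in (0:ℝ)..r, G s) + ∫ s in (0:ℝ)..r, Y s) := by
      rw [hE, mul_assoc, ← div_le_iff₀' hN0]
      rw [one_div_mul_eq_div] at h3
      linarith
    have h7 := mul_le_mul_of_nonneg_left h6 he0.le
    have h8 : e * E = κ / 4 := by rw [he]; field_simp
    have h9 := mul_le_mul_of_nonneg_left (hU2 r hr) (by positivity : 0 ≤ M + 6 * e)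
    have h10 := mul_le_mul_of_nonneg_left hr.2 (by positivity : 0 ≤ 1 + κ / 4)
    have h11 := mul_le_mul_of_nonneg_left h4 (by positivity : 0 ≤ M)
    rw [h1, hc]
    linear_combination h2 + h7 + (1 + (∫ s in (0:ℝ)..r, G s) + ∫ s in (0:ℝ)..r, Y s) * h8
      + h9 + h10 + h11 + hYinit
  have hgr := gronwall_dissipation (y := Y) (A := fun s => c₄ + c₅ * U s)
    (d := fun r => κ / 2 * ∫ s in (0:ℝ)..r, G s) (M := c₄ * T + c₅ * M) cY (by fun_prop)
    (fun s _ => add_nonneg hc₄0.le (mul_nonneg hc₅0.le (hU0 s)))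
    (fun r hr => mul_nonneg (by positivity) (hIG0 r hr)) hc0.le (by
      rw [integral_add_cont _ _ (by fun_prop) (by fun_prop), intervalIntegral.integral_const_mul]
      have := mul_le_mul_of_nonneg_left (hU2 T ⟨hT.le, le_rfl⟩) hc₅0.le
      simp only [intervalIntegral.integral_const, sub_zero, smul_eq_mul]
      linarith) hest
  intro t ht
  have h1 : Y t + κ / 2 * (∫ s in (0:ℝ)..t, G s) ≤ B := hgr t ht
  have h2 := hY0 t
  have h3 : 0 ≤ κ / 2 * (∫ s in (0:ℝ)..t, G s) := mul_nonneg (by positivity) (hIG0 t ht)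
  have h4 : κ / 2 * (∫ s in (0:ℝ)..t, G s) ≤ B := by linarith
  have h5 := mul_le_mul_of_nonneg_left h4 (by positivity : 0 ≤ 2 / κ)
  have h6 : 2 / κ * (κ / 2 * (∫ s in (0:ℝ)..t, G s)) = ∫ s in (0:ℝ)..t, G s := by
    field_simp
  change Y t + (∫ s in (0:ℝ)..t, G s) ≤ _
  linarith

end MHDFlow

namespace MHDFlow

variable {α β T : ℝ} {S : MHDFlow α β T} {M V : ℝ}

theorem BasicBound.cut_ut_slice_le (hB : S.BasicBound M) (hα : 0 ≤ α) (hG : S.GradientBound V)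
    {L t : ℝ} (hL : 1 ≤ L) (ht : t ∈ Icc 0 T) :
    ∫ x in (-L)..L, cut L x ^ 2 * (S.ut x t ^ 2 + S.uxx x t ^ 2)
      ≤ (3 * (2 * M ^ 3 + V) ^ 2 + 1) * (∫ x in (-L)..L, cut L x ^ 2 * S.uxx x t ^ 2)
        + 3 * (2 * M ^ 3 + V) ^ 2 * V * (6 * (∫ x in (-L)..L, S.ux x t ^ 2)
          + ∫ x in (-L)..L, cut L x ^ 2 * S.uxx x t ^ 2)
        + 3 * ∫ x in (-L)..L, cut L x ^ 2 * (-S.pressx x t) ^ 2 := by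
  have hM := hB.one_le
  have hV := hG.one_le
  have hLL : -L ≤ L := by linarith
  obtain ⟨N, hN⟩ : ∃ N, N = 2 * M ^ 3 + V := ⟨_, rfl⟩
  have hN0 : 0 < N := by rw [hN]; positivity
  have hsup := fun x hx => cut_sq_le (x := x) hL hx (fun y => S.hasDeriv_ux y t) (by fun_prop)
  have hU0 : 0 ≤ ∫ x in (-L)..L, S.ux x t ^ 2 :=
    intervalIntegral.integral_nonneg hLL fun x _ => by positivity
  have hD0 : 0 ≤ ∫ x in (-L)..L, cut L x ^ 2 * S.uxx x t ^ 2 :=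
    intervalIntegral.integral_nonneg hLL fun x _ => by positivity
  rw [← hN]
  set P := 6 * (∫ x in (-L)..L, S.ux x t ^ 2) + ∫ x in (-L)..L, cut L x ^ 2 * S.uxx x t ^ 2
  have hP0 : 0 ≤ P := by positivity
  have h1 := integral_le_lin3
    (f := fun x => cut L x ^ 2 * (S.ut x t ^ 2 + S.uxx x t ^ 2))
    (g₁ := fun x => cut L x ^ 2 * S.uxx x t ^ 2) (g₂ := fun x => S.vx x t ^ 2)
    (g₃ := fun x => cut L x ^ 2 * (-S.pressx x t) ^ 2) (3 * N ^ 2 + 1) (3 * N ^ 2 * P) 3 hLL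
    (by fun_prop) (by fun_prop) (by fun_prop) (by fun_prop) fun x hx => by
      obtain ⟨⟨e1, e2⟩, e3⟩ := hB.u_equation_coeff hα (by linarith : 0 ≤ V) x ht
      rw [← hN] at e1 e2 e3
      have e4 : (S.mu x t * S.iv x t) ^ 2 ≤ N ^ 2 :=
        pow_le_pow_left₀ (le_trans (by positivity) e1) e2 2
      have e5 : (S.dmu x t * S.iv x t - S.mu x t * S.iv x t ^ 2) ^ 2 ≤ N ^ 2 :=
        sq_le_sq' (by linarith [abs_le.1 e3]) (abs_le.1 e3).2
      have e6 : S.ut x t = S.mu x t * S.iv x t * S.uxx x t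
          + (S.dmu x t * S.iv x t - S.mu x t * S.iv x t ^ 2) * (S.vx x t * S.ux x t)
          + -S.pressx x t := by rw [S.ut_eq]; unfold pressx; ring
      have e7 : ∀ p q r : ℝ, (p + q + r) ^ 2 ≤ 3 * (p ^ 2 + q ^ 2 + r ^ 2) := fun p q r => by
        linarith [sq_nonneg (p - q), sq_nonneg (p - r), sq_nonneg (q - r)]
      have e8 := mul_le_mul_of_nonneg_left (e7 (S.mu x t * S.iv x t * S.uxx x t)
        ((S.dmu x t * S.iv x t - S.mu x t * S.iv x t ^ 2) * (S.vx x t * S.ux x t))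
        (-S.pressx x t)) (sq_nonneg (cut L x))
      rw [← e6] at e8
      have e9 := mul_le_mul_of_nonneg_right e4
        (by positivity : 0 ≤ cut L x ^ 2 * S.uxx x t ^ 2)
      have e10 := mul_le_mul_of_nonneg_right e5
        (by positivity : 0 ≤ cut L x ^ 2 * (S.vx x t * S.ux x t) ^ 2)
      have e11 := mul_le_mul_of_nonneg_right (hsup x hx)
        (by positivity : 0 ≤ N ^ 2 * S.vx x t ^ 2)
      linear_combination e8 + 3 * e9 + 3 * e10 + 3 * e11
  have h2 := mul_le_mul_of_nonneg_left (hG.vx_le t ht (-L) L hLL)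
    (by positivity : 0 ≤ 3 * N ^ 2 * P)
  linarith

theorem exists_velocity_bound (α β T M V : ℝ) (hα : 0 ≤ α) (hβ : 0 < β) (hT : 0 < T)
    (hM : 1 ≤ M) (hV : 1 ≤ V) :
    ∃ C, 0 < C ∧ ∀ S : MHDFlow α β T, S.BasicBound M → S.GradientBound V → ∀ t ∈ Icc 0 T,
      ∀ a b, a ≤ b → (∫ x in a..b, S.ux x t ^ 2) ≤ C
        ∧ ∫ s in (0:ℝ)..t, ∫ x in a..b, (S.ut x s ^ 2 + S.uxx x s ^ 2) ≤ C := by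
  obtain ⟨R, hR0, hR⟩ := exists_cut_temp_sq_le α β T M V hα hβ hT hM hV
  obtain ⟨N, hN⟩ : ∃ N, N = 2 * M ^ 3 + V := ⟨_, rfl⟩
  have hN0 : 0 < N := by rw [hN]; positivity
  obtain ⟨W, hW⟩ : ∃ W, W = velConst M V T * (1 + R + R * T) := ⟨_, rfl⟩
  have hW0 : 0 < W := by rw [hW]; exact mul_pos (velConst_pos hM hV hT) (by positivity)
  obtain ⟨P, hP⟩ : ∃ P, P = pressConst M V * (R + R * T + M + T) := ⟨_, rfl⟩
  have hpc : 0 < pressConst M V := by unfold pressConst; positivity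
  have hP0 : 0 < P := by rw [hP]; positivity
  obtain ⟨B, hB⟩ : ∃ B, B = (3 * N ^ 2 + 1) * (N * W) + 3 * N ^ 2 * V * (6 * M + N * W) + 3 * P :=
    ⟨_, rfl⟩
  have hB0 : 0 < B := by rw [hB]; positivity
  refine ⟨2 * W + 2 * B, by positivity, fun S hS hG t ht a b hab => ?_⟩
  have key : ∀ᶠ L in atTop, (∫ x in (-L)..L, cut L x ^ 2 * S.ux x t ^ 2 ≤ W)
      ∧ ∫ s in (0:ℝ)..t, ∫ x in (-L)..L, cut L x ^ 2 * (S.ut x s ^ 2 + S.uxx x s ^ 2) ≤ B := by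
    filter_upwards [eventually_ge_atTop 1, S.eventually_tempError_le] with L hL herr
    have hLL : -L ≤ L := by linarith
    have h1 := hR S hS hG L hL herr
    have cY : Continuous fun s => ∫ x in (-L)..L, cut L x ^ 2 * (S.θ x s - 1) ^ 2 :=
      continuous_slice_integral (f := fun x s => cut L x ^ 2 * (S.θ x s - 1) ^ 2) (by fun_prop) _ _
    have hY0 : ∀ s, 0 ≤ ∫ x in (-L)..L, cut L x ^ 2 * (S.θ x s - 1) ^ 2 := fun s =>
      intervalIntegral.integral_nonneg hLL fun x _ => by positivity
    have hG0 : ∀ r ∈ Icc 0 T, 0 ≤ ∫ s in (0:ℝ)..r, ∫ x in (-L)..L, cut L x ^ 2 * S.θx x s ^ 2 :=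
      fun r hr => intervalIntegral.integral_nonneg hr.1 fun s _ =>
        intervalIntegral.integral_nonneg hLL fun x _ => by positivity
    have h2 : ∫ s in (0:ℝ)..t, ∫ x in (-L)..L, cut L x ^ 2 * (S.θ x s - 1) ^ 2 ≤ R * T := by
      have := integral_le_of_cont (g := fun _ => R) ht.1 cY continuous_const fun s hs => by
        have hsT : s ∈ Icc 0 T := ⟨hs.1, hs.2.trans ht.2⟩
        linarith [h1 s hsT, hG0 s hsT]
      rw [intervalIntegral.integral_const, sub_zero, smul_eq_mul] at this
      have := mul_le_mul_of_nonneg_right ht.2 hR0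
      linarith
    have h3 : ∫ s in (0:ℝ)..t, ∫ x in (-L)..L, cut L x ^ 2 * S.θx x s ^ 2 ≤ R := by
      linarith [h1 t ht, hY0 t]
    have h4 := hS.cut_ux_sq_le hα hT hG hL ht herr
    have h5 := hS.integral2_cut_pressx_sq_le hα hG hL ht herr
    have h6 : velConst M V T
        * (1 + (∫ s in (0:ℝ)..t, ∫ y in (-L)..L, cut L y ^ 2 * S.θx y s ^ 2)
          + ∫ s in (0:ℝ)..t, ∫ y in (-L)..L, cut L y ^ 2 * (S.θ y s - 1) ^ 2) ≤ W := by
      rw [hW]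
      exact mul_le_mul_of_nonneg_left (by linarith) (velConst_pos hM hV hT).le
    have h7 : ∫ s in (0:ℝ)..t, ∫ x in (-L)..L, cut L x ^ 2 * (-S.pressx x s) ^ 2 ≤ P := by
      rw [hP]
      exact h5.trans (mul_le_mul_of_nonneg_left (by linarith) hpc.le)
    have h8 := h4.trans h6
    rw [← hN, one_div_mul_eq_div] at h8
    have hD0 : 0 ≤ ∫ s in (0:ℝ)..t, ∫ x in (-L)..L, cut L x ^ 2 * S.uxx x s ^ 2 :=
      intervalIntegral.integral_nonneg ht.1 fun s _ =>
        intervalIntegral.integral_nonneg hLL fun x _ => by positivity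
    have hX0 : 0 ≤ ∫ x in (-L)..L, cut L x ^ 2 * S.ux x t ^ 2 :=
      intervalIntegral.integral_nonneg hLL fun x _ => by positivity
    have h9 : ∫ s in (0:ℝ)..t, ∫ x in (-L)..L, cut L x ^ 2 * S.uxx x s ^ 2 ≤ N * W := by
      rw [← div_le_iff₀' hN0]; linarith
    have hDN := div_nonneg hD0 hN0.le
    refine ⟨by linarith, ?_⟩
    have h10 : ∫ s in (0:ℝ)..t, ∫ x in (-L)..L, S.ux x s ^ 2 ≤ M :=
      hS.integral2_heating_le (f := fun x s => S.ux x s ^ 2) (by fun_prop) (fun x s => by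
        linarith [S.sq_le_heating hα 0 x s, sq_nonneg (S.bx 0 x s), sq_nonneg (S.wx 0 x s)])
        hLL ht
    have h11 := integral_le_lin3
      (f := fun s => ∫ x in (-L)..L, cut L x ^ 2 * (S.ut x s ^ 2 + S.uxx x s ^ 2))
      (g₁ := fun s => ∫ x in (-L)..L, cut L x ^ 2 * S.uxx x s ^ 2)
      (g₂ := fun s => ∫ x in (-L)..L, S.ux x s ^ 2)
      (g₃ := fun s => ∫ x in (-L)..L, cut L x ^ 2 * (-S.pressx x s) ^ 2)
      (3 * N ^ 2 + 1 + 3 * N ^ 2 * V) (18 * N ^ 2 * V) 3 ht.1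
      (continuous_slice_integral
        (f := fun x s => cut L x ^ 2 * (S.ut x s ^ 2 + S.uxx x s ^ 2)) (by fun_prop) _ _)
      (continuous_slice_integral (f := fun x s => cut L x ^ 2 * S.uxx x s ^ 2) (by fun_prop) _ _)
      (continuous_slice_integral (f := fun x s => S.ux x s ^ 2) (by fun_prop) _ _)
      (continuous_slice_integral (f := fun x s => cut L x ^ 2 * (-S.pressx x s) ^ 2)
        (by fun_prop) _ _) fun s hs => by
        have := hS.cut_ut_slice_le hα hG hL ⟨hs.1, hs.2.trans ht.2⟩
        rw [← hN] at this
        linarith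
    have h12 := mul_le_mul_of_nonneg_left h9
      (by positivity : 0 ≤ 3 * N ^ 2 + 1 + 3 * N ^ 2 * V)
    have h13 := mul_le_mul_of_nonneg_left h10 (by positivity : 0 ≤ 18 * N ^ 2 * V)
    rw [hB]
    linarith
  constructor
  · exact (integral_le_of_cut (by fun_prop) (fun _ => sq_nonneg _)
      (key.mono fun L h => h.1) hab).trans (by linarith)
  · exact (integral2_le_of_cut (F := fun x s => S.ut x s ^ 2 + S.uxx x s ^ 2) ht.1 (by fun_prop)
      (fun x s => by positivity) (key.mono fun L h => h.2) hab).trans (by linarith)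

theorem exists_velocity_bound_of_init (α β T K δ : ℝ) (hα : 0 ≤ α) (hβ : 0 < β) (hT : 0 < T)
    (hδ₀ : 0 < δ) (hδ₁ : δ ≤ 1) :
    ∃ C, 0 < C ∧ ∀ S : MHDFlow α β T, S.Init K δ → ∀ t ∈ Icc 0 T,
      ∀ a b, a ≤ b → (∫ x in a..b, S.ux x t ^ 2) ≤ C
        ∧ ∫ s in (0:ℝ)..t, ∫ x in a..b, (S.ut x s ^ 2 + S.uxx x s ^ 2) ≤ C := by
  obtain ⟨M, hM, hbasic⟩ := exists_basicBound α β T K δ hα hβ hT hδ₀ hδ₁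
  obtain ⟨V, hV, hgrad⟩ := exists_gradientBound α β T M hα hT hM
  obtain ⟨C, hC, hvel⟩ := exists_velocity_bound α β T M V hα hβ hT hM hV
  exact ⟨C, hC, fun S hS => hvel S (hbasic S hS) (hgrad S (hbasic S hS))⟩

end MHDFlow

/-! ### From classical solutions to flows defined for all times -/

/-- The nearest point projection of a time onto `[0, T]`. -/
def clamp (T t : ℝ) : ℝ := max 0 (min t T)

@[fun_prop] theorem continuous_clamp (T : ℝ) : Continuous (clamp T) := by
  unfold clamp; fun_prop

theorem clamp_mem {T : ℝ} (hT : 0 < T) (t : ℝ) : clamp T t ∈ Icc 0 T :=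
  ⟨le_max_left _ _, max_le hT.le (min_le_right _ _)⟩

theorem clamp_of_mem {T t : ℝ} (ht : t ∈ Icc 0 T) : clamp T t = t := by
  rw [clamp, min_eq_left ht.2, max_eq_right ht.1]

theorem continuous_comp_clamp {E : Type*} [TopologicalSpace E] {T : ℝ} (hT : 0 < T)
    {f : ℝ → ℝ → E} (hf : ContinuousOn (fun p : ℝ × ℝ => f p.1 p.2) (univ ×ˢ Icc 0 T)) :
    Continuous fun p : ℝ × ℝ => f p.1 (clamp T p.2) :=
  hf.comp_continuous (f := fun p : ℝ × ℝ => (p.1, clamp T p.2)) (by fun_prop)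
    fun p => ⟨mem_univ _, clamp_mem hT p.2⟩

theorem hasDerivAt_comp_clamp {E : Type*} [NormedAddCommGroup E] [NormedSpace ℝ E] {T t x : ℝ}
    {f : ℝ → ℝ → E} (ht : t ∈ Ioo 0 T)
    (hf : DifferentiableWithinAt ℝ (fun s => f x s) (Icc 0 T) t) :
    HasDerivAt (fun s => f x (clamp T s)) (pdt T f x (clamp T t)) t := by
  rw [clamp_of_mem (Ioo_subset_Icc_self ht)]
  refine (hf.hasDerivWithinAt.hasDerivAt (Icc_mem_nhds ht.1 ht.2)).congr_of_eventuallyEq ?_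
  filter_upwards [Icc_mem_nhds ht.1 ht.2] with s hs
  rw [clamp_of_mem hs]

theorem tendsto_comp_clamp {T c : ℝ} (hT : 0 < T) {f : ℝ → ℝ → ℝ}
    (hf : ∀ ε > (0 : ℝ), ∃ M : ℝ, ∀ x : ℝ, ∀ t ∈ Icc (0 : ℝ) T, M ≤ |x| → |f x t - c| < ε) :
    Tendsto (fun p : ℝ × ℝ => f p.1 (clamp T p.2)) spaceInf (nhds c) := by
  rw [Metric.tendsto_nhds]
  intro ε hε
  obtain ⟨M, hM⟩ := hf ε hε
  have h : ∀ᶠ x : ℝ in cocompact ℝ, M ≤ ‖x‖ :=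
    (tendsto_norm_cocompact_atTop (E := ℝ)).eventually_ge_atTop M
  filter_upwards [h.comap Prod.fst] with p hp
  exact hM p.1 _ (clamp_mem hT p.2) hp

/-- The coordinates of a vector of the plane. -/
def coord (i : Fin 2) : ℝ × ℝ →L[ℝ] ℝ :=
  ![ContinuousLinearMap.fst ℝ ℝ ℝ, ContinuousLinearMap.snd ℝ ℝ ℝ] i

theorem coord_zero (p : ℝ × ℝ) : coord 0 p = p.1 := rfl

theorem coord_one (p : ℝ × ℝ) : coord 1 p = p.2 := rfl

theorem abs_coord_le (i : Fin 2) (p : ℝ × ℝ) : |coord i p| ≤ Real.sqrt (sq2 p) := by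
  refine Real.abs_le_sqrt ?_
  unfold sq2
  fin_cases i
  · change p.1 ^ 2 ≤ _
    nlinarith [sq_nonneg p.2]
  · change p.2 ^ 2 ≤ _
    nlinarith [sq_nonneg p.1]

namespace IsClassicalSolution

variable {α β T : ℝ} {v u θ : ℝ → ℝ → ℝ} {w b : ℝ → ℝ → ℝ × ℝ}

theorem momentum (h : IsClassicalSolution α β T v u θ w b) (x : ℝ) {t : ℝ}
    (ht : t ∈ Icc 0 T) :
    pdt T u x t = visc α (v x t) / v x t * pdx (pdx u) x t
      + (dvisc α (v x t) / v x t - visc α (v x t) / v x t ^ 2) * pdx v x t * pdx u x t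
      - pdx θ x t / v x t + θ x t * pdx v x t / v x t ^ 2
      - ((b x t).1 * (pdx b x t).1 + (b x t).2 * (pdx b x t).2) := by
  have hv := h.v_pos x t ht
  have hv0 := hv.ne'
  obtain ⟨dv, du, dθ, dw, db⟩ := h.diff_x x t ht
  obtain ⟨dux, dθx, dwx, dbx⟩ := h.diff_xx x t ht
  have db1 : HasDerivAt (fun y => (b y t).1) (pdx b x t).1 x :=
    (coord 0).hasFDerivAt.comp_hasDerivAt x db.hasDerivAt
  have db2 : HasDerivAt (fun y => (b y t).2) (pdx b x t).2 x :=
    (coord 1).hasFDerivAt.comp_hasDerivAt x db.hasDerivAt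
  have e1 : pdx (fun y s => θ y s / v y s + sq2 (b y s) / 2) x t
      = pdx θ x t / v x t - θ x t * pdx v x t / v x t ^ 2
        + ((b x t).1 * (pdx b x t).1 + (b x t).2 * (pdx b x t).2) := by
    refine ((dθ.hasDerivAt.fun_div dv.hasDerivAt hv0).fun_add
      (((db1.fun_pow 2).fun_add (db2.fun_pow 2)).div_const 2)).deriv.trans ?_
    unfold pdx
    field_simp
    push_cast
    ring
  have e2 : pdx (fun y s => visc α (v y s) * pdx u y s / v y s) x t
      = visc α (v x t) / v x t * pdx (pdx u) x t
      + (dvisc α (v x t) / v x t - visc α (v x t) / v x t ^ 2) * pdx v x t * pdx u x t := by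
    refine (((((hasDerivAt_visc α hv).comp x dv.hasDerivAt).fun_mul dux.hasDerivAt).fun_div
      dv.hasDerivAt hv0)).deriv.trans ?_
    unfold pdx
    simp only [Function.comp]
    field_simp
    ring
  have := h.eq_mom x t ht
  rw [e1, e2] at this
  linarith

theorem pdx_inv_smul (h : IsClassicalSolution α β T v u θ w b) {x t : ℝ} (ht : t ∈ Icc 0 T)
    {f : ℝ → ℝ → ℝ × ℝ} (hf : DifferentiableAt ℝ (fun y => f y t) x) (i : Fin 2) :
    coord i (pdx (fun y s => (v y s)⁻¹ • f y s) x t)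
      = coord i (pdx f x t) / v x t - coord i (f x t) * pdx v x t / v x t ^ 2 := by
  have hv0 := (h.v_pos x t ht).ne'
  have e : pdx (fun y s => (v y s)⁻¹ • f y s) x t
      = (v x t)⁻¹ • pdx f x t + (-pdx v x t / v x t ^ 2) • f x t :=
    (((h.diff_x x t ht).1.hasDerivAt.fun_inv hv0).fun_smul hf.hasDerivAt).deriv
  rw [e, map_add, map_smul, map_smul, smul_eq_mul, smul_eq_mul]
  ring

theorem transverse_velocity (h : IsClassicalSolution α β T v u θ w b) (i : Fin 2) (x : ℝ) {t : ℝ}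
    (ht : t ∈ Icc 0 T) :
    coord i (pdt T w x t) = coord i (pdx b x t) + coord i (pdx (pdx w) x t) / v x t
      - coord i (pdx w x t) * pdx v x t / v x t ^ 2 := by
  have e := congrArg (coord i) (h.eq_w x t ht)
  rw [map_sub, h.pdx_inv_smul ht (h.diff_xx x t ht).2.2.1] at e
  linarith

theorem magnetic_induction (h : IsClassicalSolution α β T v u θ w b) (hT : 0 < T) (i : Fin 2) (x : ℝ)
    {t : ℝ} (ht : t ∈ Icc 0 T) :
    v x t * coord i (pdt T b x t) + pdx u x t * coord i (b x t)
      = coord i (pdx w x t) + coord i (pdx (pdx b) x t) / v x t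
        - coord i (pdx b x t) * pdx v x t / v x t ^ 2 := by
  have e := congrArg (coord i) (h.eq_b x t ht)
  obtain ⟨dv, -, -, -, db⟩ := h.diff_t x t ht
  have hd : pdt T (fun y s => v y s • b y s) x t = v x t • pdt T b x t + pdt T v x t • b x t :=
    (dv.hasDerivWithinAt.fun_smul db.hasDerivWithinAt).derivWithin
      (uniqueDiffOn_Icc hT t ht)
  rw [map_sub, h.pdx_inv_smul ht (h.diff_xx x t ht).2.2.2, hd, h.eq_mass x t ht, map_add,
    map_smul, map_smul, smul_eq_mul, smul_eq_mul] at e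
  linarith

theorem temperature (h : IsClassicalSolution α β T v u θ w b) (x : ℝ) {t : ℝ}
    (ht : t ∈ Icc 0 T) :
    pdt T θ x t = -(θ x t / v x t * pdx u x t)
      + (θ x t ^ β * pdx (pdx θ) x t + β * θ x t ^ (β - 1) * pdx θ x t ^ 2) / v x t
      - θ x t ^ β * pdx θ x t * pdx v x t / v x t ^ 2
      + (visc α (v x t) * pdx u x t ^ 2 + ((pdx w x t).1 ^ 2 + (pdx w x t).2 ^ 2)
        + ((pdx b x t).1 ^ 2 + (pdx b x t).2 ^ 2)) / v x t := by
  have hv0 := (h.v_pos x t ht).ne'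
  have e := h.eq_temp x t ht
  have e1 : pdx (fun y s => θ y s ^ β * pdx θ y s / v y s) x t
      = (θ x t ^ β * pdx (pdx θ) x t + β * θ x t ^ (β - 1) * pdx θ x t ^ 2) / v x t
      - θ x t ^ β * pdx θ x t * pdx v x t / v x t ^ 2 := by
    obtain ⟨dv, -, dθ, -, -⟩ := h.diff_x x t ht
    refine (((dθ.hasDerivAt.rpow_const (p := β) (Or.inl (h.θ_pos x t ht).ne')).fun_mul
      (h.diff_xx x t ht).2.1.hasDerivAt).fun_div dv.hasDerivAt hv0).deriv.trans ?_
    unfold pdx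
    field_simp
    ring
  rw [e1] at e
  unfold sq2 at e
  linarith

end IsClassicalSolution

namespace MHDFlow

variable {α β T : ℝ} {v u θ : ℝ → ℝ → ℝ} {w b : ℝ → ℝ → ℝ × ℝ}

/-- The flow which follows a classical solution on `[0, T]` and is frozen outside. -/
def ofClassical (h : IsClassicalSolution α β T v u θ w b) (hT : 0 < T) : MHDFlow α β T where
  v x t := v x (clamp T t)
  vx x t := pdx v x (clamp T t)
  u x t := u x (clamp T t)
  ux x t := pdx u x (clamp T t)
  uxx x t := pdx (pdx u) x (clamp T t)
  ut x t := pdt T u x (clamp T t)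
  θ x t := θ x (clamp T t)
  θx x t := pdx θ x (clamp T t)
  θxx x t := pdx (pdx θ) x (clamp T t)
  θt x t := pdt T θ x (clamp T t)
  w i x t := coord i (w x (clamp T t))
  wx i x t := coord i (pdx w x (clamp T t))
  wxx i x t := coord i (pdx (pdx w) x (clamp T t))
  wt i x t := coord i (pdt T w x (clamp T t))
  b i x t := coord i (b x (clamp T t))
  bx i x t := coord i (pdx b x (clamp T t))
  bxx i x t := coord i (pdx (pdx b) x (clamp T t))
  bt i x t := coord i (pdt T b x (clamp T t))
  cont_v := continuous_comp_clamp hT h.cont.fst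
  cont_vx := continuous_comp_clamp hT h.cont_dx.fst
  cont_u := continuous_comp_clamp hT h.cont.snd.fst
  cont_ux := continuous_comp_clamp hT h.cont_dx.snd.fst
  cont_uxx := continuous_comp_clamp hT h.cont_dxx.fst
  cont_ut := continuous_comp_clamp hT h.cont_dt.snd.fst
  cont_θ := continuous_comp_clamp hT h.cont.snd.snd.fst
  cont_θx := continuous_comp_clamp hT h.cont_dx.snd.snd.fst
  cont_θxx := continuous_comp_clamp hT h.cont_dxx.snd.fst
  cont_θt := continuous_comp_clamp hT h.cont_dt.snd.snd.fst
  cont_w i := (coord i).continuous.comp (continuous_comp_clamp hT h.cont.snd.snd.snd.fst)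
  cont_wx i := (coord i).continuous.comp (continuous_comp_clamp hT h.cont_dx.snd.snd.snd.fst)
  cont_wxx i := (coord i).continuous.comp (continuous_comp_clamp hT h.cont_dxx.snd.snd.fst)
  cont_wt i := (coord i).continuous.comp (continuous_comp_clamp hT h.cont_dt.snd.snd.snd.fst)
  cont_b i := (coord i).continuous.comp (continuous_comp_clamp hT h.cont.snd.snd.snd.snd)
  cont_bx i := (coord i).continuous.comp (continuous_comp_clamp hT h.cont_dx.snd.snd.snd.snd)
  cont_bxx i := (coord i).continuous.comp (continuous_comp_clamp hT h.cont_dxx.snd.snd.snd)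
  cont_bt i := (coord i).continuous.comp (continuous_comp_clamp hT h.cont_dt.snd.snd.snd.snd)
  hasDeriv_v x t := (h.diff_x x _ (clamp_mem hT t)).1.hasDerivAt
  hasDeriv_u x t := (h.diff_x x _ (clamp_mem hT t)).2.1.hasDerivAt
  hasDeriv_ux x t := (h.diff_xx x _ (clamp_mem hT t)).1.hasDerivAt
  hasDeriv_θ x t := (h.diff_x x _ (clamp_mem hT t)).2.2.1.hasDerivAt
  hasDeriv_θx x t := (h.diff_xx x _ (clamp_mem hT t)).2.1.hasDerivAt
  hasDeriv_w i x t := (coord i).hasFDerivAt.comp_hasDerivAt x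
    (h.diff_x x _ (clamp_mem hT t)).2.2.2.1.hasDerivAt
  hasDeriv_wx i x t := (coord i).hasFDerivAt.comp_hasDerivAt x
    (h.diff_xx x _ (clamp_mem hT t)).2.2.1.hasDerivAt
  hasDeriv_b i x t := (coord i).hasFDerivAt.comp_hasDerivAt x
    (h.diff_x x _ (clamp_mem hT t)).2.2.2.2.hasDerivAt
  hasDeriv_bx i x t := (coord i).hasFDerivAt.comp_hasDerivAt x
    (h.diff_xx x _ (clamp_mem hT t)).2.2.2.hasDerivAt
  hasTDeriv_v x t ht := (hasDerivAt_comp_clamp ht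
    (h.diff_t x t (Ioo_subset_Icc_self ht)).1).congr_deriv (h.eq_mass x _ (clamp_mem hT t))
  hasTDeriv_u x t ht := hasDerivAt_comp_clamp ht (h.diff_t x t (Ioo_subset_Icc_self ht)).2.1
  hasTDeriv_θ x t ht := hasDerivAt_comp_clamp ht (h.diff_t x t (Ioo_subset_Icc_self ht)).2.2.1
  hasTDeriv_w i x t ht := (coord i).hasFDerivAt.comp_hasDerivAt t
    (hasDerivAt_comp_clamp ht (h.diff_t x t (Ioo_subset_Icc_self ht)).2.2.2.1)
  hasTDeriv_b i x t ht := (coord i).hasFDerivAt.comp_hasDerivAt t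
    (hasDerivAt_comp_clamp ht (h.diff_t x t (Ioo_subset_Icc_self ht)).2.2.2.2)
  v_pos x t := h.v_pos x _ (clamp_mem hT t)
  θ_pos x t := h.θ_pos x _ (clamp_mem hT t)
  lim_v := tendsto_comp_clamp hT fun ε hε => (h.farfield ε hε).imp
    fun _ hM x t ht hx => (hM x t ht hx).1
  lim_u := tendsto_comp_clamp hT fun ε hε => (h.farfield ε hε).imp
    fun _ hM x t ht hx => by simpa using (hM x t ht hx).2.1
  lim_θ := tendsto_comp_clamp hT fun ε hε => (h.farfield ε hε).imp
    fun _ hM x t ht hx => (hM x t ht hx).2.2.1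
  lim_w i := tendsto_comp_clamp (f := fun x t => coord i (w x t)) hT fun ε hε =>
    (h.farfield ε hε).imp fun _ hM x t ht hx => by
      rw [sub_zero]
      exact (abs_coord_le i _).trans_lt (hM x t ht hx).2.2.2.2
  lim_b i := tendsto_comp_clamp (f := fun x t => coord i (b x t)) hT fun ε hε =>
    (h.farfield ε hε).imp fun _ hM x t ht hx => by
      rw [sub_zero]
      exact (abs_coord_le i _).trans_lt (hM x t ht hx).2.2.2.1
  eq_u x t := h.momentum x (clamp_mem hT t)
  eq_w i x t := h.transverse_velocity i x (clamp_mem hT t)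
  eq_b i x t := h.magnetic_induction hT i x (clamp_mem hT t)
  eq_θ x t := h.temperature x (clamp_mem hT t)

theorem init_ofClassical {K δ : ℝ} (h : IsClassicalSolution α β T v u θ w b) (hT : 0 < T)
    (ha : Admissible K δ v u θ w b) : (ofClassical h hT).Init K δ := by
  have h0 : (0 : ℝ) ∈ Icc 0 T := ⟨le_rfl, hT.le⟩
  have hc : clamp T 0 = 0 := clamp_of_mem h0
  obtain ⟨hnorm, hv, hθ⟩ := ha
  refine ⟨fun x y hxy => ?_, fun x => ?_, fun x => ?_⟩
  · obtain ⟨i1, i2, i3, i4, i5, i6, i7, i8, i9, i10⟩ := h.sq_int 0 h0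
    have hi := ((((((((i1.add i2).add i3).add i4).add i5).add i6).add i7).add i8).add i9).add i10
    rw [intervalIntegral.integral_of_le hxy]
    have he : (ofClassical h hT).initDensity = fun x => ((v x 0 - 1) ^ 2 + (u x 0) ^ 2
        + (θ x 0 - 1) ^ 2 + sq2 (b x 0) + sq2 (w x 0) + (pdx v x 0) ^ 2 + (pdx u x 0) ^ 2
        + (pdx θ x 0) ^ 2 + sq2 (pdx b x 0) + sq2 (pdx w x 0)) := by
      funext x
      simp only [initDensity, ofClassical, hc, coord_zero, coord_one, sq2]
    rw [he]
    refine (setIntegral_le_integral hi (Eventually.of_forall fun x => ?_)).trans hnorm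
    simp only [Pi.zero_apply, Pi.add_apply, sq2]
    positivity
  · change δ ≤ v x (clamp T 0)
    rw [hc]
    exact hv x
  · change δ ≤ θ x (clamp T 0)
    rw [hc]
    exact hθ x

end MHDFlow

/-! ### Passage to integrals over the whole line -/

theorem integral_le_of_intervals {f : ℝ → ℝ} {C : ℝ} (hf : Integrable f)
    (h : ∀ a b, a ≤ b → ∫ x in a..b, f x ≤ C) : ∫ x, f x ≤ C := by
  refine le_of_tendsto (intervalIntegral_tendsto_integral hf tendsto_neg_atTop_atBot tendsto_id) ?_
  filter_upwards [eventually_ge_atTop 0] with L hL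
  exact h _ _ (neg_le_self hL)

theorem integral2_le_of_intervals {f : ℝ → ℝ → ℝ} {T C : ℝ} (hT : 0 ≤ T) (hC : 0 ≤ C)
    (hf : Continuous fun p : ℝ × ℝ => f p.1 p.2) (h0 : ∀ x t, 0 ≤ f x t)
    (h : ∀ a b, a ≤ b → ∫ s in (0 : ℝ)..T, ∫ x in a..b, f x s ≤ C) :
    ∫ s in (0 : ℝ)..T, ∫ x, f x s ≤ C := by
  have hm : Measurable fun p : ℝ × ℝ => ENNReal.ofReal (f p.2 p.1) :=
    (ENNReal.continuous_ofReal.comp (hf.comp continuous_swap)).measurable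
  have hmono : Monotone fun n : ℕ => Ioc (-(n : ℝ)) n := fun m n hmn => by
    have : (m : ℝ) ≤ n := by exact_mod_cast hmn
    exact Ioc_subset_Ioc (neg_le_neg this) this
  have hU : ⋃ n : ℕ, Ioc (-(n : ℝ)) n = univ := by
    refine eq_univ_of_forall fun x => mem_iUnion.2 ?_
    obtain ⟨n, hn⟩ := exists_nat_gt |x|
    exact ⟨n, (abs_lt.1 hn).1, (abs_lt.1 hn).2.le⟩
  have hslice (s : ℝ) : ∫⁻ x, ENNReal.ofReal (f x s)
      = ⨆ n : ℕ, ∫⁻ x in Ioc (-(n : ℝ)) n, ENNReal.ofReal (f x s) := by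
    rw [← setLIntegral_univ, ← hU, setLIntegral_iUnion_of_directed _ hmono.directed_le]
  have hfin (n : ℕ) (s : ℝ) : ∫⁻ x in Ioc (-(n : ℝ)) n, ENNReal.ofReal (f x s)
      = ENNReal.ofReal (∫ x in (-(n : ℝ))..n, f x s) := by
    have hc : Continuous fun x => f x s := hf.comp (continuous_id.prodMk continuous_const)
    rw [intervalIntegral.integral_of_le (neg_le_self n.cast_nonneg),
      ofReal_integral_eq_lintegral_ofReal (hc.integrableOn_Ioc)
        (Eventually.of_forall fun x => h0 x s)]
  have hdouble : ∫⁻ s in Ioc 0 T, ∫⁻ x, ENNReal.ofReal (f x s) ≤ ENNReal.ofReal C := by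
    simp_rw [hslice]
    rw [lintegral_iSup (fun n => hm.lintegral_prod_right')
      fun m n hmn s => lintegral_mono_set (hmono hmn)]
    refine iSup_le fun n => ?_
    simp_rw [hfin]
    have hc : Continuous fun s => ∫ x in (-(n : ℝ))..n, f x s := continuous_slice_integral hf _ _
    have hn : -(n : ℝ) ≤ n := neg_le_self n.cast_nonneg
    rw [← ofReal_integral_eq_lintegral_ofReal hc.integrableOn_Ioc
      (Eventually.of_forall fun s => integral_nonneg_of_cont hn fun x _ => h0 x s),
      ← intervalIntegral.integral_of_le hT]
    exact ENNReal.ofReal_le_ofReal (h _ _ hn)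
  have hJ (s : ℝ) : ENNReal.ofReal (∫ x, f x s) ≤ ∫⁻ x, ENNReal.ofReal (f x s) := by
    by_cases hi : Integrable fun x => f x s
    · rw [ofReal_integral_eq_lintegral_ofReal hi (Eventually.of_forall fun x => h0 x s)]
    · rw [integral_undef hi, ENNReal.ofReal_zero]
      exact zero_le
  rw [intervalIntegral.integral_of_le hT]
  by_cases hi : IntegrableOn (fun s => ∫ x, f x s) (Ioc 0 T)
  · rw [← ENNReal.ofReal_le_ofReal_iff hC, ofReal_integral_eq_lintegral_ofReal hi
      (Eventually.of_forall fun s => integral_nonneg fun x => h0 x s)]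
    exact (lintegral_mono fun s => hJ s).trans hdouble
  · rw [integral_undef hi]
    exact hC

/-- Lemma 2.7 of the paper: first-order energy estimate for `u`. -/
theorem u_higher_order_bound (α β T K δ : ℝ) (hα : 0 ≤ α) (hβ : 0 < β) (hT : 0 < T)
    (hK : 0 < K) (hδ₀ : 0 < δ) (hδ₁ : δ ≤ 1) :
    ∃ C : ℝ, 0 < C ∧
      ∀ (v u θ : ℝ → ℝ → ℝ) (w b : ℝ → ℝ → ℝ × ℝ),
        IsClassicalSolution α β T v u θ w b → Admissible K δ v u θ w b →
        ∀ t ∈ Icc (0:ℝ) T,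
          (∫ x : ℝ, (pdx u x t) ^ 2)
            + (∫ s in (0:ℝ)..T, ∫ x : ℝ,
                ((pdt T u x s) ^ 2 + (pdx (pdx u) x s) ^ 2)) ≤ C := by
  obtain ⟨C, hC, hbound⟩ := MHDFlow.exists_velocity_bound_of_init α β T K δ hα hβ hT hδ₀ hδ₁
  refine ⟨2 * C, by positivity, fun v u θ w b h ha t ht => ?_⟩
  have key := hbound (MHDFlow.ofClassical h hT) (MHDFlow.init_ofClassical h hT ha)
  have h1 : ∫ x : ℝ, (pdx u x t) ^ 2 ≤ C := by
    obtain ⟨-, -, -, -, -, -, hi, -⟩ := h.sq_int t ht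
    refine integral_le_of_intervals hi fun a b hab => ?_
    have e : ∫ x in a..b, pdx u x (clamp T t) ^ 2 ≤ C := (key t ht a b hab).1
    rwa [clamp_of_mem ht] at e
  have h2 : ∫ s in (0:ℝ)..T, ∫ x : ℝ,
      ((pdt T u x (clamp T s)) ^ 2 + (pdx (pdx u) x (clamp T s)) ^ 2) ≤ C :=
    integral2_le_of_intervals
      (f := fun x s => (pdt T u x (clamp T s)) ^ 2 + (pdx (pdx u) x (clamp T s)) ^ 2) hT.le hC.le
      (((MHDFlow.ofClassical h hT).cont_ut.pow 2).add ((MHDFlow.ofClassical h hT).cont_uxx.pow 2))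
      (fun x s => by positivity) fun a b hab => (key T ⟨hT.le, le_rfl⟩ a b hab).2
  have h3 : ∫ s in (0:ℝ)..T, ∫ x : ℝ, ((pdt T u x s) ^ 2 + (pdx (pdx u) x s) ^ 2)
      = ∫ s in (0:ℝ)..T, ∫ x : ℝ,
        ((pdt T u x (clamp T s)) ^ 2 + (pdx (pdx u) x (clamp T s)) ^ 2) := by
    refine intervalIntegral.integral_congr fun s hs => ?_
    rw [uIcc_of_le hT.le] at hs
    rw [clamp_of_mem hs]
  rw [h3]
  linarith
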